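/- arXiv:1904.13109 — 2 statements merged into one kernel-verified Lean document; each statement's English description precedes it below -/
import Mathlib

section
/- Let n ≥ 2 be an integer and let f ∈ ℤ[x_1,…,x_n] be a polynomial of degree d ≥ 1 that is irreducible over ℚ but not irreducible over the algebraic closure of ℚ. Then for every real B ≥ 1 one has N_aff(f,B) ≤ d^2·(2B+1)^{n−2}. -/
/-- The number of integer points `x ∈ ℤ^N` with `|x_i| ≤ B` for all `i` and `f(x) = 0`. -/
noncomputable def Naff {N : ℕ} (f : MvPolynomial (Fin N) ℤ) (B : ℝ) : ℕ :=
  Set.ncard {x : Fin N → ℤ | (∀ i, |(x i : ℝ)| ≤ B) ∧ MvPolynomial.eval x f = 0}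

section BezoutGrid

open Polynomial

theorem exists_tower (R : Type) [CommRing R] [Nontrivial R] (p : R[X]) (hp : p.Monic)
    (hd : 0 < p.natDegree) (k : ℕ) : ∀ (c : Fin k → R),
    ∃ (A : Type) (_ : CommRing A) (_ : Algebra R A) (x : Fin k → A)
      (b : Module.Basis (Fin k → Fin p.natDegree) R A),
      (∀ a, b a = ∏ j, x j ^ (a j : ℕ)) ∧
      (∀ j, aeval (x j) p = algebraMap R A (c j)) ∧
      ∀ (C : Type) [CommRing C] (φ : R →+* C) (y : Fin k → C),
        (∀ j, eval₂ φ (y j) p = φ (c j)) →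
          ∃ ψ : A →+* C, ψ.comp (algebraMap R A) = φ ∧ ∀ j, ψ (x j) = y j := by
  induction k with
  | zero =>
    intro c
    refine ⟨R, inferInstance, inferInstance, Fin.elim0, Module.Basis.singleton _ R, ?_, fun j => j.elim0, ?_⟩
    · intro a; simp
    · intro C _ φ y _
      exact ⟨φ, by ext; simp, fun j => j.elim0⟩
  | succ k ih =>
    intro c
    obtain ⟨A, _, _, x, b, hb, hx, hu⟩ := ih (fun j => c j.succ)
    have : Nonempty (Fin k → Fin p.natDegree) := ⟨fun _ => ⟨0, hd⟩⟩
    have : Nontrivial A := b.repr.toEquiv.nontrivial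
    set q : A[X] := p.map (algebraMap R A) - Polynomial.C (algebraMap R A (c 0)) with hq
    have hpm : (p.map (algebraMap R A)).Monic := hp.map _
    have hpd : (p.map (algebraMap R A)).natDegree = p.natDegree := hp.natDegree_map _
    have hqm : q.Monic := by
      apply hpm.sub_of_left
      apply lt_of_le_of_lt Polynomial.degree_C_le
      rw [← Polynomial.natDegree_pos_iff_degree_pos, hpd]; exact hd
    have hqd : q.natDegree = p.natDegree := by
      rw [hq, Polynomial.natDegree_sub_C, hpd]
    let b0 := (AdjoinRoot.powerBasis' hqm).basis
    have hdim : (AdjoinRoot.powerBasis' hqm).dim = p.natDegree := by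
      rw [AdjoinRoot.powerBasis'_dim, hqd]
    let b1 : Module.Basis (Fin p.natDegree) A (AdjoinRoot q) := b0.reindex (finCongr hdim)
    have hb1 : ∀ i, b1 i = AdjoinRoot.root q ^ (i : ℕ) := by
      intro i
      simp [b1, b0]
    let e : (Fin k → Fin p.natDegree) × Fin p.natDegree ≃ (Fin (k+1) → Fin p.natDegree) :=
      (Equiv.prodComm _ _).trans (Fin.consEquiv (fun _ => Fin p.natDegree))
    let b2 := (b.smulTower b1).reindex e
    refine ⟨AdjoinRoot q, inferInstance, inferInstance,
      Fin.cons (AdjoinRoot.root q) (fun j => AdjoinRoot.of q (x j)), b2, ?_, ?_, ?_⟩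
    · intro a
      simp only [b2, Module.Basis.reindex_apply, Module.Basis.smulTower_apply, hb1, hb]
      rw [Fin.prod_univ_succ]
      simp [e, Fin.consEquiv, Algebra.smul_def, mul_comm, Fin.tail]
    · intro j
      refine Fin.cases ?_ (fun j => ?_) j
      · have h := AdjoinRoot.eval₂_root q
        rw [hq, Polynomial.eval₂_sub, Polynomial.eval₂_C, sub_eq_zero, Polynomial.eval₂_map] at h
        simp only [Fin.cons_zero]
        rw [Polynomial.aeval_def]
        exact h
      · simp only [Fin.cons_succ]
        have := congrArg (algebraMap A (AdjoinRoot q)) (hx j)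
        rw [← Polynomial.aeval_algebraMap_apply, ← IsScalarTower.algebraMap_apply] at this
        exact this
    · intro C _ φ y hy
      obtain ⟨ψ, h1, h2⟩ := hu C φ (fun j => y j.succ) (fun j => hy j.succ)
      have h3 : q.eval₂ ψ (y 0) = 0 := by
        rw [hq, Polynomial.eval₂_sub, Polynomial.eval₂_C, sub_eq_zero, Polynomial.eval₂_map, h1, hy 0,
          ← h1]; rfl
      refine ⟨AdjoinRoot.lift ψ (y 0) h3, ?_, ?_⟩
      · rw [← h1]
        ext r
        simp only [RingHom.comp_apply, IsScalarTower.algebraMap_apply R A (AdjoinRoot q), AdjoinRoot.algebraMap_eq, AdjoinRoot.lift_of]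
      · intro j
        refine Fin.cases ?_ (fun j => ?_) j
        · simp
        · simp [h2]

theorem reg_a {A B : Type} [CommRing A] [CommRing B] [IsDomain B] (i : B →+* A)
    (hi : Function.Injective i) (f D : B) (hf : f ≠ 0)
    (hk : ∀ y : A, ∃ (k : ℕ) (b : B), i D ^ k * y = i b)
    (hD : ∀ y : A, i D * y = 0 → y = 0) (y : A) (hy : i f * y = 0) : y = 0 := by
  obtain ⟨k, b, hb⟩ := hk y
  have hDk : ∀ k : ℕ, ∀ y : A, i D ^ k * y = 0 → y = 0 := by
    intro k
    induction k with
    | zero => intro y h; simpa using h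
    | succ k ih => intro y h; exact ih _ (hD _ (by rw [← h]; ring))
  apply hDk k
  rw [hb]
  have : i (f * b) = 0 := by
    rw [map_mul, ← hb]
    linear_combination (i D ^ k) * hy
  rw [map_eq_zero_iff i hi] at this
  rcases mul_eq_zero.1 this with h | h
  · exact absurd h hf
  · simp [h]

theorem reg_b {A B : Type} [CommRing A] [CommRing B] (i : B →+* A)
    (hi : Function.Injective i) (f g D : B) (hfg : ∀ b, f ∣ g * b → f ∣ b)
    (hk : ∀ y : A, ∃ (k : ℕ) (b : B), i D ^ k * y = i b)
    (y : A) (hy : i f ∣ i g * y) : ∃ k : ℕ, i f ∣ i D ^ k * y := by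
  obtain ⟨z, hz⟩ := hy
  obtain ⟨k, b, hb⟩ := hk y
  obtain ⟨l, c, hc⟩ := hk z
  have h1 : i (g * (D ^ l * b)) = i (f * (D ^ k * c)) := by
    simp only [map_mul, map_pow, ← hb, ← hc]
    linear_combination (i D ^ k * i D ^ l) * hz
  obtain ⟨b', hb'⟩ := hfg _ ⟨_, hi h1⟩
  refine ⟨l + k, i b', ?_⟩
  rw [← map_mul, ← hb', pow_add, mul_assoc, hb]
  simp

theorem reg_c {R A I : Type} [CommRing R] [IsDomain R] [DecompositionMonoid R] [CommRing A]
    [Algebra R A] (b : Module.Basis I R A) (U V : R) (hU : U ≠ 0) (hUV : IsRelPrime U V) (F : A)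
    (hF : ∀ y, F * y = 0 → y = 0) (y : A) (h1 : F ∣ algebraMap R A U * y)
    (h2 : F ∣ algebraMap R A V * y) : F ∣ y := by
  obtain ⟨α, hα⟩ := h1
  obtain ⟨β, hβ⟩ := h2
  have h3 : V • α = U • β := by
    rw [← sub_eq_zero]
    apply hF
    simp only [Algebra.smul_def]
    linear_combination (-algebraMap R A V) * hα + (algebraMap R A U) * hβ
  have h4 : ∀ j, U ∣ b.repr α j := by
    intro j
    have := congrArg (fun t => b.repr t j) h3
    simp only [map_smul, Finsupp.smul_apply, smul_eq_mul] at this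
    exact hUV.dvd_of_dvd_mul_left ⟨_, this⟩
  choose γ hγ using h4
  have hγ0 : ∀ j, b.repr α j = 0 → γ j = 0 := by
    intro j hj
    rw [hγ] at hj
    exact (mul_eq_zero.1 hj).resolve_left hU
  have : Module.IsTorsionFree R A := b.isTorsionFree
  let G : I →₀ R := Finsupp.onFinset (b.repr α).support γ (by
    intro j hj; rw [Finsupp.mem_support_iff]; exact fun h => hj (hγ0 j h))
  have hG : α = U • b.repr.symm G := by
    apply b.repr.injective
    ext j
    simp [G, hγ]
  refine ⟨b.repr.symm G, ?_⟩
  have h5 : U • (y - F * b.repr.symm G) = 0 := by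
    rw [smul_sub, sub_eq_zero, ← mul_smul_comm, ← hG, ← hα, Algebra.smul_def]
  rw [← sub_eq_zero]
  exact (smul_eq_zero.1 h5).resolve_left hU

theorem count {L A I Q : Type} [CommRing L] [IsDomain L] [CommRing A] [Algebra L A] [Fintype Q]
    [DecidableEq Q]
    (β : Module.Basis I L A) (lev : ℕ → Finset I)
    (f g : A) (d e m0 : ℕ)
    (hmono : ∀ m n, m ≤ n → lev m ⊆ lev n)
    (hf : ∀ m, ∀ y ∈ Submodule.span L (β '' (lev m : Set I)),
      f * y ∈ Submodule.span L (β '' (lev (m + d) : Set I)))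
    (hg : ∀ m, ∀ y ∈ Submodule.span L (β '' (lev m : Set I)),
      g * y ∈ Submodule.span L (β '' (lev (m + e) : Set I)))
    (hf0 : ∀ y, f * y = 0 → y = 0) (hfg : ∀ y, f ∣ g * y → f ∣ y)
    (ev : Q → (A →ₐ[L] L)) (hevf : ∀ q, ev q f = 0) (hevg : ∀ q, ev q g = 0)
    (w : Q → A) (hw : ∀ q, w q ∈ Submodule.span L (β '' (lev m0 : Set I)))
    (hw1 : ∀ q, ev q (w q) ≠ 0) (hw2 : ∀ p q, p ≠ q → ev q (w p) = 0)
    (T m : ℕ) (hm : m0 + T * e ≤ m + d) :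
    T * Fintype.card Q + (lev m).card ≤ (lev (m + d)).card := by
  classical
  have key : ∀ T : ℕ, ∀ (c : Fin T → Q → L) (y : A),
      ∑ t : Fin T, g ^ (t : ℕ) * ∑ q, c t q • w q = f * y → ∀ t q, c t q = 0 := by
    intro T
    induction T with
    | zero => intro c y _ t; exact t.elim0
    | succ T ih =>
      intro c y h
      rw [Fin.sum_univ_succ] at h
      have h0 : ∀ q, c 0 q = 0 := by
        intro q
        have := congrArg (ev q) h
        simp only [map_add, map_mul, map_sum, map_smul, hevf, map_pow, hevg] at this
        simp only [Fin.val_zero, pow_zero, one_mul, Fin.val_succ, zero_mul] at this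
        rw [Finset.sum_eq_single q (fun p _ hp => by simp [hw2 p q hp]) (by simp)] at this
        simpa [hw1] using this
      have h1 : f ∣ g * ∑ t : Fin T, g ^ (t : ℕ) * ∑ q, c t.succ q • w q := by
        refine ⟨y, ?_⟩
        rw [← h]
        simp [h0, Finset.mul_sum, pow_succ]
        refine Finset.sum_congr rfl fun t _ => Finset.sum_congr rfl fun q _ => ?_
        ring_nf
      obtain ⟨y', hy'⟩ := hfg _ h1
      have h2 := ih (fun t => c t.succ) y' hy'
      intro t
      exact Fin.cases h0 (fun t => h2 t) t
  let v : (Fin T × Q) ⊕ (lev m) → A :=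
    Sum.elim (fun tq => g ^ (tq.1 : ℕ) * w tq.2) (fun i => f * β i)
  have hv : LinearIndependent L v := by
    rw [Fintype.linearIndependent_iff]
    intro c hc
    rw [Fintype.sum_sum_type] at hc
    simp only [v, Sum.elim_inl, Sum.elim_inr] at hc
    have h1 : ∑ t : Fin T, g ^ (t : ℕ) * ∑ q, c (Sum.inl (t, q)) • w q
        = f * (-∑ i : lev m, c (Sum.inr i) • β i) := by
      rw [mul_neg, eq_neg_iff_add_eq_zero, ← hc, Fintype.sum_prod_type]
      simp only [Finset.mul_sum, mul_smul_comm]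
    have h2 := key T (fun t q => c (Sum.inl (t, q))) _ h1
    have h3 : ∑ i : lev m, c (Sum.inr i) • β i = 0 := by
      rw [← neg_eq_zero]
      apply hf0
      rw [← h1]
      simp [h2]
    have h4 := Fintype.linearIndependent_iff.1
      (β.linearIndependent.comp (fun i : lev m => (i : I)) Subtype.val_injective)
      (fun i => c (Sum.inr i)) h3
    rintro (⟨t, q⟩ | i)
    · exact h2 t q
    · exact h4 i
  have hmon : ∀ a b, a ≤ b → Submodule.span L (β '' (lev a : Set I)) ≤
      Submodule.span L (β '' (lev b : Set I)) := fun a b h =>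
    Submodule.span_mono (Set.image_mono (by exact_mod_cast hmono a b h))
  have hgp : ∀ t : ℕ, ∀ q, g ^ t * w q ∈ Submodule.span L (β '' (lev (m0 + t * e) : Set I)) := by
    intro t q
    induction t with
    | zero => simpa using hw q
    | succ t ih =>
      have := hg _ _ ih
      rw [pow_succ', mul_assoc]
      convert this using 5
      ring
  have hspan : Set.range v ≤ Submodule.span L (((lev (m + d)).image β : Finset A) : Set A) := by
    rw [Finset.coe_image]
    rintro _ ⟨(⟨t, q⟩ | i), rfl⟩
    · refine hmon _ _ (le_trans ?_ hm) (hgp t q)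
      have := t.2
      gcongr
    · exact hf m _ (Submodule.subset_span ⟨i, i.2, rfl⟩)
  have h5 := linearIndependent_le_span_aux' v hv _ hspan
  have h6 := (h5.trans_eq (Fintype.card_coe _)).trans Finset.card_image_le
  simpa using h6

abbrev Lam (K : Type) [Field K] (k : ℕ) := MvPolynomial (Bool × Fin k) K
abbrev RR (K : Type) [Field K] (k : ℕ) := MvPolynomial Bool (Lam K k)

noncomputable def cc {K : Type} [Field K] {k : ℕ} (P : K[X]) (j : Fin k) : RR K k :=
  ∑ b : Bool, MvPolynomial.C (MvPolynomial.X (b, j)) * aeval (MvPolynomial.X b) P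

theorem cc_eq {K : Type} [Field K] {k : ℕ} (P : K[X]) (j : Fin k) (b : Bool) :
    cc P j = MvPolynomial.C (MvPolynomial.X (b, j)) * aeval (MvPolynomial.X b) P +
      MvPolynomial.C (MvPolynomial.X (!b, j)) * aeval (MvPolynomial.X (!b)) P := by
  cases b <;> simp [cc, add_comm]

/-- the tower data -/
structure Tow (K : Type) [Field K] (k : ℕ) (P : K[X]) (A : Type) [CommRing A]
    [Algebra (RR K k) A] [Algebra K A] where
  x : Fin k → A
  b : Module.Basis (Fin k → Fin P.natDegree) (RR K k) A
  hb : ∀ a, b a = ∏ j, x j ^ (a j : ℕ)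
  hx : ∀ j, aeval (x j) P = algebraMap (RR K k) A (cc P j)
  hu : ∀ (C : Type) [CommRing C] (φ : RR K k →+* C) (y : Fin k → C),
        (∀ j, eval₂ (φ.comp (algebraMap K (RR K k))) (y j) P = φ (cc P j)) →
          ∃ ψ : A →+* C, ψ.comp (algebraMap (RR K k) A) = φ ∧ ∀ j, ψ (x j) = y j

set_option linter.unusedSectionVars false

namespace Tow

variable {K : Type} [Field K] {k : ℕ} {P : K[X]} {A : Type} [CommRing A]
    [Algebra (RR K k) A] [Algebra K A] [IsScalarTower K (RR K k) A]
    [Algebra (Lam K k) A] [IsScalarTower (Lam K k) (RR K k) A] (t : Tow K k P A)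

/-- the coordinates -/
noncomputable def z : Fin k ⊕ Bool → A :=
  Sum.elim t.x (fun b => algebraMap (RR K k) A (MvPolynomial.X b))


theorem gen (T : Subring A) (h0 : ∀ r : K, algebraMap K A r ∈ T) (h1 : ∀ i, t.z i ∈ T)
    (h2 : ∀ i, algebraMap (RR K k) A (MvPolynomial.C (MvPolynomial.X i)) ∈ T) (y : A) : y ∈ T := by
  have hL : ∀ l : Lam K k, algebraMap (RR K k) A (MvPolynomial.C l) ∈ T := by
    intro l
    induction l using MvPolynomial.induction_on with
    | C a =>
      have := h0 a
      rw [IsScalarTower.algebraMap_apply K (RR K k) A] at this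
      exact this
    | add p q hp hq => rw [map_add, map_add]; exact T.add_mem hp hq
    | mul_X p n hp => rw [map_mul, map_mul]; exact T.mul_mem hp (h2 n)
  have hR : ∀ r : RR K k, algebraMap (RR K k) A r ∈ T := by
    intro l
    induction l using MvPolynomial.induction_on with
    | C a => exact hL a
    | add p q hp hq => rw [map_add]; exact T.add_mem hp hq
    | mul_X p n hp => rw [map_mul]; exact T.mul_mem hp (h1 (Sum.inr n))
  rw [← t.b.sum_repr y]
  refine T.sum_mem fun a _ => ?_
  rw [Algebra.smul_def, t.hb]
  exact T.mul_mem (hR _) (T.prod_mem fun j _ => T.pow_mem (h1 (Sum.inl j)) _)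

/-- embedding of the localised model -/
noncomputable def iB (b : Bool) : MvPolynomial (Fin k) (MvPolynomial (Fin k ⊕ Bool) K) →+* A :=
  MvPolynomial.eval₂Hom (MvPolynomial.aeval t.z : MvPolynomial (Fin k ⊕ Bool) K →ₐ[K] A).toRingHom
    (fun j => algebraMap (RR K k) A (MvPolynomial.C (MvPolynomial.X (!b, j))))

theorem iB_C (b : Bool) (F : MvPolynomial (Fin k ⊕ Bool) K) :
    t.iB b (MvPolynomial.C F) = MvPolynomial.aeval t.z F := by
  simp [iB]

noncomputable def DD (k : ℕ) (P : K[X]) (b : Bool) : MvPolynomial (Fin k ⊕ Bool) K :=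
  aeval (MvPolynomial.X (Sum.inr b)) P

theorem aeval_DD (b : Bool) :
    MvPolynomial.aeval t.z (DD k P b) = algebraMap (RR K k) A (aeval (MvPolynomial.X b) P) := by
  rw [DD, ← Polynomial.aeval_algHom_apply, MvPolynomial.aeval_X, ← Polynomial.aeval_algebraMap_apply]
  rfl

theorem iB_surj (b : Bool) (y : A) : ∃ (n : ℕ) (c : _),
    t.iB b (MvPolynomial.C (DD k P b)) ^ n * y = t.iB b c := by
  let T : Subring A :=
    { carrier := {y | ∃ (n : ℕ) (c : _), t.iB b (MvPolynomial.C (DD k P b)) ^ n * y = t.iB b c}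
      zero_mem' := ⟨0, 0, by simp⟩
      one_mem' := ⟨0, 1, by simp⟩
      neg_mem' := by
        rintro y ⟨n, c, h⟩
        exact ⟨n, -c, by rw [map_neg, ← h]; ring⟩
      add_mem' := by
        rintro y y' ⟨n, c, h⟩ ⟨n', c', h'⟩
        refine ⟨n + n', MvPolynomial.C (DD k P b) ^ n' * c + MvPolynomial.C (DD k P b) ^ n * c', ?_⟩
        rw [map_add, map_mul, map_mul, ← h, ← h', map_pow, map_pow]; ring
      mul_mem' := by
        rintro y y' ⟨n, c, h⟩ ⟨n', c', h'⟩
        refine ⟨n + n', c * c', ?_⟩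
        rw [map_mul, ← h, ← h']; ring }
  refine t.gen T ?_ ?_ ?_ y
  · intro r
    refine ⟨0, MvPolynomial.C (MvPolynomial.C r), ?_⟩
    rw [pow_zero, one_mul, iB_C]; simp
  · intro i
    refine ⟨0, MvPolynomial.C (MvPolynomial.X i), ?_⟩
    rw [pow_zero, one_mul, iB_C]; simp
  · rintro ⟨c, j⟩
    by_cases hc : c = b
    · subst hc
      refine ⟨1, MvPolynomial.C (aeval (MvPolynomial.X (Sum.inl j)) P) -
        MvPolynomial.X j * MvPolynomial.C (DD k P (!c)), ?_⟩
      rw [map_sub, map_mul, iB_C, iB_C, iB_C, aeval_DD, aeval_DD]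
      have h4 : MvPolynomial.aeval t.z
          (aeval (MvPolynomial.X (Sum.inl j) : MvPolynomial (Fin k ⊕ Bool) K) P) =
          aeval (t.z (Sum.inl j)) P := by
        rw [← Polynomial.aeval_algHom_apply, MvPolynomial.aeval_X]
      have := t.hx j
      rw [cc_eq P j c, map_add, map_mul, map_mul] at this
      have h2 : t.z (Sum.inl j) = t.x j := rfl
      have h3 : t.iB c (MvPolynomial.X j) =
        algebraMap (RR K k) A (MvPolynomial.C (MvPolynomial.X (!c, j))) := by simp [iB]
      rw [h4, h2, this, h3]
      ring
    · have : c = !b := by cases c <;> cases b <;> simp_all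
      subst this
      refine ⟨0, MvPolynomial.X j, ?_⟩
      simp [iB]

theorem iB_inj (b : Bool) (hP : DD k P b ≠ 0) : Function.Injective (t.iB b) := by
  let B := MvPolynomial (Fin k) (MvPolynomial (Fin k ⊕ Bool) K)
  let F := FractionRing B
  let e : MvPolynomial (Fin k ⊕ Bool) K →+* F := (algebraMap B F).comp MvPolynomial.C
  have he : ∀ r, eval₂ (e.comp MvPolynomial.C) (e (MvPolynomial.X r)) P =
      e (aeval (MvPolynomial.X r) P) := by
    intro r
    rw [Polynomial.aeval_def, Polynomial.hom_eval₂]; rfl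
  let φ0 : Lam K k →+* F := MvPolynomial.eval₂Hom (e.comp MvPolynomial.C)
    (fun cj => if cj.1 = b then (e (aeval (MvPolynomial.X (Sum.inl cj.2)) P) -
      algebraMap B F (MvPolynomial.X cj.2) * e (DD k P (!b))) / e (DD k P b)
      else algebraMap B F (MvPolynomial.X cj.2))
  let φ : RR K k →+* F := MvPolynomial.eval₂Hom φ0 (fun c => e (MvPolynomial.X (Sum.inr c)))
  have hφK : φ.comp (algebraMap K (RR K k)) = e.comp MvPolynomial.C := by
    ext r
    have : algebraMap K (RR K k) r = MvPolynomial.C (MvPolynomial.C r) := rfl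
    rw [RingHom.comp_apply, this]
    simp only [φ, φ0, MvPolynomial.coe_eval₂Hom, MvPolynomial.eval₂_C]
  have hφP : ∀ c, φ (aeval (MvPolynomial.X c) P) = e (DD k P c) := by
    intro c
    rw [Polynomial.aeval_def, Polynomial.hom_eval₂, hφK, DD, ← he]
    simp [φ]
  have heD : e (DD k P b) ≠ 0 := by
    intro h
    apply hP
    have h1 := (IsFractionRing.injective B F) (h.trans (map_zero _).symm)
    exact (MvPolynomial.C_injective _ _) (h1.trans (map_zero _).symm)
  obtain ⟨ψ, h1, h2⟩ := t.hu F φ (fun j => e (MvPolynomial.X (Sum.inl j))) (by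
    intro j
    rw [hφK, he, cc_eq P j b, map_add, map_mul, map_mul, hφP, hφP]
    have hb : (!b) ≠ b := by cases b <;> simp
    simp only [φ, φ0, MvPolynomial.coe_eval₂Hom, MvPolynomial.eval₂_C, MvPolynomial.eval₂_X, if_true, hb, if_false]
    rw [div_mul_cancel₀ _ heD]; ring)
  have h3 : ψ.comp (t.iB b) = algebraMap B F := by
    have h1' : ∀ r, ψ (algebraMap _ A r) = φ r := fun r => by rw [← h1]; rfl
    apply MvPolynomial.ringHom_ext
    · intro G
      rw [RingHom.comp_apply, iB_C]
      have : (ψ.comp (MvPolynomial.aeval t.z : _ →ₐ[K] A).toRingHom) = e := by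
        apply MvPolynomial.ringHom_ext
        · intro r
          simp only [RingHom.comp_apply, AlgHom.toRingHom_eq_coe, RingHom.coe_coe, MvPolynomial.aeval_C]
          rw [IsScalarTower.algebraMap_apply K (RR K k) A, h1']
          exact DFunLike.congr_fun hφK r
        · rintro (j | c)
          · simpa [z] using h2 j
          · simp [z, h1', φ]
      exact DFunLike.congr_fun this G
    · intro j
      have hb : (!b) ≠ b := by cases b <;> simp
      simp [iB, h1', φ, φ0]
  have h4 : Function.Injective (ψ.comp (t.iB b)) := by
    rw [h3]; exact IsFractionRing.injective B F
  exact Function.Injective.of_comp h4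


/-- index weights -/
noncomputable def wt {s : ℕ} (i : (Bool →₀ ℕ) × (Fin k → Fin s)) : ℕ := i.1.degree + ∑ j, (i.2 j : ℕ)

theorem lev_finite (k s m : ℕ) : {i : (Bool →₀ ℕ) × (Fin k → Fin s) | wt i ≤ m}.Finite := by
  have h : Function.Injective (fun i : (Bool →₀ ℕ) × (Fin k → Fin s) =>
      (i.1 true, i.1 false, i.2)) := by
    rintro ⟨e, a⟩ ⟨e', a'⟩ h
    simp only [Prod.mk.injEq] at h
    obtain ⟨h1, h2, h3⟩ := h
    simp only [Prod.mk.injEq, h3, and_true]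
    ext c; cases c <;> assumption
  refine Set.Finite.of_finite_image (f := fun i => (i.1 true, i.1 false, i.2)) ?_ h.injOn
  refine Set.Finite.subset ((Set.finite_Iic m).prod ((Set.finite_Iic m).prod Set.finite_univ)) ?_
  rintro _ ⟨⟨e, a⟩, h, rfl⟩
  simp only [Set.mem_ofPred_eq, wt, Finsupp.degree_eq_sum, Fintype.sum_bool] at h
  simp only [Set.mem_prod, Set.mem_Iic, Set.mem_univ, and_true]
  omega

noncomputable def lev (k s m : ℕ) : Finset ((Bool →₀ ℕ) × (Fin k → Fin s)) :=
  (lev_finite k s m).toFinset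

theorem mem_lev {k s m : ℕ} (i) : i ∈ lev k s m ↔ wt i ≤ m := by simp [lev]

theorem lev_card (k s m d : ℕ) :
    (lev k s (m + d)).card ≤ (lev k s m).card + s ^ k * d * (m + d + 1) := by
  classical
  have h1 : (lev k s (m + d) \ lev k s m).card ≤ s ^ k * d * (m + d + 1) := by
    have := Finset.card_le_card_of_injOn (s := lev k s (m + d) \ lev k s m)
      (t := ((Finset.univ : Finset (Fin k → Fin s)) ×ˢ Finset.range d) ×ˢ Finset.range (m + d + 1))
      (fun i => ((i.2, wt i - m - 1), i.1 true)) (by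
        rintro ⟨e, a⟩ h
        simp only [Finset.coe_sdiff, Set.mem_sdiff, Finset.mem_coe, mem_lev] at h
        have h2 : e true ≤ wt (e, a) := by
          simp only [wt, Finsupp.degree_eq_sum, Fintype.sum_bool]; omega
        simp only [Finset.coe_product, Set.mem_prod, Finset.mem_coe, Finset.mem_univ, Finset.mem_range, true_and]
        omega) (by
        rintro ⟨e, a⟩ h ⟨e', a'⟩ h' heq
        simp only [Finset.coe_sdiff, Set.mem_sdiff, Finset.mem_coe, mem_lev] at h h'
        simp only [Prod.mk.injEq] at heq
        obtain ⟨⟨rfl, h3⟩, h4⟩ := heq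
        have h5 : wt (e, a) = wt (e', a) := by omega
        simp only [wt, Finsupp.degree_eq_sum, Fintype.sum_bool] at h5
        simp only [Prod.mk.injEq, and_true]
        ext c; cases c <;> omega)
    simpa using this
  have h2 : lev k s m ⊆ lev k s (m + d) := by
    intro i; simp only [mem_lev]; omega
  have := Finset.card_sdiff_add_card_eq_card h2
  omega

/-- the basis over the parameter ring -/
noncomputable def bas : Module.Basis ((Bool →₀ ℕ) × (Fin k → Fin P.natDegree)) (Lam K k) A :=
  (MvPolynomial.basisMonomials Bool (Lam K k)).smulTower t.b

/-- monomials -/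
noncomputable def mon (e : Bool →₀ ℕ) (a : Fin k → ℕ) : A :=
  algebraMap (RR K k) A (MvPolynomial.monomial e 1) * ∏ j, t.x j ^ a j

theorem bas_apply (i) : t.bas i = t.mon i.1 (fun j => (i.2 j : ℕ)) := by
  rw [bas, Module.Basis.smulTower_apply, t.hb, Algebra.smul_def]
  simp [mon]

/-- the filtration -/
noncomputable def Fil (m : ℕ) : Submodule (Lam K k) A :=
  Submodule.span (Lam K k) (t.bas '' (lev k P.natDegree m : Set _))

theorem Fil_mono {m n : ℕ} (h : m ≤ n) : t.Fil m ≤ t.Fil n := by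
  apply Submodule.span_mono
  apply Set.image_mono
  intro i
  simp only [Finset.mem_coe, mem_lev]
  omega

theorem mon_mul (e e' : Bool →₀ ℕ) (a a' : Fin k → ℕ) :
    t.mon e a * t.mon e' a' = t.mon (e + e') (a + a') := by
  have : (MvPolynomial.monomial (e + e') (1 : Lam K k)) =
    MvPolynomial.monomial e 1 * MvPolynomial.monomial e' 1 := by
    rw [MvPolynomial.monomial_mul, one_mul]
  simp only [mon, this, map_mul, Pi.add_apply, pow_add, Finset.prod_mul_distrib]
  ring

theorem mon_x (j : Fin k) (i : ℕ) : t.mon 0 (Pi.single j i) = t.x j ^ i := by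
  rw [mon, Finset.prod_eq_single j]
  · simp
  · intro l _ hl; simp [Pi.single_eq_of_ne hl]
  · simp

theorem mon_u (b : Bool) (i : ℕ) :
    t.mon (Finsupp.single b i) 0 = algebraMap (RR K k) A (MvPolynomial.X b) ^ i := by
  rw [mon, ← map_pow, MvPolynomial.X_pow_eq_monomial]
  simp

theorem algebraMap_K_smul (r : K) (y : A) : algebraMap K A r * y = (MvPolynomial.C r : Lam K k) • y := by
  rw [Algebra.smul_def, IsScalarTower.algebraMap_apply K (RR K k) A,
    IsScalarTower.algebraMap_apply (Lam K k) (RR K k) A]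
  rfl

theorem mon_mem (hP : P.Monic) (hP0 : 0 < P.natDegree) : ∀ (N : ℕ) (e : Bool →₀ ℕ) (a : Fin k → ℕ),
    ∑ j, a j = N → t.mon e a ∈ t.Fil (e.degree + ∑ j, a j) := by
  intro N
  induction N using Nat.strong_induction_on with
  | _ N ih =>
    intro e a hN
    by_cases hs : ∀ j, a j < P.natDegree
    · apply Submodule.subset_span
      refine ⟨(e, fun j => ⟨a j, hs j⟩), ?_, ?_⟩
      · simp [mem_lev, wt]
      · rw [bas_apply]
    · push Not at hs
      obtain ⟨j, hj⟩ := hs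
      set s := P.natDegree with hsdef
      obtain ⟨a', ha'⟩ : ∃ a' : Fin k → ℕ, a = a' + Pi.single j s := by
        refine ⟨a - Pi.single j s, ?_⟩
        ext l
        by_cases hl : l = j
        · subst hl; simp; omega
        · simp [Pi.single_eq_of_ne hl]
      have hsum : ∀ i, ∑ l, (a' + Pi.single j i : Fin k → ℕ) l = ∑ l, a' l + i := by
        intro i
        simp [Finset.sum_add_distrib]
      have hN' : ∑ l, a' l + s = N := by rw [← hsum, ← ha', hN]
      have hpow : t.x j ^ s = algebraMap (RR K k) A (cc P j) -
          ∑ i ∈ Finset.range s, algebraMap K A (P.coeff i) * t.x j ^ i := by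
        rw [← t.hx j, Polynomial.aeval_eq_sum_range, ← hsdef, Finset.sum_range_succ]
        have : P.coeff s = 1 := hP
        simp only [this, map_one, Algebra.smul_def]
        ring
      have h1 : t.mon e a = t.mon e a' * algebraMap (RR K k) A (cc P j) -
          ∑ i ∈ Finset.range s, (MvPolynomial.C (P.coeff i) : Lam K k) • t.mon e (a' + Pi.single j i) := by
        have h2 : t.mon e a = t.mon e a' * t.x j ^ s := by
          rw [← mon_x, mon_mul, add_zero, ← ha']
        rw [h2, hpow, mul_sub, Finset.mul_sum]
        congr 1
        refine Finset.sum_congr rfl fun i _ => ?_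
        rw [← algebraMap_K_smul, ← mon_x, mul_left_comm, mon_mul, add_zero]
      rw [h1, hN]
      refine Submodule.sub_mem _ ?_ ?_
      · rw [cc, map_sum, Finset.mul_sum]
        refine Submodule.sum_mem _ fun b _ => ?_
        rw [map_mul, ← Polynomial.aeval_algebraMap_apply, Polynomial.aeval_eq_sum_range, mul_left_comm]
        have h3 : ∀ y : A, algebraMap (RR K k) A (MvPolynomial.C (MvPolynomial.X (b, j))) * y =
            (MvPolynomial.X (b, j) : Lam K k) • y := by
          intro y
          rw [Algebra.smul_def, IsScalarTower.algebraMap_apply (Lam K k) (RR K k) A]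
          rfl
        rw [h3]
        refine Submodule.smul_mem _ _ ?_
        rw [Finset.mul_sum]
        refine Submodule.sum_mem _ fun i hi => ?_
        rw [Finset.mem_range, ← hsdef] at hi
        rw [Algebra.smul_def, mul_left_comm, algebraMap_K_smul (k := k)]
        refine Submodule.smul_mem _ _ ?_
        rw [← mon_u, mon_mul, add_zero]
        refine t.Fil_mono ?_ (ih (∑ l, a' l) (by omega) _ a' rfl)
        rw [map_add, Finsupp.degree_single]
        omega
      · refine Submodule.sum_mem _ fun i hi => ?_
        rw [Finset.mem_range] at hi
        refine Submodule.smul_mem _ _ ?_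
        refine t.Fil_mono ?_ (ih (∑ l, a' l + i) (by omega) _ _ (hsum i))
        rw [hsum]
        omega

theorem aeval_monomial' (n : Fin k ⊕ Bool →₀ ℕ) (r : K) :
    ∃ (e : Bool →₀ ℕ) (a : Fin k → ℕ), e.degree + ∑ j, a j = n.degree ∧
      MvPolynomial.aeval t.z (MvPolynomial.monomial n r) = (MvPolynomial.C r : Lam K k) • t.mon e a := by
  refine ⟨n.comapDomain Sum.inr (Sum.inr_injective.injOn), fun j => n (Sum.inl j), ?_, ?_⟩
  · simp [Finsupp.degree_eq_sum, add_comm]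
  · rw [MvPolynomial.aeval_monomial, ← algebraMap_K_smul, Finsupp.prod_fintype _ _ (by simp),
      Fintype.prod_sum_type, mon, MvPolynomial.monomial_eq, map_mul]
    rw [Finsupp.prod_fintype _ _ (by simp)]
    simp [z, mul_comm]

theorem mul_mem_Fil (hP : P.Monic) (hP0 : 0 < P.natDegree) (f : MvPolynomial (Fin k ⊕ Bool) K)
    (m : ℕ) (y : A) (hy : y ∈ t.Fil m) :
    MvPolynomial.aeval t.z f * y ∈ t.Fil (m + f.totalDegree) := by
  rw [Fil] at hy
  induction hy using Submodule.span_induction with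
  | mem y h =>
    obtain ⟨i, hi, rfl⟩ := h
    rw [Finset.mem_coe, mem_lev] at hi
    rw [f.as_sum, map_sum, Finset.sum_mul, ← f.as_sum]
    refine Submodule.sum_mem _ fun n hn => ?_
    obtain ⟨e, a, h1, h2⟩ := t.aeval_monomial' n (f.coeff n)
    rw [h2, smul_mul_assoc]
    refine Submodule.smul_mem _ _ ?_
    rw [bas_apply, mon_mul]
    refine t.Fil_mono ?_ (t.mon_mem hP hP0 _ _ _ rfl)
    have h3 := MvPolynomial.le_totalDegree hn
    simp only [wt] at hi
    have h4 : n.degree = n.sum fun _ e => e := rfl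
    simp only [map_add, Pi.add_apply, Finset.sum_add_distrib]
    omega
  | zero => simp
  | add y y' _ _ h h' => rw [mul_add]; exact Submodule.add_mem _ h h'
  | smul c y _ h => rw [mul_smul_comm]; exact Submodule.smul_mem _ _ h

theorem one_mem_Fil (hP : P.Monic) (hP0 : 0 < P.natDegree) : (1 : A) ∈ t.Fil 0 := by
  have := t.mon_mem hP hP0 0 0 0 (by simp)
  simpa [mon] using this

/-- evaluation at a grid point -/
theorem exists_ev (p : Fin k ⊕ Bool → K) (hp : ∀ i, P.eval (p i) = 0) :
    ∃ ev : A →ₐ[Lam K k] Lam K k, ∀ f, ev (MvPolynomial.aeval t.z f) = MvPolynomial.C (MvPolynomial.eval p f) := by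
  let φ : RR K k →+* Lam K k := MvPolynomial.eval₂Hom (RingHom.id _) (fun b => MvPolynomial.C (p (Sum.inr b)))
  have hφK : φ.comp (algebraMap K (RR K k)) = MvPolynomial.C := by
    ext1 r
    have : algebraMap K (RR K k) r = MvPolynomial.C (MvPolynomial.C r) := rfl
    rw [RingHom.comp_apply, this]
    simp only [φ, MvPolynomial.coe_eval₂Hom, MvPolynomial.eval₂_C, RingHom.id_apply]
  have hC : ∀ i, eval₂ (MvPolynomial.C : K →+* Lam K k) (MvPolynomial.C (p i)) P = 0 := by
    intro i
    rw [Polynomial.eval₂_at_apply, hp, map_zero]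
  obtain ⟨ψ, h1, h2⟩ := t.hu (Lam K k) φ (fun j => MvPolynomial.C (p (Sum.inl j))) (by
    intro j
    rw [hφK, hC, cc, map_sum]
    symm
    apply Finset.sum_eq_zero
    intro b _
    rw [map_mul, Polynomial.aeval_def, Polynomial.hom_eval₂, hφK]
    have : φ (MvPolynomial.X b) = MvPolynomial.C (p (Sum.inr b)) := by simp [φ]
    rw [this, hC, mul_zero])
  have h1' : ∀ r, ψ (algebraMap _ A r) = φ r := fun r => by rw [← h1]; rfl
  refine ⟨{ ψ with commutes' := ?_ }, ?_⟩
  · intro l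
    change ψ _ = l
    rw [IsScalarTower.algebraMap_apply (Lam K k) (RR K k) A, h1']
    exact MvPolynomial.eval₂_C _ _ _
  · intro f
    change (ψ.comp (MvPolynomial.aeval t.z : _ →ₐ[K] A).toRingHom) f =
      ((MvPolynomial.C).comp (MvPolynomial.eval p)) f
    congr 1
    apply MvPolynomial.ringHom_ext
    · intro r
      simp only [RingHom.comp_apply, AlgHom.toRingHom_eq_coe, RingHom.coe_coe, MvPolynomial.aeval_C, MvPolynomial.eval_C]
      rw [IsScalarTower.algebraMap_apply K (RR K k) A, h1']
      exact DFunLike.congr_fun hφK r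
    · rintro (j | c)
      · simpa [z] using h2 j
      · simp [z, h1', φ]

end Tow

theorem relprime_lin {L : Type} [CommRing L] [IsDomain L] (b b' : Bool) (h : b ≠ b') (s s' : L) :
    IsRelPrime (MvPolynomial.X b - MvPolynomial.C s : MvPolynomial Bool L)
      (MvPolynomial.X b' - MvPolynomial.C s') := by
  have hdeg : ∀ (c : Bool) (r : L),
      (MvPolynomial.X c - MvPolynomial.C r : MvPolynomial Bool L).totalDegree = 1 := by
    intro c r
    rw [sub_eq_add_neg, ← map_neg, MvPolynomial.totalDegree_add_eq_left_of_totalDegree_lt]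
    · simp
    · simp
  have hirr : Irreducible (MvPolynomial.X b - MvPolynomial.C s : MvPolynomial Bool L) := by
    apply MvPolynomial.irreducible_of_totalDegree_eq_one (hdeg b s)
    intro x hx
    have := hx (Finsupp.single b 1)
    have h2 : MvPolynomial.coeff (Finsupp.single b 1)
      (MvPolynomial.X b - MvPolynomial.C s : MvPolynomial Bool L) = 1 := by
      rw [MvPolynomial.coeff_sub, MvPolynomial.coeff_X, MvPolynomial.coeff_C, if_pos rfl, if_neg,
        sub_zero]
      intro h0
      have := DFunLike.congr_fun h0 b
      simp at this
    rw [h2] at this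
    exact isUnit_of_dvd_one this
  rw [Irreducible.isRelPrime_iff_not_dvd hirr]
  rintro ⟨q, hq⟩
  have := congrArg (MvPolynomial.eval (fun c => if c = b then s else s' + 1)) hq
  simp [h.symm] at this

theorem relprime_P {K : Type} [Field K] {k : ℕ} (S : Finset K) (b b' : Bool) (h : b ≠ b') (n m : ℕ) :
    IsRelPrime ((aeval (MvPolynomial.X b : RR K k) (∏ s ∈ S, (X - C s))) ^ n)
      ((aeval (MvPolynomial.X b' : RR K k) (∏ s ∈ S, (X - C s))) ^ m) := by
  apply IsRelPrime.pow
  rw [map_prod, map_prod]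
  refine IsRelPrime.prod_left fun i _ => IsRelPrime.prod_right fun j _ => ?_
  simp only [map_sub, aeval_X, aeval_C]
  exact relprime_lin b b' h _ _

theorem exists_sep {K σ : Type} [Field K] [DecidableEq σ] [Fintype σ] (Q : Finset (σ → K)) (p : σ → K) :
    ∃ w : MvPolynomial σ K, MvPolynomial.eval p w ≠ 0 ∧ ∀ q ∈ Q, q ≠ p → MvPolynomial.eval q w = 0 := by
  classical
  have h : ∀ q : σ → K, ∃ l : MvPolynomial σ K, q ≠ p → MvPolynomial.eval p l ≠ 0 ∧
      MvPolynomial.eval q l = 0 := by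
    intro q
    by_cases hq : q = p
    · exact ⟨0, fun h => absurd hq h⟩
    · obtain ⟨i, hi⟩ := Function.ne_iff.1 hq
      refine ⟨MvPolynomial.X i - MvPolynomial.C (q i), fun _ => ⟨?_, ?_⟩⟩
      · simpa [sub_eq_zero] using Ne.symm hi
      · simp
  choose l hl using h
  refine ⟨∏ q ∈ Q.erase p, l q, ?_, ?_⟩
  · rw [map_prod, Finset.prod_ne_zero_iff]
    intro q hq
    exact (hl q (Finset.ne_of_mem_erase hq)).1
  · intro q hq hqp
    rw [map_prod]
    exact Finset.prod_eq_zero (Finset.mem_erase.2 ⟨hqp, hq⟩) (hl q hqp).2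

theorem bezout_grid {K : Type} [Field K] (k : ℕ) (S : Finset K) (hS : S.Nonempty)
    (f g : MvPolynomial (Fin k ⊕ Bool) K) (hf : f ≠ 0) (hfg : IsRelPrime f g)
    (Q : Finset (Fin k ⊕ Bool → K)) (hQS : ∀ q ∈ Q, ∀ i, q i ∈ S)
    (hQf : ∀ q ∈ Q, MvPolynomial.eval q f = 0) (hQg : ∀ q ∈ Q, MvPolynomial.eval q g = 0) :
    Q.card ≤ S.card ^ k * f.totalDegree * g.totalDegree := by
  classical
  set P : K[X] := ∏ s ∈ S, (X - C s) with hPdef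
  have hP : P.Monic := Polynomial.monic_prod_of_monic _ _ fun s _ => Polynomial.monic_X_sub_C s
  have hPd : P.natDegree = S.card := by
    rw [hPdef, Polynomial.natDegree_finsetProd_X_sub_C_eq_card]
  have hP0 : 0 < P.natDegree := by rw [hPd]; exact hS.card_pos
  have hPe : ∀ s ∈ S, P.eval s = 0 := by
    intro s hs
    rw [hPdef, Polynomial.eval_prod]
    exact Finset.prod_eq_zero hs (by simp)
  have hmap : (P.map (algebraMap K (RR K k))).natDegree = P.natDegree := hP.natDegree_map _
  obtain ⟨A, _, _, x, b, hb, hx, hu⟩ := exists_tower (RR K k) (P.map (algebraMap K (RR K k)))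
    (hP.map _) (by rw [hmap]; exact hP0) k (cc P)
  let _ : Algebra (Lam K k) A := ((algebraMap (RR K k) A).comp MvPolynomial.C).toAlgebra
  have : IsScalarTower (Lam K k) (RR K k) A := IsScalarTower.of_algebraMap_eq fun _ => rfl
  let _ : Algebra K A := ((algebraMap (RR K k) A).comp (algebraMap K (RR K k))).toAlgebra
  have : IsScalarTower K (RR K k) A := IsScalarTower.of_algebraMap_eq fun _ => rfl
  let t : Tow K k P A :=
    { x := x
      b := b.reindex (Equiv.arrowCongr (Equiv.refl _) (finCongr hmap))
      hb := by intro a; simp [hb]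
      hx := by intro j; rw [← hx j, Polynomial.aeval_map_algebraMap]
      hu := by
        intro C _ φ y hy
        exact hu C φ y (fun j => by rw [Polynomial.eval₂_map, hy j]) }
  -- nonvanishing of the localisation elements
  have hDR : ∀ c : Bool, (aeval (MvPolynomial.X c : RR K k) P) ≠ 0 := by
    intro c
    rw [hPdef, map_prod, Finset.prod_ne_zero_iff]
    intro s _ h0
    simp only [map_sub, aeval_X, aeval_C] at h0
    have hA : algebraMap K (RR K k) s = MvPolynomial.C (MvPolynomial.C s) := rfl
    have h1 := congrArg (MvPolynomial.eval (fun _ => MvPolynomial.C s + 1)) h0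
    rw [map_sub, MvPolynomial.eval_X, map_zero, hA, MvPolynomial.eval_C] at h1
    simp at h1
  have hDD : ∀ c : Bool, Tow.DD k P c ≠ 0 := by
    intro c h0
    have h1 := t.aeval_DD c
    rw [h0, map_zero] at h1
    have : Module.IsTorsionFree (RR K k) A := t.b.isTorsionFree
    have h2 : (aeval (MvPolynomial.X c : RR K k) P) • (1 : A) = 0 := by
      rw [Algebra.smul_def, ← h1, zero_mul]
    have : Nonempty (Fin k → Fin P.natDegree) := ⟨fun _ => ⟨0, hP0⟩⟩
    have : Nontrivial A := t.b.repr.toEquiv.nontrivial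
    rcases smul_eq_zero.1 h2 with h | h
    · exact hDR c h
    · exact one_ne_zero h
  have hDreg : ∀ c : Bool, ∀ y : A, t.iB c (MvPolynomial.C (Tow.DD k P c)) * y = 0 → y = 0 := by
    intro c y h
    have : Module.IsTorsionFree (RR K k) A := t.b.isTorsionFree
    rw [Tow.iB_C, Tow.aeval_DD, ← Algebra.smul_def] at h
    exact (smul_eq_zero.1 h).resolve_left (hDR c)
  have hf0 : ∀ y : A, MvPolynomial.aeval t.z f * y = 0 → y = 0 := by
    intro y hy
    refine reg_a (t.iB true) (t.iB_inj true (hDD true)) (MvPolynomial.C f)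
      (MvPolynomial.C (Tow.DD k P true)) ?_ (t.iB_surj true) (hDreg true) y ?_
    · simpa using hf
    · rw [Tow.iB_C]; exact hy
  have hreg : ∀ y : A, MvPolynomial.aeval t.z f ∣ MvPolynomial.aeval t.z g * y →
      MvPolynomial.aeval t.z f ∣ y := by
    intro y hy
    have h1 : ∀ c : Bool, ∃ n : ℕ, MvPolynomial.aeval t.z f ∣
        algebraMap (RR K k) A ((aeval (MvPolynomial.X c : RR K k) P) ^ n) * y := by
      intro c
      have := reg_b (t.iB c) (t.iB_inj c (hDD c)) (MvPolynomial.C f) (MvPolynomial.C g)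
        (MvPolynomial.C (Tow.DD k P c)) (by
          intro q hq
          rw [MvPolynomial.C_dvd_iff_dvd_coeff] at hq ⊢
          intro i
          have := hq i
          rw [MvPolynomial.coeff_C_mul] at this
          exact hfg.dvd_of_dvd_mul_left this) (t.iB_surj c) y (by rw [Tow.iB_C, Tow.iB_C]; exact hy)
      obtain ⟨n, hn⟩ := this
      refine ⟨n, ?_⟩
      rw [Tow.iB_C, Tow.iB_C, Tow.aeval_DD, ← map_pow] at hn
      exact hn
    obtain ⟨n, hn⟩ := h1 true
    obtain ⟨m, hm⟩ := h1 false
    exact reg_c t.b _ _ (pow_ne_zero _ (hDR true)) (relprime_P S true false (by simp) n m) _ hf0 y hn hm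
  -- evaluation and interpolation
  have hev : ∀ q : Q, ∃ ev : A →ₐ[Lam K k] Lam K k, ∀ f, ev (MvPolynomial.aeval t.z f) =
      MvPolynomial.C (MvPolynomial.eval (q : Fin k ⊕ Bool → K) f) := fun q =>
    t.exists_ev q (fun i => hPe _ (hQS q q.2 i))
  choose ev hev using hev
  choose w hw1 hw2 using fun q : Q => exists_sep Q (q : Fin k ⊕ Bool → K)
  set m0 := Finset.univ.sup (fun q : Q => (w q).totalDegree) with hm0
  have hwF : ∀ q : Q, MvPolynomial.aeval t.z (w q) ∈ t.Fil m0 := by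
    intro q
    have := t.mul_mem_Fil hP hP0 (w q) 0 1 (t.one_mem_Fil hP hP0)
    rw [mul_one, zero_add] at this
    exact t.Fil_mono (Finset.le_sup (f := fun q : Q => (w q).totalDegree) (Finset.mem_univ q)) this
  have hcount : ∀ T m : ℕ, m0 + T * g.totalDegree ≤ m + f.totalDegree →
      T * Fintype.card Q + (Tow.lev k P.natDegree m).card ≤
        (Tow.lev k P.natDegree (m + f.totalDegree)).card := by
    intro T m hm
    refine count t.bas (Tow.lev k P.natDegree) (MvPolynomial.aeval t.z f) (MvPolynomial.aeval t.z g)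
      f.totalDegree g.totalDegree m0 ?_ (t.mul_mem_Fil hP hP0 f) (t.mul_mem_Fil hP hP0 g) hf0 hreg ev
      ?_ ?_ (fun q => MvPolynomial.aeval t.z (w q)) hwF ?_ ?_ T m hm
    · intro a b hab i
      simp only [Tow.mem_lev]; omega
    · intro q; rw [hev, hQf q q.2, map_zero]
    · intro q; rw [hev, hQg q q.2, map_zero]
    · intro q
      rw [hev]
      simpa using hw1 q
    · intro p q hpq
      rw [hev, hw2 p q q.2 (fun h => hpq (Subtype.ext h.symm)), map_zero]
  rw [Fintype.card_coe, hPd] at hcount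
  by_contra hlt
  push Not at hlt
  set s := S.card ^ k * f.totalDegree with hs
  set T := s * (m0 + f.totalDegree + 1) + 1 with hT
  have h1 := hcount T (m0 + T * g.totalDegree) (by omega)
  have h2 := Tow.lev_card k S.card (m0 + T * g.totalDegree) f.totalDegree
  rw [← hs] at h2
  have h3 : T * Q.card ≤ s * (m0 + T * g.totalDegree + f.totalDegree + 1) := by omega
  have h4 : T * (s * g.totalDegree + 1) ≤ T * Q.card := Nat.mul_le_mul_left _ hlt
  nlinarith

theorem bezout_fin (n : ℕ) (hn : 2 ≤ n) (S : Finset ℚ) (hS : S.Nonempty)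
    (f g : MvPolynomial (Fin n) ℚ) (hf : Irreducible f) (hg : g ≠ 0)
    (hdeg : g.totalDegree < f.totalDegree)
    (Q : Finset (Fin n → ℚ)) (hQS : ∀ q ∈ Q, ∀ i, q i ∈ S)
    (hQf : ∀ q ∈ Q, MvPolynomial.eval q f = 0) (hQg : ∀ q ∈ Q, MvPolynomial.eval q g = 0) :
    Q.card ≤ S.card ^ (n - 2) * f.totalDegree * g.totalDegree := by
  classical
  have hcard : Fintype.card (Fin (n - 2) ⊕ Bool) = Fintype.card (Fin n) := by
    simp; omega
  let e : Fin (n - 2) ⊕ Bool ≃ Fin n := Fintype.equivOfCardEq hcard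
  let E := MvPolynomial.renameEquiv ℚ e.symm
  have hE : ∀ p, (E p).totalDegree = p.totalDegree := fun p =>
    MvPolynomial.totalDegree_renameEquiv e.symm p
  have hirr : Irreducible (E f) := (MulEquiv.irreducible_iff E).2 hf
  have hg' : E g ≠ 0 := by simpa using hg
  have hrel : IsRelPrime (E f) (E g) := by
    rw [Irreducible.isRelPrime_iff_not_dvd hirr]
    intro h
    have := MvPolynomial.totalDegree_le_of_dvd_of_isDomain h hg'
    rw [hE, hE] at this
    omega
  have heval : ∀ (p : MvPolynomial (Fin n) ℚ) (q : Fin n → ℚ),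
      MvPolynomial.eval (q ∘ e) (E p) = MvPolynomial.eval q p := by
    intro p q
    simp only [E, MvPolynomial.renameEquiv_apply, MvPolynomial.eval_rename]
    congr 2
    ext i; simp
  have := bezout_grid (n - 2) S hS (E f) (E g) hirr.ne_zero hrel (Q.image (fun q => q ∘ e)) (by
      intro q hq i
      obtain ⟨q, hq', rfl⟩ := Finset.mem_image.1 hq
      exact hQS q hq' _) (by
      intro q hq
      obtain ⟨q, hq', rfl⟩ := Finset.mem_image.1 hq
      rw [heval]; exact hQf q hq') (by
      intro q hq
      obtain ⟨q, hq', rfl⟩ := Finset.mem_image.1 hq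
      rw [heval]; exact hQg q hq')
  rw [Finset.card_image_of_injective _ e.surjective.injective_comp_right, hE, hE] at this
  exact this

/-- descend a polynomial over an extension to a nonzero rational one, keeping rational zeros -/
theorem exists_descent {σ : Type} {L : Type} [Field L] [Algebra ℚ L] (g : MvPolynomial σ L)
    (hg : g ≠ 0) :
    ∃ g' : MvPolynomial σ ℚ, g' ≠ 0 ∧ g'.totalDegree ≤ g.totalDegree ∧
      ∀ q : σ → ℚ, MvPolynomial.eval (fun i => algebraMap ℚ L (q i)) g = 0 →
        MvPolynomial.eval q g' = 0 := by
  classical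
  obtain ⟨n, hn⟩ := MvPolynomial.ne_zero_iff.1 hg
  obtain ⟨l, hl⟩ := Module.Projective.exists_dual_ne_zero ℚ hn
  refine ⟨∑ m ∈ g.support, MvPolynomial.monomial m (l (g.coeff m)), ?_, ?_, ?_⟩
  · rw [MvPolynomial.ne_zero_iff]
    refine ⟨n, ?_⟩
    rw [MvPolynomial.coeff_sum, Finset.sum_eq_single n]
    · simpa using hl
    · intro m _ hm
      rw [MvPolynomial.coeff_monomial, if_neg hm]
    · intro h
      exact absurd (MvPolynomial.mem_support_iff.2 hn) h
  · refine MvPolynomial.totalDegree_finsetSum_le fun m hm => ?_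
    exact (MvPolynomial.totalDegree_monomial_le _ _).trans (MvPolynomial.le_totalDegree hm)
  · intro q hq
    have h := congrArg l hq
    rw [MvPolynomial.eval_eq, map_sum, map_zero] at h
    rw [map_sum, ← h]
    refine Finset.sum_congr rfl fun m _ => ?_
    rw [MvPolynomial.eval_monomial, Finsupp.prod]
    have : (MvPolynomial.coeff m g) * ∏ i ∈ m.support, algebraMap ℚ L (q i) ^ m i =
        (∏ i ∈ m.support, q i ^ m i) • MvPolynomial.coeff m g := by
      rw [Algebra.smul_def, map_prod, mul_comm]
      simp
    rw [this, map_smul, smul_eq_mul, mul_comm]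

end BezoutGrid

/-- **Trivial bound for irreducible but not geometrically irreducible hypersurfaces.**
Let `n ≥ 2` and let `f ∈ ℤ[x_1,…,x_n]` have degree `d ≥ 1`, be irreducible over `ℚ`
but not irreducible over the algebraic closure of `ℚ`. Then for every `B ≥ 1` one has
`N_aff(f,B) ≤ d²·(2B+1)^(n-2)`. -/
theorem not_geometrically_irreducible_bound (n : ℕ) (hn : 2 ≤ n)
    (d : ℕ) (f : MvPolynomial (Fin n) ℤ) (hd : 1 ≤ d) (hdeg : f.totalDegree = d)
    (hirr : Irreducible (MvPolynomial.map (Int.castRingHom ℚ) f))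
    (hnotabs : ¬ Irreducible (MvPolynomial.map (Int.castRingHom (AlgebraicClosure ℚ)) f))
    (B : ℝ) (hB : 1 ≤ B) :
    (Naff f B : ℝ) ≤ (d : ℝ) ^ 2 * (2 * B + 1) ^ (n - 2) := by
  classical
  set fQ := MvPolynomial.map (Int.castRingHom ℚ) f with hfQ
  set fA := MvPolynomial.map (Int.castRingHom (AlgebraicClosure ℚ)) f with hfA
  have hdQ : fQ.totalDegree = d := by
    rw [← hdeg]
    simp only [MvPolynomial.totalDegree, hfQ]
    rw [MvPolynomial.support_map_of_injective f
      (f := Int.castRingHom ℚ) (RingHom.injective_int _)]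
  have hdA : fA.totalDegree = d := by
    rw [← hdeg]
    simp only [MvPolynomial.totalDegree, hfA]
    rw [MvPolynomial.support_map_of_injective f
      (f := Int.castRingHom (AlgebraicClosure ℚ)) (RingHom.injective_int _)]
  have hunit : ∀ p : MvPolynomial (Fin n) (AlgebraicClosure ℚ), p ≠ 0 → ¬ IsUnit p →
      1 ≤ p.totalDegree := by
    intro p hp hpu
    by_contra h
    have h0 : p.totalDegree = 0 := by omega
    rw [MvPolynomial.totalDegree_eq_zero_iff_eq_C] at h0
    apply hpu
    rw [h0]
    apply IsUnit.map
    rw [isUnit_iff_ne_zero]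
    intro h1
    apply hp
    rw [h0, h1, map_zero]
  have hfA0 : fA ≠ 0 := by
    intro h
    rw [h, MvPolynomial.totalDegree_zero] at hdA
    omega
  have hfAu : ¬ IsUnit fA := by
    intro h
    have := MvPolynomial.isUnit_iff_totalDegree_of_isReduced.1 h
    omega
  obtain ⟨g, h, hgh, hgu, hhu⟩ : ∃ g h, fA = g * h ∧ ¬ IsUnit g ∧ ¬ IsUnit h := by
    by_contra hcon
    push Not at hcon
    apply hnotabs
    refine ⟨hfAu, fun a b hab => ?_⟩
    by_cases ha : IsUnit a
    · exact Or.inl ha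
    · exact Or.inr (hcon a b hab ha)
  have hg0 : g ≠ 0 := by rintro rfl; simp [hgh] at hfA0
  have hh0 : h ≠ 0 := by rintro rfl; simp [hgh] at hfA0
  have hdsum : g.totalDegree + h.totalDegree = d := by
    rw [← MvPolynomial.totalDegree_mul_of_isDomain hg0 hh0, ← hgh, hdA]
  have hg1 := hunit g hg0 hgu
  have hh1 := hunit h hh0 hhu
  obtain ⟨g', hg'0, hg'd, hg'e⟩ := exists_descent g hg0
  obtain ⟨h', hh'0, hh'd, hh'e⟩ := exists_descent h hh0
  let Z : Finset ℤ := Finset.Icc (-⌊B⌋) ⌊B⌋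
  let S : Finset ℚ := Finset.image (fun z : ℤ => (z : ℚ)) Z
  have hfl : 1 ≤ ⌊B⌋ := Int.le_floor.2 (by exact_mod_cast hB)
  have hS : S.Nonempty := ⟨0, Finset.mem_image.2 ⟨0, by simp [Z]; omega, by simp⟩⟩
  have hScard : (S.card : ℝ) ≤ 2 * B + 1 := by
    have h1 : S.card = (2 * ⌊B⌋ + 1).toNat := by
      rw [Finset.card_image_of_injective _ Int.cast_injective, Int.card_Icc]
      congr 1; ring
    have h2 : ((S.card : ℤ) : ℝ) = ((2 * ⌊B⌋ + 1 : ℤ) : ℝ) := by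
      rw [h1, Int.toNat_of_nonneg (by omega)]
    have h3 := Int.floor_le B
    push_cast at h2
    linarith
  let X : Finset (Fin n → ℤ) := (Fintype.piFinset (fun _ => Z)).filter
    (fun x => MvPolynomial.eval x f = 0)
  have hX : {x : Fin n → ℤ | (∀ i, |(x i : ℝ)| ≤ B) ∧ MvPolynomial.eval x f = 0} = (X : Set _) := by
    ext x
    simp only [Set.mem_ofPred_eq, X, Finset.coe_filter, Fintype.mem_piFinset, Z, Finset.mem_Icc]
    have : ∀ i, |(x i : ℝ)| ≤ B ↔ -⌊B⌋ ≤ x i ∧ x i ≤ ⌊B⌋ := by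
      intro i
      rw [abs_le, Int.le_floor, neg_le, neg_le (a := ⌊B⌋), Int.le_floor]
      push_cast
      rfl
    simp only [this]
  have hN : Naff f B = X.card := by
    rw [Naff, hX, Set.ncard_coe_finset]
  let c : (Fin n → ℤ) → (Fin n → ℚ) := fun x i => (x i : ℚ)
  have hc : Function.Injective c := by
    intro x y hxy
    ext i
    exact Int.cast_injective (α := ℚ) (congrFun hxy i)
  let Q : Finset (Fin n → ℚ) := X.image c
  have hQc : Q.card = X.card := Finset.card_image_of_injective _ hc
  have hQS : ∀ q ∈ Q, ∀ i, q i ∈ S := by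
    intro q hq i
    obtain ⟨x, hx, rfl⟩ := Finset.mem_image.1 hq
    exact Finset.mem_image.2 ⟨x i, Fintype.mem_piFinset.1 (Finset.mem_filter.1 hx).1 i, rfl⟩
  have hQf : ∀ q ∈ Q, MvPolynomial.eval q fQ = 0 := by
    intro q hq
    obtain ⟨x, hx, rfl⟩ := Finset.mem_image.1 hq
    have h1 := (Finset.mem_filter.1 hx).2
    have h2 : MvPolynomial.eval (c x) fQ = Int.castRingHom ℚ (MvPolynomial.eval x f) := by
      rw [hfQ, MvPolynomial.eval_map]
      exact (MvPolynomial.eval₂_comp _ _ _).symm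
    rw [h2, h1, map_zero]
  have hQor : ∀ q ∈ Q, MvPolynomial.eval q g' = 0 ∨ MvPolynomial.eval q h' = 0 := by
    intro q hq
    have h1 : MvPolynomial.eval (fun i => algebraMap ℚ (AlgebraicClosure ℚ) (q i)) fA = 0 := by
      have h2 : fA = MvPolynomial.map (algebraMap ℚ (AlgebraicClosure ℚ)) fQ := by
        rw [hfA, hfQ, MvPolynomial.map_map]
        congr 1
      have h3 : MvPolynomial.eval (fun i => algebraMap ℚ (AlgebraicClosure ℚ) (q i))
          (MvPolynomial.map (algebraMap ℚ (AlgebraicClosure ℚ)) fQ) =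
          algebraMap ℚ (AlgebraicClosure ℚ) (MvPolynomial.eval q fQ) := by
        rw [MvPolynomial.eval_map]
        exact (MvPolynomial.eval₂_comp _ _ _).symm
      rw [h2, h3, hQf q hq, map_zero]
    rw [hgh, map_mul, mul_eq_zero] at h1
    exact h1.imp (hg'e q) (hh'e q)
  have hb1 := bezout_fin n hn S hS fQ g' hirr hg'0 (by omega)
    (Q.filter (fun q => MvPolynomial.eval q g' = 0)) (fun q hq => hQS q (Finset.mem_filter.1 hq).1)
    (fun q hq => hQf q (Finset.mem_filter.1 hq).1) (fun q hq => (Finset.mem_filter.1 hq).2)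
  have hb2 := bezout_fin n hn S hS fQ h' hirr hh'0 (by omega)
    (Q.filter (fun q => MvPolynomial.eval q h' = 0)) (fun q hq => hQS q (Finset.mem_filter.1 hq).1)
    (fun q hq => hQf q (Finset.mem_filter.1 hq).1) (fun q hq => (Finset.mem_filter.1 hq).2)
  have hb3 : Q.card ≤ (Q.filter (fun q => MvPolynomial.eval q g' = 0)).card +
      (Q.filter (fun q => MvPolynomial.eval q h' = 0)).card := by
    refine le_trans (Finset.card_le_card ?_) (Finset.card_union_le _ _)
    intro q hq
    rcases hQor q hq with h1 | h1
    · exact Finset.mem_union_left _ (Finset.mem_filter.2 ⟨hq, h1⟩)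
    · exact Finset.mem_union_right _ (Finset.mem_filter.2 ⟨hq, h1⟩)
  have hfin : Naff f B ≤ d ^ 2 * S.card ^ (n - 2) := by
    rw [hN, ← hQc]
    rw [hdQ] at hb1 hb2
    calc Q.card ≤ S.card ^ (n - 2) * d * g'.totalDegree + S.card ^ (n - 2) * d * h'.totalDegree := by
          omega
      _ ≤ S.card ^ (n - 2) * d * g.totalDegree + S.card ^ (n - 2) * d * h.totalDegree := by gcongr
      _ = S.card ^ (n - 2) * d * (g.totalDegree + h.totalDegree) := by ring
      _ = d ^ 2 * S.card ^ (n - 2) := by rw [hdsum]; ring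
  calc (Naff f B : ℝ) ≤ ((d ^ 2 * S.card ^ (n - 2) : ℕ) : ℝ) := by exact_mod_cast hfin
    _ = (d : ℝ) ^ 2 * (S.card : ℝ) ^ (n - 2) := by push_cast; ring
    _ ≤ (d : ℝ) ^ 2 * (2 * B + 1) ^ (n - 2) := by gcongr
end

section
/- There exists an absolute constant c such that the following holds. Let d > d' > 0 be coprime integers, let c_d and c_{d'} be nonzero integers, and let f ∈ ℤ[x_1,x_2] be a polynomial of the form f = c_d·x_1^d + c_{d'}·x_2^{d'} + Σ c_{i,i'}·x_1^i·x_2^{i'}, where the sum ranges over pairs (i, i') of non-negative integers with i·d' + i'·d < d·d' and the c_{i,i'} are integers. Then for every real B ≥ 1, one has N_aff(f,B) ≤ c·d^4·(log|c_d·c_{d'}| + 1)·B^{1/d}. -/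
namespace NPC
open MvPolynomial

/-- The weight of an exponent vector. -/
def wt (d d' : ℕ) (m : Fin 2 →₀ ℕ) : ℕ := m 0 * d' + m 1 * d

theorem wt_add (d d' : ℕ) (m n : Fin 2 →₀ ℕ) : wt d d' (m + n) = wt d d' m + wt d d' n := by
  simp [wt]; ring

/-- The shape hypothesis on `f`. -/
structure NP {K : Type*} [Field K] (d d' : ℕ) (f : MvPolynomial (Fin 2) K) : Prop where
  pos : 0 < d'
  lt : d' < d
  cop : Nat.Coprime d d'
  ha : coeff (Finsupp.single 0 d) f ≠ 0
  hb : coeff (Finsupp.single 1 d') f ≠ 0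
  low : ∀ m, coeff m f ≠ 0 → m ≠ Finsupp.single 0 d → m ≠ Finsupp.single 1 d' →
    wt d d' m < d * d'

variable {K : Type*} [Field K] {d d' : ℕ} {f : MvPolynomial (Fin 2) K}

/-- Polynomials all of whose monomials have weight `< n`. -/
def FL (K : Type*) [Field K] (d d' n : ℕ) : Submodule K (MvPolynomial (Fin 2) K) where
  carrier := {P | ∀ m, coeff m P ≠ 0 → wt d d' m < n}
  add_mem' := by
    intro a b ha hb m hm
    by_cases h : coeff m a = 0
    · apply hb; intro h2; apply hm; simp [h, h2]
    · exact ha m h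
  zero_mem' := by intro m hm; simp at hm
  smul_mem' := by
    intro c a ha m hm
    apply ha; intro h; apply hm; simp [h]

theorem mem_FL {n : ℕ} {P : MvPolynomial (Fin 2) K} :
    P ∈ FL K d d' n ↔ ∀ m, coeff m P ≠ 0 → wt d d' m < n := Iff.rfl

theorem FL_zero : FL K d d' 0 = ⊥ := by
  rw [eq_bot_iff]
  intro P hP
  rw [Submodule.mem_bot]
  ext m
  by_contra h
  exact absurd (hP m (by simpa using h)) (by omega)

theorem FL_mono {a b : ℕ} (h : a ≤ b) : FL K d d' a ≤ FL K d d' b :=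
  fun _ hP m hm => lt_of_lt_of_le (hP m hm) h

theorem monomial_mem_FL {n : ℕ} {m : Fin 2 →₀ ℕ} (c : K) (h : wt d d' m < n) :
    monomial m c ∈ FL K d d' n := by
  intro m' hm'
  rw [coeff_monomial] at hm'
  split_ifs at hm' with h1
  · subst h1; exact h
  · simp at hm'

theorem exists_FL (P : MvPolynomial (Fin 2) K) : ∃ n, P ∈ FL K d d' n := by
  refine ⟨P.support.sup (wt d d') + 1, ?_⟩
  intro m hm
  exact Nat.lt_succ_of_le (Finset.le_sup (f := wt d d') (mem_support_iff.2 hm))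

theorem FL_le_of_monomial {n : ℕ} {W : Submodule K (MvPolynomial (Fin 2) K)}
    (h : ∀ m, wt d d' m < n → monomial m 1 ∈ W) : FL K d d' n ≤ W := by
  intro P hP
  rw [P.as_sum]
  refine Submodule.sum_mem _ fun m hm => ?_
  have : monomial m (coeff m P) = (coeff m P) • monomial m (1 : K) := by
    rw [smul_monomial]; simp
  rw [this]
  exact W.smul_mem _ (h m (hP m (mem_support_iff.1 hm)))

theorem FL_mul {a b : ℕ} {P Q : MvPolynomial (Fin 2) K} (hP : P ∈ FL K d d' (a + 1))
    (hQ : Q ∈ FL K d d' (b + 1)) : P * Q ∈ FL K d d' (a + b + 1) := by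
  intro m hm
  have hm' : m ∈ (P * Q).support := mem_support_iff.2 hm
  have := support_mul P Q hm'
  rw [Finset.mem_add] at this
  obtain ⟨u, hu, v, hv, rfl⟩ := this
  have h1 := hP u (mem_support_iff.1 hu)
  have h2 := hQ v (mem_support_iff.1 hv)
  rw [wt_add]; omega

/-- The homogenizing map. -/
noncomputable def Phi (K : Type*) [Field K] (d d' : ℕ) :
    MvPolynomial (Fin 2) K →ₐ[K] Polynomial (MvPolynomial (Fin 2) K) :=
  aeval ![Polynomial.C (X 0) * Polynomial.X ^ d', Polynomial.C (X 1) * Polynomial.X ^ d]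

theorem Phi_monomial (u : Fin 2 →₀ ℕ) (a : K) :
    Phi K d d' (monomial u a) = Polynomial.monomial (wt d d' u) (monomial u a) := by
  rw [Phi, aeval_monomial, Finsupp.prod_fintype _ _ (by simp)]
  simp only [Fin.prod_univ_two, Matrix.cons_val_zero, Matrix.cons_val_one, mul_pow, ← pow_mul]
  rw [← Polynomial.C_mul_X_pow_eq_monomial, monomial_eq, Finsupp.prod_fintype _ _ (by simp)]
  simp only [Fin.prod_univ_two, wt, map_mul, map_pow]
  have : (algebraMap K (Polynomial (MvPolynomial (Fin 2) K))) a = Polynomial.C (C a) := rfl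
  rw [this]
  ring

theorem coeff_Phi (P : MvPolynomial (Fin 2) K) (m : Fin 2 →₀ ℕ) (k : ℕ) :
    coeff m ((Phi K d d' P).coeff k) = if wt d d' m = k then coeff m P else 0 := by
  induction P using MvPolynomial.induction_on' with
  | monomial u a =>
    rw [Phi_monomial, Polynomial.coeff_monomial]
    by_cases h : u = m
    · subst h; split_ifs <;> simp
    · split_ifs <;> simp [coeff_monomial, h]
  | add p q hp hq =>
    simp only [map_add, Polynomial.coeff_add, coeff_add, hp, hq]
    split_ifs <;> simp

theorem Phi_natDegree_le {P : MvPolynomial (Fin 2) K} {n : ℕ} (h : P ∈ FL K d d' (n + 1)) :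
    (Phi K d d' P).natDegree ≤ n := by
  rw [Polynomial.natDegree_le_iff_coeff_eq_zero]
  intro k hk
  ext m
  rw [coeff_Phi]
  split_ifs with h1
  · by_contra h2
    have := h m (by simpa using h2)
    omega
  · simp

theorem Phi_f_coeff (hf : NP d d' f) : (Phi K d d' f).coeff (d * d') =
    C (coeff (Finsupp.single 0 d) f) * X 0 ^ d + C (coeff (Finsupp.single 1 d') f) * X 1 ^ d' := by
  have hne : (Finsupp.single 0 d : Fin 2 →₀ ℕ) ≠ Finsupp.single 1 d' := by
    intro h
    have := DFunLike.congr_fun h 0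
    simp at this
    have := hf.lt; omega
  ext m
  rw [coeff_Phi, X_pow_eq_monomial, X_pow_eq_monomial, C_mul_monomial, C_mul_monomial, coeff_add,
    coeff_monomial, coeff_monomial]
  by_cases h0 : Finsupp.single 0 d = m
  · subst h0; simp [wt, hne.symm, mul_comm]
  by_cases h1 : Finsupp.single 1 d' = m
  · subst h1; simp [wt, hne, mul_comm]
  simp only [h0, h1, if_false, add_zero]
  split_ifs with h2
  · by_contra h3
    have := hf.low m h3 (Ne.symm h0) (Ne.symm h1)
    omega
  · rfl

theorem f_mem_FL (hf : NP d d' f) : f ∈ FL K d d' (d * d' + 1) := by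
  intro m hm
  by_cases h0 : m = Finsupp.single 0 d
  · subst h0; simp [wt]
  by_cases h1 : m = Finsupp.single 1 d'
  · subst h1; simp [wt, mul_comm]
  have := hf.low m hm h0 h1
  omega

/-- Top-form map. -/
noncomputable def psi (d d' : ℕ) (l μ : K) : MvPolynomial (Fin 2) K →+* Polynomial K :=
  (Polynomial.mapRingHom (eval ![l, μ])).comp (Phi K d d').toRingHom

theorem psi_apply (l μ : K) (P : MvPolynomial (Fin 2) K) :
    psi d d' l μ P = (Phi K d d' P).map (eval ![l, μ]) := rfl

theorem psi_monomial (l μ : K) (u : Fin 2 →₀ ℕ) (a : K) :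
    psi d d' l μ (monomial u a) = Polynomial.monomial (wt d d' u) (a * (l ^ u 0 * μ ^ u 1)) := by
  rw [psi_apply, Phi_monomial, Polynomial.map_monomial, eval_monomial,
    Finsupp.prod_fintype _ _ (by simp)]
  simp

theorem psi_smul (l μ c : K) (P : MvPolynomial (Fin 2) K) :
    psi d d' l μ (c • P) = c • psi d d' l μ P := by
  rw [smul_eq_C_mul, map_mul, Polynomial.smul_eq_C_mul]
  congr 1
  have := psi_monomial (d := d) (d' := d') l μ 0 c
  simpa [wt] using this

theorem psi_natDegree_le (l μ : K) {P : MvPolynomial (Fin 2) K} {n : ℕ}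
    (h : P ∈ FL K d d' (n + 1)) : (psi d d' l μ P).natDegree ≤ n :=
  Polynomial.natDegree_map_le.trans (Phi_natDegree_le h)

theorem psi_coeff_zero (l μ : K) {P : MvPolynomial (Fin 2) K} {n : ℕ}
    (h : P ∈ FL K d d' n) : (psi d d' l μ P).coeff n = 0 := by
  rcases n with _ | n
  · rw [FL_zero, Submodule.mem_bot] at h; simp [h]
  · exact Polynomial.coeff_eq_zero_of_natDegree_lt
      (Nat.lt_succ_of_le (psi_natDegree_le l μ h))

theorem exists_lm (hf : NP d d' f) : ∃ l μ : K, l ≠ 0 ∧ μ ≠ 0 ∧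
    coeff (Finsupp.single 0 d) f * l ^ d + coeff (Finsupp.single 1 d') f * μ ^ d' = 0 := by
  set a := coeff (Finsupp.single 0 d) f
  set b := coeff (Finsupp.single 1 d') f
  have ha : a ≠ 0 := hf.ha
  have hb : b ≠ 0 := hf.hb
  set g : K := -b / a with hg
  have hg0 : g ≠ 0 := div_ne_zero (neg_ne_zero.2 hb) ha
  have hbez : (d : ℤ) * Nat.gcdA d d' + d' * Nat.gcdB d d' = 1 := by
    rw [← Nat.gcd_eq_gcd_ab, hf.cop]; rfl
  refine ⟨g ^ (Nat.gcdA d d'), g ^ (-Nat.gcdB d d'), zpow_ne_zero _ hg0, zpow_ne_zero _ hg0, ?_⟩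
  have h1 : (g ^ (Nat.gcdA d d')) ^ d = g * (g ^ (-Nat.gcdB d d')) ^ d' := by
    rw [← zpow_natCast, ← zpow_natCast, ← zpow_mul, ← zpow_mul]
    nth_rw 2 [← zpow_one g]
    rw [← zpow_add₀ hg0]
    congr 1
    linarith
  rw [h1, hg]
  field_simp
  ring

/-- data of a zero of the top form. -/
def LM (d d' : ℕ) (f : MvPolynomial (Fin 2) K) (l μ : K) : Prop := l ≠ 0 ∧ μ ≠ 0 ∧
    coeff (Finsupp.single 0 d) f * l ^ d + coeff (Finsupp.single 1 d') f * μ ^ d' = 0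

variable {l μ : K}

theorem lemmaA (hf : NP d d' f) (hl : LM d d' f l μ) {P : MvPolynomial (Fin 2) K} {n : ℕ}
    (hP : P ∈ FL K d d' (n + 1)) (hd : f ∣ P) : (psi d d' l μ P).coeff n = 0 := by
  obtain ⟨h, rfl⟩ := hd
  by_cases hh : h = 0
  · simp [hh]
  have hfc := Phi_f_coeff hf
  have hfd : (Phi K d d' f).natDegree ≤ d * d' := Phi_natDegree_le (f_mem_FL hf)
  have hev : eval ![l, μ] ((Phi K d d' f).coeff (d * d')) = 0 := by
    rw [hfc]; simpa using hl.2.2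
  have hne : (Phi K d d' f).coeff (d * d') ≠ 0 := by
    intro h0
    have := coeff_Phi (d := d) (d' := d') f (Finsupp.single 0 d) (d * d')
    rw [h0] at this
    simp [wt] at this
    exact hf.ha this.symm
  have hfd' : (Phi K d d' f).natDegree = d * d' :=
    le_antisymm hfd (Polynomial.le_natDegree_of_ne_zero hne)
  have hinj : Phi K d d' h ≠ 0 := by
    intro h0
    apply hh
    ext m
    have := coeff_Phi (d := d) (d' := d') h m (wt d d' m)
    simpa [h0] using this.symm
  have hf0 : Phi K d d' f ≠ 0 := by intro h0; simp [h0] at hne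
  have hdeg := Phi_natDegree_le hP
  rw [map_mul, Polynomial.natDegree_mul hf0 hinj, hfd'] at hdeg
  rw [psi_apply, Polynomial.coeff_map, map_mul]
  obtain ⟨k, rfl⟩ := Nat.exists_eq_add_of_le (le_trans (Nat.le_add_right _ _) hdeg)
  rw [Polynomial.coeff_mul_add_eq_of_natDegree_le hfd'.le (by omega), map_mul, hev, zero_mul]

/-- `P` has exact weight `n` on the curve. -/
def Good (d d' : ℕ) (l μ : K) (n : ℕ) (P : MvPolynomial (Fin 2) K) : Prop :=
  P ∈ FL K d d' (n + 1) ∧ (psi d d' l μ P).coeff n ≠ 0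

theorem Good.mul {n m : ℕ} {P Q : MvPolynomial (Fin 2) K} (hP : Good d d' l μ n P)
    (hQ : Good d d' l μ m Q) : Good d d' l μ (n + m) (P * Q) := by
  refine ⟨FL_mul hP.1 hQ.1, ?_⟩
  rw [map_mul, Polynomial.coeff_mul_add_eq_of_natDegree_le (psi_natDegree_le l μ hP.1)
    (psi_natDegree_le l μ hQ.1)]
  exact mul_ne_zero hP.2 hQ.2

theorem Good.monomial (h1 : l ≠ 0) (h2 : μ ≠ 0) (m : Fin 2 →₀ ℕ) :
    Good d d' l μ (wt d d' m) (monomial m 1) := by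
  refine ⟨monomial_mem_FL _ (by omega), ?_⟩
  rw [psi_monomial]
  simp [h1, h2]

theorem Good.pow {n : ℕ} {P : MvPolynomial (Fin 2) K} (hP : Good d d' l μ n P) (k : ℕ) :
    Good d d' l μ (k * n) (P ^ k) := by
  induction k with
  | zero =>
    have := hP.1
    simp only [zero_mul, pow_zero]
    refine ⟨?_, by simp⟩
    intro m hm
    have : m = 0 := by
      by_contra h
      exact hm (by rw [coeff_one, if_neg (Ne.symm h)])
    subst this; simp [wt]
  | succ k ih =>
    rw [pow_succ, add_mul, one_mul]
    exact ih.mul hP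

theorem good_sum {ι : Type*} (S : Finset ι) (w : ι → ℕ) (g : ι → MvPolynomial (Fin 2) K)
    (hg : ∀ a ∈ S, Good d d' l μ (w a) (g a)) (hw : Set.InjOn w S) (c : ι → K)
    (hc : ∃ a ∈ S, c a ≠ 0) :
    ∃ a ∈ S, Good d d' l μ (w a) (∑ a ∈ S, c a • g a) := by
  classical
  obtain ⟨a, ha, hmax⟩ := Finset.exists_max_image (S.filter (fun a => c a ≠ 0)) w
    (by obtain ⟨a, h1, h2⟩ := hc; exact ⟨a, by simp [h1, h2]⟩)
  rw [Finset.mem_filter] at ha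
  refine ⟨a, ha.1, ?_, ?_⟩
  · refine Submodule.sum_mem _ fun b hb => ?_
    by_cases h : c b = 0
    · simp [h]
    · exact Submodule.smul_mem _ _ (FL_mono (by
        have := hmax b (by simp [hb, h]); omega) (hg b hb).1)
  · rw [map_sum, Polynomial.finsetSum_coeff, Finset.sum_eq_single a]
    · rw [psi_smul, Polynomial.coeff_smul]
      exact mul_ne_zero ha.2 (hg a ha.1).2
    · intro b hb hba
      rw [psi_smul, Polynomial.coeff_smul]
      by_cases h : c b = 0
      · simp [h]
      · have h1 := hmax b (by simp [hb, h])
        have h2 : w b ≠ w a := fun h => hba (hw hb ha.1 h)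
        rw [psi_coeff_zero l μ (FL_mono (by omega) (hg b hb).1)]
        simp
    · intro h; exact absurd ha.1 h

/-- The semigroup of weights. -/
def Gam (d d' n : ℕ) : Prop := ∃ m : Fin 2 →₀ ℕ, m 0 < d ∧ wt d d' m = n

open Classical in
/-- Reduced exponent vector of weight `n`. -/
noncomputable def ex (d d' n : ℕ) : Fin 2 →₀ ℕ := if h : Gam d d' n then h.choose else 0

theorem ex_spec {n : ℕ} (h : Gam d d' n) : ex d d' n 0 < d ∧ wt d d' (ex d d' n) = n := by
  rw [ex, dif_pos h]; exact h.choose_spec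

theorem gam_wt (hd : 0 < d) (m : Fin 2 →₀ ℕ) : Gam d d' (wt d d' m) := by
  refine ⟨Finsupp.single 0 (m 0 % d) + Finsupp.single 1 (m 1 + d' * (m 0 / d)), ?_, ?_⟩
  · simp [Nat.mod_lt _ hd]
  · simp only [wt, Finsupp.add_apply, Finsupp.single_apply]
    simp
    conv_rhs => rw [← Nat.mod_add_div (m 0) d]
    ring

theorem gam_add (hd : 0 < d) {a b : ℕ} (ha : Gam d d' a) (hb : Gam d d' b) :
    Gam d d' (a + b) := by
  obtain ⟨m, -, rfl⟩ := ha
  obtain ⟨n, -, rfl⟩ := hb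
  rw [← wt_add]; exact gam_wt hd _

theorem gam_large (hd : 0 < d) (cop : Nat.Coprime d d') {n : ℕ} (hn : d * d' ≤ n) :
    Gam d d' n := by
  obtain ⟨i, -, hi⟩ := Nat.exists_mul_mod_eq_of_coprime (k := d) (n := d') n cop.symm (by omega)
  have h1 : (i % d) * d' ≡ n [MOD d] := by
    have : (i % d) * d' ≡ i * d' [MOD d] := (Nat.mod_modEq i d).mul_right _
    refine this.trans ?_
    rw [mul_comm]; exact hi
  have h2 : (i % d) * d' ≤ n :=
    le_trans (Nat.mul_le_mul_right _ (Nat.mod_lt i hd).le) hn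
  obtain ⟨j, hj⟩ := (Nat.modEq_iff_dvd' h2).1 h1
  refine ⟨Finsupp.single 0 (i % d) + Finsupp.single 1 j, ?_, ?_⟩
  · simp [Nat.mod_lt _ hd]
  · simp [wt]; rw [mul_comm j]; omega

theorem ex_unique (cop : Nat.Coprime d d') {m m' : Fin 2 →₀ ℕ} (h : m 0 < d) (h' : m' 0 < d)
    (hw : wt d d' m = wt d d' m') : m = m' := by
  have h1 : m 0 * d' ≡ m' 0 * d' [MOD d] := by
    have : wt d d' m ≡ wt d d' m' [MOD d] := by rw [hw]
    simpa [wt, Nat.ModEq] using this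
  have h2 : m 0 ≡ m' 0 [MOD d] := Nat.ModEq.cancel_right_of_coprime cop h1
  have h3 : m 0 = m' 0 := Nat.ModEq.eq_of_lt_of_lt h2 h h'
  have h4 : m 1 = m' 1 := by
    simp only [wt, h3] at hw
    exact Nat.eq_of_mul_eq_mul_right (by omega) (Nat.add_left_cancel hw)
  ext i; fin_cases i
  · exact h3
  · exact h4

/-- The reduced monomial of weight `n`. -/
noncomputable def em (K : Type*) [Field K] (d d' n : ℕ) : MvPolynomial (Fin 2) K :=
  monomial (ex d d' n) 1

theorem em_good (hl : LM d d' f l μ) {n : ℕ} (h : Gam d d' n) :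
    Good d d' l μ n (em K d d' n) := by
  have := Good.monomial (d := d) (d' := d') hl.1 hl.2.1 (ex d d' n)
  rwa [(ex_spec h).2] at this

/-- multiples of `f` as a subspace. -/
noncomputable def If (f : MvPolynomial (Fin 2) K) : Submodule K (MvPolynomial (Fin 2) K) :=
  (Ideal.span {f}).restrictScalars K

theorem mem_If {P : MvPolynomial (Fin 2) K} : P ∈ If f ↔ f ∣ P := by
  simp [If, Ideal.mem_span_singleton]

theorem lemmaB (hf : NP d d' f) (n : ℕ) :
    FL K d d' (n + 1) ≤ (K ∙ em K d d' n) ⊔ FL K d d' n ⊔ If f := by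
  apply FL_le_of_monomial
  have key : ∀ N, ∀ m : Fin 2 →₀ ℕ, m 0 < N → wt d d' m < n + 1 →
      monomial m (1 : K) ∈ (K ∙ em K d d' n) ⊔ FL K d d' n ⊔ If f := by
    intro N
    induction N with
    | zero => intro m h; omega
    | succ N ih =>
      intro m hmN hm
      rcases Nat.lt_or_ge (wt d d' m) n with h | h
      · exact Submodule.mem_sup_left (Submodule.mem_sup_right (monomial_mem_FL _ h))
      have hmn : wt d d' m = n := by omega
      rcases Nat.lt_or_ge (m 0) d with hd | hd
      · have hg : Gam d d' n := ⟨m, hd, hmn⟩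
        have : m = ex d d' n := ex_unique hf.cop hd (ex_spec hg).1 (by rw [hmn, (ex_spec hg).2])
        rw [this]
        exact Submodule.mem_sup_left (Submodule.mem_sup_left (Submodule.mem_span_singleton_self _))
      · set u : Fin 2 →₀ ℕ := Finsupp.single 0 (m 0 - d) + Finsupp.single 1 (m 1) with hu
        have hmu : u + Finsupp.single 0 d = m := by
          ext i; fin_cases i <;> simp [hu]; omega
        set a := coeff (Finsupp.single 0 d) f with ha
        set b := coeff (Finsupp.single 1 d') f with hb
        have ha0 : a ≠ 0 := hf.ha
        set r := f - monomial (Finsupp.single 0 d) a - monomial (Finsupp.single 1 d') b with hr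
        have hne : (Finsupp.single 0 d : Fin 2 →₀ ℕ) ≠ Finsupp.single 1 d' := by
          intro h
          have := DFunLike.congr_fun h 0
          simp at this
          have := hf.lt; omega
        have hrFL : r ∈ FL K d d' (d * d') := by
          intro v hv
          by_cases h0 : Finsupp.single 0 d = v
          · exfalso; apply hv; subst h0; simp [hr, hne.symm, coeff_monomial, ha]
          by_cases h1 : Finsupp.single 1 d' = v
          · exfalso; apply hv; subst h1; simp [hr, hne, coeff_monomial, hb]
          apply hf.low v _ (Ne.symm h0) (Ne.symm h1)
          simpa [hr, coeff_monomial, h0, h1] using hv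
        have hwu : wt d d' u + d * d' = n := by
          have h5 := congrArg (wt d d') hmu
          rw [wt_add, hmn] at h5
          rw [← h5]
          congr 1
          simp [wt]
        have e1 : monomial m (1 : K) = a⁻¹ • (f * monomial u 1)
            - (a⁻¹ * b) • monomial (u + Finsupp.single 1 d') (1 : K)
            - a⁻¹ • (monomial u 1 * r) := by
          have hfr : f = r + monomial (Finsupp.single 0 d) a
              + monomial (Finsupp.single 1 d') b := by rw [hr]; ring
          rw [hfr]
          simp only [add_mul, smul_add, monomial_mul, smul_monomial, mul_one, smul_eq_mul]
          rw [inv_mul_cancel₀ ha0, add_comm (Finsupp.single 0 d), hmu,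
            add_comm (Finsupp.single 1 d'), mul_comm r]
          ring
        rw [e1]
        refine Submodule.sub_mem _ (Submodule.sub_mem _ ?_ ?_) ?_
        · exact Submodule.mem_sup_right (Submodule.smul_mem _ _ (mem_If.2 (Dvd.intro _ rfl)))
        · refine Submodule.smul_mem _ _ (ih _ ?_ ?_)
          · simp [hu]; have := hf.lt; omega
          · rw [wt_add]; simp [wt] at hwu ⊢; rw [mul_comm d' d]; omega
        · refine Submodule.mem_sup_left (Submodule.mem_sup_right (Submodule.smul_mem _ _ ?_))
          have hdd : 0 < d * d' := Nat.mul_pos (by have := hf.lt; omega) hf.pos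
          obtain ⟨t, ht⟩ := Nat.exists_eq_succ_of_ne_zero hdd.ne'
          rw [ht] at hrFL
          have := FL_mul (monomial_mem_FL (d := d) (d' := d') (m := u) (1 : K)
            (Nat.lt_succ_self _)) hrFL
          refine FL_mono ?_ this
          omega
  intro m hm
  exact key _ m (Nat.lt_succ_self _) hm

theorem FL_succ_of_not_gam (hd : 0 < d) {n : ℕ} (h : ¬ Gam d d' n) :
    FL K d d' (n + 1) ≤ FL K d d' n := by
  intro P hP m hm
  have h1 := hP m hm
  have h2 : wt d d' m ≠ n := fun h3 => h (h3 ▸ gam_wt hd m)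
  omega

theorem lemmaC (hf : NP d d' f) (hl : LM d d' f l μ) {W : Submodule K (MvPolynomial (Fin 2) K)}
    (hW : If f ≤ W) (hG : ∀ n, Gam d d' n → ∃ G ∈ W, Good d d' l μ n G) : W = ⊤ := by
  have key : ∀ n, FL K d d' n ≤ W := by
    intro n
    induction n with
    | zero => rw [FL_zero]; exact bot_le
    | succ n ih =>
      by_cases hg : Gam d d' n
      · obtain ⟨G, hGW, hGg⟩ := hG n hg
        have hem : em K d d' n ∈ W := by
          have h1 := lemmaB hf n hGg.1
          obtain ⟨y, hy, h, hh, rfl⟩ := Submodule.mem_sup.1 h1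
          obtain ⟨z, hz, q, hq, rfl⟩ := Submodule.mem_sup.1 hy
          obtain ⟨c, rfl⟩ := Submodule.mem_span_singleton.1 hz
          have hc : c ≠ 0 := by
            rintro rfl
            have h2 : h ∈ FL K d d' (n + 1) := by
              have := Submodule.sub_mem _ hGg.1 (FL_mono (Nat.le_succ n) hq)
              simpa using this
            have h3 := lemmaA hf hl h2 (mem_If.1 hh)
            have h4 := psi_coeff_zero l μ hq
            apply hGg.2
            simp [h3, h4]
          have : em K d d' n = c⁻¹ • ((c • em K d d' n + q + h) - q - h) := by
            rw [add_sub_cancel_right_aux]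
            rw [smul_smul, inv_mul_cancel₀ hc, one_smul]
          rw [this]
          exact W.smul_mem _ (W.sub_mem (W.sub_mem hGW (ih hq)) (hW hh))
        refine (lemmaB hf n).trans (sup_le (sup_le ?_ ih) hW)
        rw [Submodule.span_singleton_le_iff_mem]; exact hem
      · exact (FL_succ_of_not_gam (by have := hf.lt; omega) hg).trans ih
  rw [eq_top_iff]
  intro P _
  obtain ⟨n, hn⟩ := exists_FL (d := d) (d' := d') P
  exact key n hn
where
  add_sub_cancel_right_aux {A : Type _} [AddCommGroup A] {a b c : A} :
      a + b + c - b - c = a := by abel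

theorem FL_le_span (hf : NP d d' f) (N : ℕ) :
    FL K d d' N ≤ Submodule.span K (em K d d' '' (Finset.range N)) ⊔ If f := by
  induction N with
  | zero => rw [FL_zero]; exact bot_le
  | succ n ih =>
    have hmono : Submodule.span K (em K d d' '' (Finset.range n)) ⊔ If f ≤
        Submodule.span K (em K d d' '' (Finset.range (n + 1))) ⊔ If f := by
      refine sup_le_sup_right (Submodule.span_mono (Set.image_mono ?_)) _
      intro x hx; simp at hx ⊢; omega
    refine (lemmaB hf n).trans (sup_le (sup_le ?_ (ih.trans hmono)) le_sup_right)
    rw [Submodule.span_singleton_le_iff_mem]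
    exact Submodule.mem_sup_left (Submodule.subset_span ⟨n, by simp, rfl⟩)

theorem good_gam (hd : 0 < d) {n : ℕ} {P : MvPolynomial (Fin 2) K} (h : Good d d' l μ n P) :
    Gam d d' n := by
  by_contra hg
  exact h.2 (psi_coeff_zero l μ (FL_succ_of_not_gam hd hg h.1))

theorem lemmaD (hf : NP d d' f) (hl : LM d d' f l μ) {w : ℕ} {H : MvPolynomial (Fin 2) K}
    (hH : Good d d' l μ w H) {ι : Type*} [Fintype ι] (T : MvPolynomial (Fin 2) K →ₗ[K] (ι → K))
    (hT : Function.Surjective T) (hTf : ∀ P, T (f * P) = 0) (hTH : ∀ P, T (H * P) = 0) :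
    Fintype.card ι ≤ w := by
  classical
  have hd : 0 < d := by have := hf.lt; omega
  have hwg := good_gam hd hH
  let Ap : Set ℕ := {n | Gam d d' n ∧ ¬ ∃ k, Gam d d' k ∧ n = k + w}
  have hgk : ∀ a k, Gam d d' a → Gam d d' (a + k * w) := by
    intro a k ha
    induction k with
    | zero => simpa using ha
    | succ k ih => rw [add_mul, one_mul, ← add_assoc]; exact gam_add hd ih hwg
  have hinj : ∀ a ∈ Ap, ∀ b ∈ Ap, a < b → a % w ≠ b % w := by
    intro a ha b hb hab hmod
    obtain ⟨k, hk⟩ := (Nat.modEq_iff_dvd' hab.le).1 hmod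
    apply hb.2
    rcases k with _ | k
    · omega
    · refine ⟨a + k * w, hgk a k ha.1, ?_⟩
      have : w * (k + 1) = k * w + w := by ring
      omega
  have hw0 : w = 0 → Ap = ∅ := by
    rintro rfl
    ext n
    simp only [Ap, Set.mem_ofPred_eq, Set.mem_empty_iff_false, iff_false]
    rintro ⟨h1, h2⟩
    exact h2 ⟨n, h1, rfl⟩
  have hInjOn : Set.InjOn (fun n => n % w) Ap := by
    intro a ha b hb hab
    rcases lt_trichotomy a b with h | h | h
    · exact absurd hab (hinj a ha b hb h)
    · exact h
    · exact absurd hab.symm (hinj b hb a ha h)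
  have hmaps : Set.MapsTo (fun n => n % w) Ap (Finset.range w : Set ℕ) := by
    intro a ha
    rcases Nat.eq_zero_or_pos w with h | h
    · rw [hw0 h] at ha; exact absurd ha (by simp)
    · simpa using Nat.mod_lt a h
  have hfin : Ap.Finite := Set.Finite.of_injOn hmaps hInjOn (Finset.finite_toSet _)
  have hcard : hfin.toFinset.card ≤ w := by
    have := Finset.card_le_card_of_injOn (s := hfin.toFinset) (t := Finset.range w)
      (fun n => n % w) (by intro a ha; exact hmaps (by simpa using ha))
      (by intro a ha b hb; exact hInjOn (by simpa using ha) (by simpa using hb))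
    simpa using this
  let IH : Submodule K (MvPolynomial (Fin 2) K) := If H
  let S := Submodule.span K ((hfin.toFinset.image (em K d d') : Finset _) : Set (MvPolynomial (Fin 2) K))
  have htop : If f ⊔ IH ⊔ S = ⊤ := by
    apply lemmaC hf hl (le_sup_left.trans le_sup_left)
    intro n hn
    by_cases h : ∃ k, Gam d d' k ∧ n = k + w
    · obtain ⟨k, hk, rfl⟩ := h
      refine ⟨H * em K d d' k, Submodule.mem_sup_left (Submodule.mem_sup_right ?_), ?_⟩
      · exact mem_If.2 (Dvd.intro _ rfl)
      · rw [add_comm]; exact hH.mul (em_good hl hk)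
    · refine ⟨em K d d' n, Submodule.mem_sup_right (Submodule.subset_span ?_), em_good hl hn⟩
      simp only [Finset.coe_image, Set.mem_image, Finset.mem_coe, Set.Finite.mem_toFinset]
      exact ⟨n, ⟨hn, h⟩, rfl⟩
  have hmap : Submodule.map T S = ⊤ := by
    have h1 : Submodule.map T ⊤ = ⊤ := by
      rw [Submodule.map_top, LinearMap.range_eq_top]; exact hT
    rw [← htop, Submodule.map_sup, Submodule.map_sup] at h1
    have h2 : Submodule.map T (If f) = ⊥ := by
      rw [eq_bot_iff]; rintro _ ⟨P, hP, rfl⟩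
      obtain ⟨Q, rfl⟩ := mem_If.1 hP
      simp [hTf]
    have h3 : Submodule.map T IH = ⊥ := by
      rw [eq_bot_iff]; rintro _ ⟨P, hP, rfl⟩
      obtain ⟨Q, rfl⟩ := mem_If.1 hP
      simp [hTH]
    rw [h2, h3] at h1
    simpa using h1
  have hfr : Module.finrank K (Submodule.map T S) ≤ w := by
    refine (Submodule.finrank_map_le T S).trans ?_
    refine (finrank_span_finset_le_card _).trans (Finset.card_image_le.trans hcard)
  rw [hmap, finrank_top, Module.finrank_fintype_fun_eq_card] at hfr
  exact hfr

theorem card_gam (hd : 0 < d) (cop : Nat.Coprime d d') [DecidablePred (Gam d d')] (M : ℕ) :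
    M ≤ ((Finset.range M).filter (Gam d d')).card + d * d' := by
  have h1 : (Finset.range M) ⊆ ((Finset.range M).filter (Gam d d')) ∪ Finset.range (d * d') := by
    intro n hn
    rw [Finset.mem_union, Finset.mem_filter]
    rcases Nat.lt_or_ge n (d * d') with h | h
    · right; simpa using h
    · left; exact ⟨hn, gam_large hd cop h⟩
  have := (Finset.card_le_card h1).trans (Finset.card_union_le _ _)
  simpa using this

end NPC



namespace NPC
open MvPolynomial

section Der
variable {K A : Type*} [Field K] [CommRing A] [Algebra K A] (D : Derivation K A A) (φ : A →ₐ[K] K)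

/-- vanishing to order `r` along `D`. -/
def van (r : ℕ) (P : A) : Prop := ∀ i < r, φ (D^[i] P) = 0

variable {D φ}

theorem van.mono {r s : ℕ} {P : A} (h : van D φ s P) (hrs : r ≤ s) : van D φ r P :=
  fun i hi => h i (by omega)

theorem van.der {r : ℕ} {P : A} (h : van D φ (r + 1) P) : van D φ r (D P) := by
  intro i hi
  have := h (i + 1) (by omega)
  rwa [Function.iterate_succ_apply] at this

theorem van_succ {r : ℕ} {P : A} (h0 : φ P = 0) (h : van D φ r (D P)) : van D φ (r + 1) P := by
  intro i hi
  rcases i with _ | i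
  · simpa using h0
  · rw [Function.iterate_succ_apply]; exact h i (by omega)

theorem van.add {r : ℕ} {P Q : A} (hP : van D φ r P) (hQ : van D φ r Q) : van D φ r (P + Q) := by
  intro i hi
  rw [iterate_map_add, map_add, hP i hi, hQ i hi, add_zero]

theorem van.mul {r : ℕ} : ∀ {P : A} (_ : van D φ r P) (h : A), van D φ r (P * h) := by
  induction r with
  | zero => intro P _ h i hi; omega
  | succ r ih =>
    intro P hP h
    apply van_succ
    · have := hP 0 (by omega)
      rw [Function.iterate_zero, id] at this
      rw [map_mul, this, zero_mul]
    · rw [Derivation.leibniz, smul_eq_mul, smul_eq_mul, mul_comm h]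
      exact (ih (hP.mono (by omega)) _).add (ih hP.der _)

theorem van.mul_t {r : ℕ} {t : A} (ht : φ t = 0) :
    ∀ {P : A} (_ : van D φ r P), van D φ (r + 1) (t * P) := by
  induction r with
  | zero => intro P _; exact van_succ (by simp [ht]) (by intro i hi; omega)
  | succ r ih =>
    intro P hP
    apply van_succ (by simp [ht])
    rw [Derivation.leibniz, smul_eq_mul, smul_eq_mul]
    exact (ih hP.der).add (hP.mul _)

theorem van.lead {r : ℕ} : ∀ {P : A} (_ : van D φ r P) (h : A),
    φ (D^[r] (P * h)) = φ (D^[r] P) * φ h := by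
  induction r with
  | zero => intro P _ h; simp
  | succ r ih =>
    intro P hP h
    rw [Function.iterate_succ_apply, Derivation.leibniz, smul_eq_mul, smul_eq_mul, mul_comm h,
      iterate_map_add, map_add, ih (hP.mono (by omega)), ih hP.der, hP r (by omega),
      Function.iterate_succ_apply]
    ring

theorem van.lead_t {r : ℕ} {t : A} (ht : φ t = 0) : ∀ {P : A} (_ : van D φ r P),
    φ (D^[r + 1] (t * P)) = (r + 1) * φ (D t) * φ (D^[r] P) := by
  induction r with
  | zero => intro P _; simp [ht]; ring
  | succ r ih =>
    intro P hP
    rw [Function.iterate_succ_apply, Derivation.leibniz, smul_eq_mul, smul_eq_mul,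
      iterate_map_add, map_add, ih hP.der, hP.lead, ← Function.iterate_succ_apply (f := D)]
    push_cast
    ring

theorem van_pow {t : A} (ht : φ t = 0) (u : A) (j : ℕ) : van D φ j (t ^ j * u) ∧
    φ (D^[j] (t ^ j * u)) = (j.factorial : K) * φ (D t) ^ j * φ u := by
  induction j with
  | zero => exact ⟨by intro i hi; omega, by simp⟩
  | succ j ih =>
    have e : t ^ (j + 1) * u = t * (t ^ j * u) := by ring
    rw [e]
    refine ⟨ih.1.mul_t ht, ?_⟩
    rw [ih.1.lead_t ht, ih.2, Nat.factorial_succ]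
    push_cast; ring

theorem iterate_mul_const {c : A} (hc : D c = 0) (P : A) (k : ℕ) :
    D^[k] (c * P) = c * D^[k] P := by
  induction k generalizing P with
  | zero => rfl
  | succ k ih =>
    rw [Function.iterate_succ_apply, Derivation.leibniz, hc, smul_zero, add_zero, smul_eq_mul, ih,
      Function.iterate_succ_apply]

end Der

variable {K : Type*} [Field K] {d d' : ℕ} {f : MvPolynomial (Fin 2) K} {l μ : K}

/-- The Hamiltonian derivation of `f`. -/
noncomputable def Dv (f : MvPolynomial (Fin 2) K) :
    Derivation K (MvPolynomial (Fin 2) K) (MvPolynomial (Fin 2) K) :=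
  pderiv 1 f • pderiv 0 - pderiv 0 f • pderiv 1

theorem Dv_apply (P : MvPolynomial (Fin 2) K) :
    Dv f P = pderiv 1 f * pderiv 0 P - pderiv 0 f * pderiv 1 P := by
  simp [Dv]

theorem Dv_f : Dv f f = 0 := by rw [Dv_apply]; ring

theorem Dv_X0 : Dv f (X 0) = pderiv 1 f := by
  rw [Dv_apply]
  simp [pderiv_X]

theorem ae (q : Fin 2 → K) (P : MvPolynomial (Fin 2) K) :
    (aeval q : MvPolynomial (Fin 2) K →ₐ[K] K) P = eval q P := rfl

theorem Dv_iter_smul (c : K) (P : MvPolynomial (Fin 2) K) (k : ℕ) :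
    (Dv f)^[k] (c • P) = c • (Dv f)^[k] P := by
  induction k generalizing P with
  | zero => rfl
  | succ k ih => rw [Function.iterate_succ_apply, Derivation.map_smul, ih, Function.iterate_succ_apply]

theorem vanish (hf : NP d d' f) (hl : LM d d' f l μ) {w : ℕ} {H : MvPolynomial (Fin 2) K}
    (hH : Good d d' l μ w H) (Z : Finset (Fin 2 → K)) (hZ : ∀ q ∈ Z, eval q f = 0) (m : ℕ)
    (hv : ∀ q ∈ Z, ∀ k < m, eval q ((Dv f)^[k] H) = 0)
    (hm : ∀ q ∈ Z, ∀ j < m, (j.factorial : K) * (eval q (pderiv 1 f)) ^ j ≠ 0) :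
    Z.card * m ≤ w := by
  classical
  let T : MvPolynomial (Fin 2) K →ₗ[K] (Z × Fin m → K) :=
    { toFun := fun P a => eval a.1.1 ((Dv f)^[a.2] P)
      map_add' := by intro P Q; ext a; simp [iterate_map_add]
      map_smul' := by intro c P; ext a; simp [Dv_iter_smul] }
  have hTa : ∀ P a, T P a = eval a.1.1 ((Dv f)^[a.2] P) := fun P a => rfl
  have hsurj : Function.Surjective T := by
    rw [← LinearMap.range_eq_top, eq_top_iff]
    have key : ∀ n : ℕ, ∀ (q : Z) (j : Fin m), m - j.1 ≤ n →
        (Pi.single (q, j) 1 : Z × Fin m → K) ∈ LinearMap.range T := by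
      intro n
      induction n with
      | zero => intro q j h; have := j.2; omega
      | succ n ih =>
        intro q j hj
        have hlin : ∀ q' : Fin 2 → K, ∃ L : MvPolynomial (Fin 2) K, eval q' L = 0 ∧
            (q' ≠ q.1 → eval q.1 L ≠ 0) := by
          intro q'
          by_cases h : q' = q.1
          · exact ⟨0, by simp, fun h' => absurd h h'⟩
          · obtain ⟨i, hi⟩ := Function.ne_iff.1 h
            exact ⟨X i - C (q' i), by simp, fun _ => by simpa [sub_eq_zero] using hi.symm⟩
        choose L hL1 hL2 using hlin
        let u : MvPolynomial (Fin 2) K := ∏ q' ∈ Z.erase q.1, L q' ^ m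
        have hu : eval q.1 u ≠ 0 := by
          simp only [u, map_prod, map_pow]
          exact Finset.prod_ne_zero_iff.2 fun q' hq' =>
            pow_ne_zero _ (hL2 q' (Finset.ne_of_mem_erase hq'))
        let t : MvPolynomial (Fin 2) K := X 0 - C (q.1 0)
        have ht : eval q.1 t = 0 := by simp [t]
        have hDt : Dv f t = pderiv 1 f := by
          simp only [t, map_sub, Dv_X0]
          rw [← algebraMap_eq, Derivation.map_algebraMap, sub_zero]
        have hvp := van_pow (D := Dv f) (φ := aeval q.1) (t := t)
          (by rw [ae]; exact ht) u j
        have hT0 : ∀ a : Z × Fin m, (a.1 ≠ q ∨ a.2 < j) → T (t ^ j.1 * u) a = 0 := by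
          intro a ha
          rw [hTa]
          by_cases haq : a.1 = q
          · have h2 : a.2 < j := by tauto
            rw [haq]
            have := hvp.1 a.2 h2
            rwa [ae] at this
          · have h1 : van (Dv f) (aeval a.1.1) m (L a.1.1 ^ m * 1) := by
              refine (van_pow ?_ 1 m).1
              rw [ae]; exact hL1 _
            have hmem : a.1.1 ∈ Z.erase q.1 :=
              Finset.mem_erase.2 ⟨fun h => haq (Subtype.ext h), a.1.2⟩
            have h3 : t ^ j.1 * u = (L a.1.1 ^ m * 1) *
                (t ^ j.1 * ∏ q' ∈ (Z.erase q.1).erase a.1.1, L q' ^ m) := by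
              simp only [u]
              rw [← Finset.mul_prod_erase _ _ hmem]; ring
            have h4 := (h1.mul (t ^ j.1 * ∏ q' ∈ (Z.erase q.1).erase a.1.1, L q' ^ m)) a.2 a.2.2
            rw [← h3, ae] at h4
            exact h4
        have hTj : T (t ^ j.1 * u) (q, j) ≠ 0 := by
          rw [hTa]
          have h5 := hvp.2
          rw [ae] at h5
          rw [h5, hDt]
          exact mul_ne_zero (hm q.1 q.2 j j.2) hu
        have hsum : T (t ^ j.1 * u) = ∑ a, T (t ^ j.1 * u) a • (Pi.single a 1 : Z × Fin m → K) := by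
          ext b
          simp [Finset.sum_apply, Pi.single_apply]
        rw [← Finset.add_sum_erase _ _ (Finset.mem_univ (q, j))] at hsum
        have hrest : ∑ a ∈ Finset.univ.erase (q, j), T (t ^ j.1 * u) a •
            (Pi.single a 1 : Z × Fin m → K) ∈ LinearMap.range T := by
          refine Submodule.sum_mem _ fun a ha => ?_
          by_cases hc : a.1 ≠ q ∨ a.2 < j
          · rw [hT0 a hc, zero_smul]; exact Submodule.zero_mem _
          · push Not at hc
            have hne := Finset.ne_of_mem_erase ha
            have : j < a.2 := by
              refine lt_of_le_of_ne hc.2 fun h => hne (Prod.ext hc.1 h.symm)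
            refine Submodule.smul_mem _ _ ?_
            exact ih a.1 a.2 (by have : j.1 < a.2.1 := this; have := j.2; omega)
        have h6 : T (t ^ j.1 * u) (q, j) • (Pi.single (q, j) 1 : Z × Fin m → K) ∈
            LinearMap.range T := by
          have := Submodule.sub_mem _ (LinearMap.mem_range_self T (t ^ j.1 * u)) hrest
          rwa [← eq_sub_of_add_eq hsum.symm] at this
        exact (Submodule.smul_mem_iff _ hTj).1 h6
    intro v _
    have hsum : v = ∑ a, v a • (Pi.single a 1 : Z × Fin m → K) := by
      ext b
      simp [Finset.sum_apply, Pi.single_apply]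
    rw [hsum]
    exact Submodule.sum_mem _ fun a _ => Submodule.smul_mem _ _ (key m a.1 a.2 (by omega))
  have := lemmaD hf hl hH T hsurj ?_ ?_
  · simpa using this
  · intro P
    ext a
    rw [hTa, iterate_mul_const Dv_f, map_mul, hZ _ a.1.2, zero_mul]; rfl
  · intro P
    ext a
    have h1 : van (Dv f) (aeval a.1.1) m H := by
      intro i hi
      rw [ae]; exact hv _ a.1.2 i hi
    have := (h1.mul P) a.2 a.2.2
    rw [ae] at this
    rw [hTa]; exact this

/-- Simple zero count. -/
theorem bezout (hf : NP d d' f) (hl : LM d d' f l μ) {w : ℕ} {H : MvPolynomial (Fin 2) K}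
    (hH : Good d d' l μ w H) (Z : Finset (Fin 2 → K)) (hZ : ∀ q ∈ Z, eval q f = 0)
    (hv : ∀ q ∈ Z, eval q H = 0) : Z.card ≤ w := by
  have := vanish hf hl hH Z hZ 1 (by intro q hq k hk; obtain rfl : k = 0 := by omega
                                     simpa using hv q hq)
    (by intro q hq j hj; obtain rfl : j = 0 := by omega
        simp)
  simpa using this

theorem pderiv0_FL {n : ℕ} {P : MvPolynomial (Fin 2) K} (h : P ∈ FL K d d' n) (i : Fin 2) :
    pderiv i P ∈ FL K d d' n := by
  have : FL K d d' n ≤ (FL K d d' n).comap (pderiv i).toLinearMap := by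
    apply FL_le_of_monomial
    intro m hm
    rw [Submodule.mem_comap]
    change pderiv i (monomial m 1) ∈ _
    rw [pderiv_monomial]
    apply monomial_mem_FL
    refine lt_of_le_of_lt ?_ hm
    simp only [wt, Finsupp.coe_tsub, Pi.sub_apply]
    gcongr <;> omega
  exact this h

theorem Dv_FL (hf : NP d d' f) {n : ℕ} {P : MvPolynomial (Fin 2) K} (h : P ∈ FL K d d' (n + 1)) :
    Dv f P ∈ FL K d d' (n + d * d' + 1) := by
  rw [Dv_apply, add_comm n]
  exact Submodule.sub_mem _ (FL_mul (pderiv0_FL (f_mem_FL hf) 1) (pderiv0_FL h 0))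
    (FL_mul (pderiv0_FL (f_mem_FL hf) 0) (pderiv0_FL h 1))

theorem Dv_iter_FL (hf : NP d d' f) {n : ℕ} {P : MvPolynomial (Fin 2) K}
    (h : P ∈ FL K d d' (n + 1)) (k : ℕ) :
    (Dv f)^[k] P ∈ FL K d d' (n + k * (d * d') + 1) := by
  induction k with
  | zero => simpa using h
  | succ k ih =>
    rw [Function.iterate_succ_apply']
    have := Dv_FL hf ih
    rwa [add_mul, one_mul, ← add_assoc]

theorem pderiv_good (hf : NP d d' f) (hl : LM d d' f l μ) (hc : (d' : K) ≠ 0) :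
    Good d d' l μ (d * d' - d) (pderiv 1 f) := by
  set b := coeff (Finsupp.single 1 d') f with hb
  have hdd : d ≤ d * d' := Nat.le_mul_of_pos_right _ hf.pos
  have hrest : pderiv 1 (f - monomial (Finsupp.single 1 d') b) ∈ FL K d d' (d * d' - d) := by
    rw [MvPolynomial.as_sum (f - monomial (Finsupp.single 1 d') b), map_sum]
    refine Submodule.sum_mem _ fun m hm => ?_
    rw [pderiv_monomial]
    by_cases h1 : m 1 = 0
    · simp [h1]
    rw [mem_support_iff] at hm
    have hne : Finsupp.single 1 d' ≠ m := by
      rintro rfl; apply hm; simp [hb]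
    have hne0 : m ≠ Finsupp.single 0 d := by
      rintro rfl; simp at h1
    have := hf.low m (by simpa [coeff_monomial, hne] using hm) hne0 (Ne.symm hne)
    apply monomial_mem_FL
    simp only [wt, Finsupp.coe_tsub, Pi.sub_apply] at this ⊢
    simp only [Finsupp.single_apply]
    simp
    obtain ⟨t, ht⟩ := Nat.exists_eq_succ_of_ne_zero h1
    rw [ht] at this ⊢
    simp only [Nat.succ_sub_one]
    rw [Nat.succ_mul] at this
    omega
  have hmon : pderiv 1 (monomial (Finsupp.single 1 d') b) =
      monomial (Finsupp.single (1 : Fin 2) (d' - 1)) (b * d') := by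
    have h : (Finsupp.single (1 : Fin 2) d' - Finsupp.single 1 1 : Fin 2 →₀ ℕ) =
        Finsupp.single 1 (d' - 1) := by
      ext i; fin_cases i <;> simp
    rw [pderiv_monomial, h]
    simp
  have hwt : wt d d' (Finsupp.single (1 : Fin 2) (d' - 1)) = d * d' - d := by
    simp [wt]; rw [Nat.sub_mul, one_mul, mul_comm]
  have e : pderiv 1 f = pderiv 1 (f - monomial (Finsupp.single 1 d') b) +
      monomial (Finsupp.single (1 : Fin 2) (d' - 1)) (b * d') := by
    rw [← hmon, ← map_add]; congr 1; ring
  rw [e]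
  refine ⟨Submodule.add_mem _ (FL_mono (by omega) hrest) (monomial_mem_FL _ (by omega)), ?_⟩
  rw [map_add, Polynomial.coeff_add, psi_coeff_zero _ _ hrest, psi_monomial, hwt]
  simp
  exact ⟨⟨hf.hb, hc⟩, fun h => absurd h hl.2.1⟩

end NPC



namespace NPC
open MvPolynomial

theorem lin_sys {K V ι : Type*} [Field K] [AddCommGroup V] [Module K V] [Fintype ι] (m : ℕ)
    (N : ℕ → ℕ) (I : Submodule K V) (e : ℕ → V) (v : ℕ → ι → V)
    (hv : ∀ k < m, ∀ a, v k a ∈ Submodule.span K (e '' (Finset.range (N k))) ⊔ I)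
    (hN : ∑ k ∈ Finset.range m, N k < Fintype.card ι) :
    ∃ c : ι → K, c ≠ 0 ∧ ∀ k < m, ∑ a, c a • v k a ∈ I := by
  classical
  have h1 : ∀ k, ∀ a, ∃ u : ℕ → K, k < m → v k a - ∑ n ∈ Finset.range (N k), u n • e n ∈ I := by
    intro k a
    by_cases hk : k < m
    · obtain ⟨y, hy, z, hz, hyz⟩ := Submodule.mem_sup.1 (hv k hk a)
      obtain ⟨u, hu⟩ := (Submodule.mem_span_image_finset_iff_exists_fun K).1 hy
      have hu' : ∑ n ∈ Finset.range (N k),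
          (if h : n ∈ Finset.range (N k) then u ⟨n, h⟩ else 0) • e n = y := by
        rw [← hu, ← Finset.sum_coe_sort]
        refine Finset.sum_congr rfl fun i _ => ?_
        rw [dif_pos i.2]
      exact ⟨_, fun _ => by rw [hu', ← hyz]; simpa using hz⟩
    · exact ⟨0, fun h => absurd h hk⟩
  choose u hu using h1
  let T : (ι → K) →ₗ[K] ((Σ k : Fin m, Fin (N k)) → K) :=
    { toFun := fun c x => ∑ a, c a * u x.1 a x.2
      map_add' := by intro c c'; ext x; simp [add_mul, Finset.sum_add_distrib]
      map_smul' := by intro c c'; ext x; simp [mul_assoc, Finset.mul_sum] }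
  have hlt : Module.finrank K ((Σ k : Fin m, Fin (N k)) → K) < Module.finrank K (ι → K) := by
    rw [Module.finrank_fintype_fun_eq_card, Module.finrank_fintype_fun_eq_card, Fintype.card_sigma]
    simpa [Finset.sum_range] using hN
  have hker := LinearMap.ker_ne_bot_of_finrank_lt (f := T) hlt
  obtain ⟨c, hc, hc0⟩ := (Submodule.ne_bot_iff _).1 hker
  refine ⟨c, hc0, fun k hk => ?_⟩
  have h2 : ∑ a, c a • (v k a - ∑ n ∈ Finset.range (N k), u k a n • e n) ∈ I :=
    Submodule.sum_mem _ fun a _ => Submodule.smul_mem _ _ (hu k a hk)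
  have h3 : ∑ a, c a • ∑ n ∈ Finset.range (N k), u k a n • e n = 0 := by
    simp_rw [Finset.smul_sum, smul_smul]
    rw [Finset.sum_comm]
    apply Finset.sum_eq_zero
    intro n hn
    rw [← Finset.sum_smul]
    have := congrFun (LinearMap.mem_ker.1 hc) ⟨⟨k, hk⟩, ⟨n, by simpa using hn⟩⟩
    change ∑ a, c a * u k a n = 0 at this
    rw [this, zero_smul]
  simp_rw [smul_sub] at h2
  rwa [Finset.sum_sub_distrib, h3, sub_zero] at h2

theorem stepanov_arith {G m p : ℕ} (hG : 1 ≤ G) (hm : 10 * G ≤ m) (hp : m * m ≤ p) :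
    m * (p + (m + 4 * G)) + G * (m * (m - 1) / 2) < (p - G) * (m + 4 * G + 1 - G) := by
  have h1 : G ≤ p := by nlinarith
  have h2 : m * (m - 1) / 2 ≤ p := by
    refine (Nat.div_le_self _ _).trans (le_trans ?_ hp)
    exact Nat.mul_le_mul_left _ (by omega)
  have h3 : m + 4 * G + 1 - G = m + 3 * G + 1 := by omega
  rw [h3]
  obtain ⟨q, rfl⟩ := Nat.exists_eq_add_of_le h1
  rw [Nat.add_sub_cancel_left]
  have h4 : G * (m * (m - 1) / 2) ≤ G * (G + q) := Nat.mul_le_mul_left _ h2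
  nlinarith

theorem stepanov {p : ℕ} [Fact p.Prime] {d d' : ℕ} {f : MvPolynomial (Fin 2) (ZMod p)}
    (hf : NP d d' f) (hp : 100 * d ^ 4 ≤ p) (Z : Finset (Fin 2 → ZMod p))
    (hZ : ∀ q ∈ Z, eval q f = 0) (hZ' : ∀ q ∈ Z, eval q (pderiv 1 f) ≠ 0) :
    Z.card * Nat.sqrt p ≤ p - 1 + p * (Nat.sqrt p + 4 * (d * d')) := by
  classical
  obtain ⟨l, μ, hl⟩ := exists_lm hf
  have hl : LM d d' f l μ := hl
  have hd : 0 < d := by have := hf.lt; omega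
  set G := d * d' with hG
  set m := Nat.sqrt p with hm
  have hG1 : 1 ≤ G := Nat.mul_pos hd hf.pos
  have hGd : G ≤ d ^ 2 := by have := hf.lt; nlinarith
  have hm10 : 10 * G ≤ m := by
    rw [hm, Nat.le_sqrt]
    refine le_trans ?_ hp
    nlinarith
  have hmp : m * m ≤ p := Nat.sqrt_le p
  have hp1 : 1 < p := (Fact.out : p.Prime).one_lt
  have hmlt : m < p := Nat.sqrt_lt_self hp1
  set S := ((Finset.range p).filter (Gam d d')) ×ˢ ((Finset.range (m + 4 * G + 1)).filter (Gam d d'))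
    with hS
  have hScard : (p - G) * (m + 4 * G + 1 - G) ≤ S.card := by
    rw [hS, Finset.card_product]
    have h1 := card_gam hd hf.cop p
    have h2 := card_gam hd hf.cop (m + 4 * G + 1)
    exact Nat.mul_le_mul (by omega) (by omega)
  have hsum : ∑ k ∈ Finset.range m, (p - 1 + k * G + (m + 4 * G) + 1) < Fintype.card S := by
    rw [Fintype.card_coe]
    refine lt_of_lt_of_le (lt_of_eq_of_lt ?_ (stepanov_arith hG1 hm10 hmp)) hScard
    rw [← Finset.sum_range_id_mul_two, Nat.mul_div_cancel _ (by norm_num), Finset.mul_sum]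
    have : ∀ k ∈ Finset.range m, (p - 1 + k * G + (m + 4 * G) + 1) = (p + (m + 4 * G)) + G * k := by
      intro k _
      rw [mul_comm k]; omega
    rw [Finset.sum_congr rfl this, Finset.sum_add_distrib]
    simp
  obtain ⟨c, hc0, hc⟩ := lin_sys (ι := S) m (fun k => p - 1 + k * G + (m + 4 * G) + 1) (If f)
    (em (ZMod p) d d')
    (fun k a => (Dv f)^[k] (em (ZMod p) d d' a.1.1) * em (ZMod p) d d' a.1.2) (by
      intro k hk a
      apply FL_le_span hf
      have ha := a.2
      simp only [hS, Finset.mem_product, Finset.mem_filter, Finset.mem_range] at ha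
      refine FL_mul (Dv_iter_FL hf ?_ k) ?_
      · exact FL_mono (by omega) (em_good hl ha.1.2).1
      · exact FL_mono (by omega) (em_good hl ha.2.2).1) hsum
  have hgood := good_sum (d := d) (d' := d') (l := l) (μ := μ) (Finset.univ : Finset S)
    (fun a => a.1.1 + p * a.1.2) (fun a => em (ZMod p) d d' a.1.1 * em (ZMod p) d d' a.1.2 ^ p)
    (by
      intro a _
      have ha := a.2
      simp only [hS, Finset.mem_product, Finset.mem_filter, Finset.mem_range] at ha
      exact (em_good hl ha.1.2).mul ((em_good hl ha.2.2).pow p))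
    (by
      intro a _ b _ hab
      have ha := a.2
      have hb := b.2
      simp only [hS, Finset.mem_product, Finset.mem_filter, Finset.mem_range] at ha hb
      simp only at hab
      have h1 := congrArg (· % p) hab
      simp only [Nat.add_mul_mod_self_left, Nat.mod_eq_of_lt ha.1.1, Nat.mod_eq_of_lt hb.1.1] at h1
      rw [h1] at hab
      have h2 : a.1.2 = b.1.2 := Nat.eq_of_mul_eq_mul_left (by omega) (Nat.add_left_cancel hab)
      exact Subtype.ext (Prod.ext h1 h2)) c
    (by
      obtain ⟨a, ha⟩ := Function.ne_iff.1 hc0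
      exact ⟨a, Finset.mem_univ _, ha⟩)
  obtain ⟨a, -, hH⟩ := hgood
  have ha := a.2
  simp only [hS, Finset.mem_product, Finset.mem_filter, Finset.mem_range] at ha
  refine (vanish hf hl hH Z hZ m ?_ ?_).trans ?_
  · intro q hq k hk
    have hk' := hc k hk
    rw [mem_If] at hk'
    obtain ⟨r, hr⟩ := hk'
    have h1 : eval q (∑ a : S, c a • ((Dv f)^[k] (em (ZMod p) d d' a.1.1) *
        em (ZMod p) d d' a.1.2)) = 0 := by
      rw [hr, map_mul, hZ q hq, zero_mul]
    rw [← h1]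
    have hiter : ∀ (T : Finset S) (g : S → MvPolynomial (Fin 2) (ZMod p)),
        (Dv f)^[k] (∑ a ∈ T, g a) = ∑ a ∈ T, (Dv f)^[k] (g a) := by
      intro T g
      induction T using Finset.induction_on with
      | empty => simp [iterate_map_zero]
      | insert a T ha ih => rw [Finset.sum_insert ha, Finset.sum_insert ha, iterate_map_add, ih]
    rw [hiter, map_sum, map_sum]
    refine Finset.sum_congr rfl fun b _ => ?_
    have hD0 : Dv f (em (ZMod p) d d' b.1.2 ^ p) = 0 := by
      rw [Derivation.leibniz_pow]
      rw [← Nat.cast_smul_eq_nsmul (ZMod p)]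
      simp
    rw [Dv_iter_smul, mul_comm, iterate_mul_const hD0]
    simp only [smul_eval, map_mul, map_pow, ZMod.pow_card]
    ring
  · intro q hq j hj
    refine mul_ne_zero ?_ (pow_ne_zero _ (hZ' q hq))
    rw [Ne, ZMod.natCast_eq_zero_iff, (Fact.out : p.Prime).dvd_factorial]
    omega
  · have : p * a.1.2 ≤ p * (m + 4 * G) := Nat.mul_le_mul_left _ (by omega)
    omega

/-- Weighted point count modulo `p`. -/
theorem weighted_count {p : ℕ} [Fact p.Prime] {d d' : ℕ} {f : MvPolynomial (Fin 2) (ZMod p)}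
    (hf : NP d d' f) (hp : 100 * d ^ 4 ≤ p) (ρ : (Fin 2 → ZMod p) → ℕ)
    (h0 : ∀ q, eval q f ≠ 0 → ρ q = 0)
    (h1 : ∀ q, eval q (pderiv 1 f) ≠ 0 → ρ q ≤ 1) (h2 : ∀ q, ρ q ≤ d') :
    ((∑ q, ρ q : ℕ) : ℝ) ≤ p + 7 * d ^ 2 * Real.sqrt p := by
  classical
  obtain ⟨l, μ, hl⟩ := exists_lm hf
  have hl : LM d d' f l μ := hl
  have hd : 0 < d := by have := hf.lt; omega
  set Zg := (Finset.univ : Finset (Fin 2 → ZMod p)).filter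
    (fun q => eval q f = 0 ∧ eval q (pderiv 1 f) ≠ 0) with hZg
  set Zb := (Finset.univ : Finset (Fin 2 → ZMod p)).filter
    (fun q => eval q f = 0 ∧ eval q (pderiv 1 f) = 0) with hZb
  have hlt := hf.lt
  have hpos := hf.pos
  have hG1 : 1 ≤ d * d' := Nat.mul_pos hd hf.pos
  have hGd : d * d' ≤ d ^ 2 := by nlinarith
  have hd4 : d ≤ d ^ 4 := by
    calc d = d ^ 1 := (pow_one d).symm
      _ ≤ d ^ 4 := Nat.pow_le_pow_right hd (by norm_num)
  have hg := stepanov hf hp Zg (fun q hq => (Finset.mem_filter.1 hq).2.1)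
    (fun q hq => (Finset.mem_filter.1 hq).2.2)
  have hb := bezout hf hl (pderiv_good hf hl (by
    rw [Ne, ZMod.natCast_eq_zero_iff]
    intro h
    have := Nat.le_of_dvd hpos h
    omega)) Zb (fun q hq => (Finset.mem_filter.1 hq).2.1)
    (fun q hq => (Finset.mem_filter.1 hq).2.2)
  have hsum : ∑ q, ρ q ≤ Zg.card + Zb.card * d' := by
    have : ∀ q, ρ q ≤ (if q ∈ Zg then 1 else 0) + (if q ∈ Zb then d' else 0) := by
      intro q
      by_cases e0 : eval q f = 0
      · by_cases e1 : eval q (pderiv 1 f) = 0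
        · simp [hZg, hZb, e0, e1, h2 q]
        · simp [hZg, hZb, e0, e1, h1 q e1]
      · simp [h0 q e0]
    refine (Finset.sum_le_sum fun q _ => this q).trans ?_
    rw [Finset.sum_add_distrib]
    simp
  set m := Nat.sqrt p with hm
  have hm10 : 10 * d ^ 2 ≤ m := by
    rw [hm, Nat.le_sqrt]
    refine le_trans ?_ hp
    nlinarith
  have hpm : p ≤ m * m + m + m := Nat.sqrt_le_add p
  have hmr : (m : ℝ) ≤ Real.sqrt p := Real.nat_sqrt_le_real_sqrt
  have hbb : Zb.card * d' ≤ d ^ 2 * m := by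
    have : Zb.card ≤ d ^ 2 := by omega
    have : d' ≤ m := by nlinarith
    gcongr
  have hgg : Zg.card ≤ p + 6 * d ^ 2 * m := by
    have hd2 : 1 ≤ d ^ 2 := Nat.one_le_pow _ _ hd
    have hmpos : 0 < m := by omega
    have h3 : Zg.card * m ≤ (p + 6 * d ^ 2 * m) * m := by
      have e1 : p * (4 * (d * d')) ≤ p * (4 * d ^ 2) := by gcongr
      have e2 : p * d ^ 2 ≤ (m * m + m + m) * d ^ 2 := by gcongr
      have e3 : p ≤ p * d ^ 2 := Nat.le_mul_of_pos_right _ hd2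
      have e4 : 10 * (m * d ^ 2) ≤ m * (m * d ^ 2) := by
        have : 10 ≤ m := by omega
        gcongr
      have : p - 1 ≤ p := Nat.sub_le _ _
      nlinarith
    exact Nat.le_of_mul_le_mul_right h3 hmpos
  have htot : ∑ q, ρ q ≤ p + 7 * d ^ 2 * m := by
    refine hsum.trans ?_
    nlinarith
  calc ((∑ q, ρ q : ℕ) : ℝ) ≤ ((p + 7 * d ^ 2 * m : ℕ) : ℝ) := by exact_mod_cast htot
    _ = p + 7 * d ^ 2 * m := by push_cast; ring
    _ ≤ _ := by gcongr

end NPC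



namespace NPC
open MvPolynomial

/-- Multilinear expansion: divisibility of a determinant. -/
theorem det_dvd {J ι : Type*} [Fintype J] [DecidableEq J] [Fintype ι] [DecidableEq ι]
    (p k : ℕ) (w : ι → J → ℤ) (e : ι → ℕ) (hw : ∀ a j, (p : ℤ) ^ e a ∣ w a j)
    (v : Matrix J J ℤ) (c : J → ι → ℤ) (z : J → J → ℤ)
    (hv : ∀ i j, v i j = ∑ a, c i a * w a j + (p : ℤ) ^ k * z i j) :
    (p : ℤ) ^ (k * Fintype.card J - ∑ a, (k - e a)) ∣ v.det := by
  classical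
  let u : ι ⊕ J → J → ℤ := Sum.elim w (fun j => Pi.single j ((p : ℤ) ^ k))
  let e' : ι ⊕ J → ℕ := Sum.elim e (fun _ => k)
  let c' : J → ι ⊕ J → ℤ := fun i => Sum.elim (c i) (z i)
  have hu : ∀ b j, (p : ℤ) ^ e' b ∣ u b j := by
    rintro (a | j') j
    · exact hw a j
    · simp only [u, e', Sum.elim_inr, Pi.single_apply]
      split_ifs <;> simp
  have hv' : v = fun i => ∑ b, c' i b • u b := by
    ext i j
    rw [hv, Finset.sum_apply, Fintype.sum_sum_type]
    simp [c', u, Pi.single_apply, mul_comm]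
  have hdet : v.det = ∑ r : J → ι ⊕ J, Matrix.detRowAlternating (fun i => c' i (r i) • u (r i)) := by
    change Matrix.detRowAlternating v = _
    rw [hv']
    exact MultilinearMap.map_sum (Matrix.detRowAlternating (n := J) (R := ℤ)).toMultilinearMap _
  rw [hdet]
  refine Finset.dvd_sum fun r _ => ?_
  have h1 := MultilinearMap.map_smul_univ (Matrix.detRowAlternating (n := J) (R := ℤ)).toMultilinearMap
    (fun i => c' i (r i)) (fun i => u (r i))
  change Matrix.detRowAlternating (fun i => c' i (r i) • u (r i)) =
    (∏ i, c' i (r i)) • Matrix.detRowAlternating (fun i => u (r i)) at h1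
  rw [h1, smul_eq_mul]
  apply Dvd.dvd.mul_left
  by_cases hr : Function.Injective r
  · choose u' hu' using hu
    have h2 : (fun i => u (r i)) = fun i => ((p : ℤ) ^ e' (r i)) • u' (r i) := by
      ext i j
      simp [hu']
    have h3 := MultilinearMap.map_smul_univ
      (Matrix.detRowAlternating (n := J) (R := ℤ)).toMultilinearMap
      (fun i => (p : ℤ) ^ e' (r i)) (fun i => u' (r i))
    change Matrix.detRowAlternating (fun i => (p : ℤ) ^ e' (r i) • u' (r i)) =
      (∏ i, (p : ℤ) ^ e' (r i)) • Matrix.detRowAlternating (fun i => u' (r i)) at h3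
    rw [h2, h3, smul_eq_mul, Finset.prod_pow_eq_pow_sum]
    apply Dvd.dvd.mul_right
    apply pow_dvd_pow
    have h4 : ∑ i, (k - e' (r i)) ≤ ∑ a, (k - e a) := by
      have : ∑ b, (k - e' b) = ∑ a, (k - e a) := by
        rw [Fintype.sum_sum_type]; simp [e']
      rw [← this]
      rw [← Finset.sum_image (s := Finset.univ) (g := r) (f := fun b => k - e' b)
        (by intro x _ y _ h; exact hr h)]
      exact Finset.sum_le_sum_of_subset (Finset.subset_univ _)
    have h5 : k * Fintype.card J ≤ ∑ i, e' (r i) + ∑ i, (k - e' (r i)) := by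
      rw [← Finset.sum_add_distrib]
      calc k * Fintype.card J = ∑ i : J, k := by simp [mul_comm]
        _ ≤ _ := Finset.sum_le_sum fun i _ => by omega
    omega
  · rw [Matrix.detRowAlternating.map_eq_zero_of_not_injective]
    · exact dvd_zero _
    · intro h
      apply hr
      intro x y hxy
      apply h
      simp only [hxy]

/-- `f(a,Y)` as an integer polynomial in `Y`. -/
noncomputable def sp {R : Type*} [CommRing R] (a : R) : MvPolynomial (Fin 2) R →ₐ[R] Polynomial R :=
  aeval ![Polynomial.C a, Polynomial.X]

theorem sp_split (a : ℤ) (h : MvPolynomial (Fin 2) ℤ) :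
    ∃ h2, h = Polynomial.aeval (X 1) (sp a h) + (X 0 - C a) * h2 := by
  induction h using MvPolynomial.induction_on with
  | C c => exact ⟨0, by simp [sp]⟩
  | add g h hg hh =>
    obtain ⟨g2, hg⟩ := hg
    obtain ⟨h2, hh⟩ := hh
    refine ⟨g2 + h2, ?_⟩
    rw [map_add, map_add]
    linear_combination hg + hh
  | mul_X g i hg =>
    obtain ⟨g2, hg⟩ := hg
    fin_cases i
    · refine ⟨g2 * X 0 + Polynomial.aeval (X 1) (sp a g), ?_⟩
      have : sp a (X 0) = Polynomial.C a := by simp [sp]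
      simp only [Fin.zero_eta, map_mul, this, Polynomial.aeval_C]
      change _ = _ * C a + _
      linear_combination (X 0) * hg
    · refine ⟨g2 * X 1, ?_⟩
      have : sp a (X 1) = Polynomial.X := by simp [sp]
      simp only [Fin.mk_one, map_mul, this, Polynomial.aeval_X]
      linear_combination (X 1) * hg

theorem exists_lift (p : ℕ) (P : Polynomial (ZMod p)) :
    ∃ Q : Polynomial ℤ, Q.map (Int.castRingHom (ZMod p)) = P := by
  have := Polynomial.map_surjective (Int.castRingHom (ZMod p)) (ZMod.ringHom_surjective _)
  exact this P

theorem map_eq_zero_dvd (p : ℕ) (P : Polynomial ℤ) (h : P.map (Int.castRingHom (ZMod p)) = 0) :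
    ∃ Q, P = Polynomial.C (p : ℤ) * Q := by
  have : Polynomial.C (p : ℤ) ∣ P := by
    rw [Polynomial.C_dvd_iff_dvd_coeff]
    intro i
    have := congrArg (fun Q => Polynomial.coeff Q i) h
    simp only [Polynomial.coeff_map, eq_intCast, Polynomial.coeff_zero] at this
    exact (ZMod.intCast_zmod_eq_zero_iff_dvd _ _).1 this
  exact this

/-- polynomial remainder in powers of `Y - b`. -/
theorem poly_rem {K : Type*} [Field K] (b : K) (ρ : ℕ) (h : Polynomial K) :
    ∃ (c : ℕ → K) (q : Polynomial K), h = ∑ r ∈ Finset.range ρ,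
      Polynomial.C (c r) * (Polynomial.X - Polynomial.C b) ^ r +
      (Polynomial.X - Polynomial.C b) ^ ρ * q := by
  induction ρ with
  | zero => exact ⟨0, h, by simp⟩
  | succ n ih =>
    obtain ⟨c, q, hq⟩ := ih
    refine ⟨fun r => if r = n then q.eval b else c r, q /ₘ (Polynomial.X - Polynomial.C b), ?_⟩
    rw [Finset.sum_range_succ]
    simp only [if_true]
    have h1 : ∑ r ∈ Finset.range n, Polynomial.C (if r = n then q.eval b else c r) *
        (Polynomial.X - Polynomial.C b) ^ r = ∑ r ∈ Finset.range n,
      Polynomial.C (c r) * (Polynomial.X - Polynomial.C b) ^ r := by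
      refine Finset.sum_congr rfl fun r hr => ?_
      rw [if_neg (by simp at hr; omega)]
    rw [h1]
    have h2 := Polynomial.modByMonic_add_div q (Polynomial.X - Polynomial.C b)
    rw [Polynomial.modByMonic_X_sub_C_eq_C_eval] at h2
    conv_lhs => rw [hq, ← h2]
    ring

/-- One step of the local decomposition. -/
theorem local_step (p k : ℕ) [Fact p.Prime] (f : MvPolynomial (Fin 2) ℤ) (a b : ℤ)
    (I : Ideal (MvPolynomial (Fin 2) ℤ)) (hfI : f ∈ I) (hβ : (X 1 - C b) ^ k ∈ I)
    (hF : (sp a f).map (Int.castRingHom (ZMod p)) ≠ 0) (h : MvPolynomial (Fin 2) ℤ) :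
    ∃ (c : ℕ → ℤ) (h1 h2 : MvPolynomial (Fin 2) ℤ), h -
      (∑ r ∈ Finset.range (((sp a f).map (Int.castRingHom (ZMod p))).rootMultiplicity (b : ZMod p)),
        C (c r) * (X 1 - C b) ^ r + C (p : ℤ) * h1 + (X 0 - C a) * h2) ∈ I := by
  set F := (sp a f).map (Int.castRingHom (ZMod p)) with hFdef
  set ρ := F.rootMultiplicity (b : ZMod p) with hρ
  obtain ⟨u, hu, hu0⟩ := Polynomial.exists_eq_pow_rootMultiplicity_mul_and_not_dvd F hF (b : ZMod p)
  rw [← hρ] at hu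
  have hcop : IsCoprime u ((Polynomial.X - Polynomial.C (b : ZMod p)) ^ k) := by
    apply IsCoprime.pow_right
    have := (Polynomial.irreducible_X_sub_C (b : ZMod p)).coprime_iff_not_dvd.2 hu0
    exact this.symm
  obtain ⟨α, γ, hαγ⟩ := hcop
  obtain ⟨c, q, hq⟩ := poly_rem (b : ZMod p) ρ ((sp a h).map (Int.castRingHom (ZMod p)))
  obtain ⟨α', hα'⟩ := exists_lift p (α * q)
  obtain ⟨γ', hγ'⟩ := exists_lift p (γ * q * (Polynomial.X - Polynomial.C (b : ZMod p)) ^ ρ)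
  have hc' : ∀ r, ∃ c' : ℤ, (c' : ZMod p) = c r := fun r => ZMod.intCast_surjective _
  choose c' hc' using hc'
  have hkey : (sp a h - (∑ r ∈ Finset.range ρ,
      Polynomial.C (c' r) * (Polynomial.X - Polynomial.C b) ^ r + α' * sp a f +
      γ' * (Polynomial.X - Polynomial.C b) ^ k)).map (Int.castRingHom (ZMod p)) = 0 := by
    simp only [Polynomial.map_sub, Polynomial.map_add, Polynomial.map_mul, Polynomial.map_pow,
      Polynomial.map_X, Polynomial.map_C, Polynomial.map_sum, hα', hγ', ← hFdef, Int.coe_castRingHom, hc']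
    rw [hq]
    conv_lhs => rw [hu]
    linear_combination
      (-q * (Polynomial.X - Polynomial.C (b : ZMod p)) ^ ρ) * hαγ
  obtain ⟨Q, hQ⟩ := map_eq_zero_dvd p _ hkey
  obtain ⟨g, hg⟩ := sp_split a h
  obtain ⟨g', hg'⟩ := sp_split a f
  have hQ' := congrArg (Polynomial.aeval (X 1 : MvPolynomial (Fin 2) ℤ)) hQ
  simp only [map_sub, map_add, map_mul, map_pow, map_sum, Polynomial.aeval_X, Polynomial.aeval_C,
    algebraMap_eq] at hQ'
  refine ⟨c', Polynomial.aeval (X 1) Q, g - Polynomial.aeval (X 1) α' * g', ?_⟩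
  have : h - (∑ r ∈ Finset.range ρ, C (c' r) * (X 1 - C b) ^ r + C (p : ℤ) *
      Polynomial.aeval (X 1) Q + (X 0 - C a) * (g - Polynomial.aeval (X 1) α' * g')) =
      Polynomial.aeval (X 1) α' * f + Polynomial.aeval (X 1) γ' * (X 1 - C b) ^ k := by
    linear_combination hQ' + hg - Polynomial.aeval (X 1) α' * hg'
  rw [this]
  exact I.add_mem (I.mul_mem_left _ hfI) (I.mul_mem_left _ hβ)

theorem local_decomp (p k : ℕ) [Fact p.Prime] (f : MvPolynomial (Fin 2) ℤ) (a b : ℤ)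
    (S : Set (Fin 2 → ℤ)) (hS : ∀ x ∈ S, eval x f = 0 ∧ (p : ℤ) ∣ x 0 - a ∧ (p : ℤ) ∣ x 1 - b)
    (hF : (sp a f).map (Int.castRingHom (ZMod p)) ≠ 0) (h : MvPolynomial (Fin 2) ℤ) :
    ∃ c : ℕ → ℕ → ℤ, ∀ x ∈ S, (p : ℤ) ^ k ∣ eval x h - ∑ e ∈ Finset.range k, ∑ r ∈ Finset.range
      (((sp a f).map (Int.castRingHom (ZMod p))).rootMultiplicity (b : ZMod p)),
        c e r * ((x 0 - a) ^ e * (x 1 - b) ^ r) := by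
  set ρ := ((sp a f).map (Int.castRingHom (ZMod p))).rootMultiplicity (b : ZMod p) with hρ
  let I : Ideal (MvPolynomial (Fin 2) ℤ) :=
    { carrier := {h | ∀ x ∈ S, (p : ℤ) ^ k ∣ eval x h}
      add_mem' := by
        intro g h hg hh x hx
        rw [map_add]; exact dvd_add (hg x hx) (hh x hx)
      zero_mem' := by intro x _; simp
      smul_mem' := by
        intro g h hh x hx
        rw [smul_eq_mul, map_mul]; exact (hh x hx).mul_left _ }
  have hI : ∀ h, h ∈ I ↔ ∀ x ∈ S, (p : ℤ) ^ k ∣ eval x h := fun _ => Iff.rfl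
  have key : ∀ n i e, k ≤ e + i + n → ∀ h : MvPolynomial (Fin 2) ℤ, ∃ c : ℕ → ℕ → ℤ,
      C (p : ℤ) ^ i * (X 0 - C a) ^ e * h - ∑ e ∈ Finset.range k, ∑ r ∈ Finset.range ρ,
        C (c e r) * ((X 0 - C a) ^ e * (X 1 - C b) ^ r) ∈ I := by
    intro n
    have base : ∀ i e, k ≤ e + i → ∀ h : MvPolynomial (Fin 2) ℤ, ∃ c : ℕ → ℕ → ℤ,
      C (p : ℤ) ^ i * (X 0 - C a) ^ e * h - ∑ e ∈ Finset.range k, ∑ r ∈ Finset.range ρ,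
        C (c e r) * ((X 0 - C a) ^ e * (X 1 - C b) ^ r) ∈ I := by
      intro i e hie h
      refine ⟨0, ?_⟩
      rw [hI]
      intro x hx
      simp only [Pi.zero_apply, map_zero, zero_mul, Finset.sum_const_zero, sub_zero, map_mul,
        map_pow, eval_C, map_sub, eval_X]
      apply Dvd.dvd.mul_right
      refine (pow_dvd_pow _ (show k ≤ i + e by omega)).trans ?_
      rw [pow_add]
      exact mul_dvd_mul_left _ (pow_dvd_pow_of_dvd (hS x hx).2.1 _)
    induction n with
    | zero => intro i e hie h; exact base i e (by omega) h
    | succ n ih =>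
      intro i e hie h
      by_cases hk : k ≤ e + i
      · exact base i e hk h
      obtain ⟨c, h1, h2, hc⟩ := local_step p k f a b I
        ((hI _).2 fun x hx => by rw [(hS x hx).1]; exact dvd_zero _)
        ((hI _).2 fun x hx => by
          simp only [map_pow, map_sub, eval_X, eval_C]
          exact pow_dvd_pow_of_dvd (hS x hx).2.2 _) hF h
      rw [← hρ] at hc
      obtain ⟨c1, hc1⟩ := ih (i + 1) e (by omega) h1
      obtain ⟨c2, hc2⟩ := ih i (e + 1) (by omega) h2
      refine ⟨fun e' r => c1 e' r + c2 e' r + if e' = e then (p : ℤ) ^ i * c r else 0, ?_⟩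
      have h3 : ∑ e' ∈ Finset.range k, ∑ r ∈ Finset.range ρ,
          C (c1 e' r + c2 e' r + if e' = e then (p : ℤ) ^ i * c r else 0) *
            ((X 0 - C a) ^ e' * (X 1 - C b) ^ r) =
          (∑ e' ∈ Finset.range k, ∑ r ∈ Finset.range ρ,
          C (c1 e' r) * ((X 0 - C a) ^ e' * (X 1 - C b) ^ r)) +
          (∑ e' ∈ Finset.range k, ∑ r ∈ Finset.range ρ,
          C (c2 e' r) * ((X 0 - C a) ^ e' * (X 1 - C b) ^ r)) +
          C (p : ℤ) ^ i * (X 0 - C a) ^ e * ∑ r ∈ Finset.range ρ,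
            C (c r) * (X 1 - C b : MvPolynomial (Fin 2) ℤ) ^ r := by
        simp only [map_add, add_mul, Finset.sum_add_distrib]
        congr 1
        rw [Finset.sum_eq_single e]
        · simp only [if_true, map_mul, map_pow, Finset.mul_sum]
          refine Finset.sum_congr rfl fun r _ => ?_
          ring
        · intro e' _ he'
          simp [he']
        · intro he; simp at he; omega
      simp only [h3]
      have h4 := I.add_mem (I.add_mem hc1 hc2)
        (I.mul_mem_left (C (p : ℤ) ^ i * (X 0 - C a) ^ e) hc)
      convert h4 using 1
      ring
  obtain ⟨c, hc⟩ := key k 0 0 (by omega) h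
  refine ⟨c, fun x hx => ?_⟩
  have := (hI _).1 hc x hx
  simpa [map_sum] using this

/-- The main divisibility statement. -/
theorem det_div (p k : ℕ) [Fact p.Prime] (f : MvPolynomial (Fin 2) ℤ)
    (ρ : (Fin 2 → ZMod p) → ℕ)
    (hρ : ∀ q : Fin 2 → ZMod p, ρ q = (sp (q 0)
      (f.map (Int.castRingHom (ZMod p)))).rootMultiplicity (q 1))
    (hF : ∀ a : ZMod p, sp a (f.map (Int.castRingHom (ZMod p))) ≠ 0)
    {J : Type*} [Fintype J] [DecidableEq J] (P : J → Fin 2 → ℤ) (hP : ∀ j, eval (P j) f = 0)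
    (g : J → MvPolynomial (Fin 2) ℤ) :
    (p : ℤ) ^ (k * Fintype.card J - (∑ q, ρ q) * ∑ e ∈ Finset.range k, (k - e)) ∣
      (Matrix.of fun i j => eval (P j) (g i)).det := by
  classical
  have hspm : ∀ a : ℤ, (sp a f).map (Int.castRingHom (ZMod p)) =
      sp (a : ZMod p) (f.map (Int.castRingHom (ZMod p))) := by
    intro a
    have : ((Polynomial.mapRingHom (Int.castRingHom (ZMod p))).comp (sp a).toRingHom) =
        (sp (a : ZMod p)).toRingHom.comp (MvPolynomial.map (Int.castRingHom (ZMod p))) := by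
      apply MvPolynomial.ringHom_ext
      · intro r; simp [sp]
      · intro i; fin_cases i <;> simp [sp]
    exact congrArg (fun φ => φ f) this
  let red : J → Fin 2 → ZMod p := fun j i => (P j i : ZMod p)
  have hl : ∀ y : ZMod p, ∃ a : ℤ, (a : ZMod p) = y := fun y => ZMod.intCast_surjective y
  choose lift hlift using hl
  have hdec : ∀ (i : J) (q : Fin 2 → ZMod p), ∃ c : ℕ → ℕ → ℤ, ∀ j, red j = q →
      (p : ℤ) ^ k ∣ eval (P j) (g i) - ∑ e ∈ Finset.range k, ∑ r ∈ Finset.range (ρ q),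
        c e r * ((P j 0 - lift (q 0)) ^ e * (P j 1 - lift (q 1)) ^ r) := by
    intro i q
    obtain ⟨c, hc⟩ := local_decomp p k f (lift (q 0)) (lift (q 1)) {x | ∃ j, red j = q ∧ P j = x} (by
      rintro x ⟨j, hj, rfl⟩
      refine ⟨hP j, ?_, ?_⟩
      · rw [← ZMod.intCast_zmod_eq_zero_iff_dvd]
        push_cast
        rw [hlift, ← hj]; simp [red]
      · rw [← ZMod.intCast_zmod_eq_zero_iff_dvd]
        push_cast
        rw [hlift, ← hj]; simp [red]) (by rw [hspm]; exact hF _) (g i)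
    rw [hspm, hlift, hlift, ← hρ] at hc
    exact ⟨c, fun j hj => hc _ ⟨j, hj, rfl⟩⟩
  choose c hc using hdec
  choose z hz using fun i j => hc i (red j) j rfl
  have := det_dvd p k (ι := (Σ q : Fin 2 → ZMod p, Fin k × Fin (ρ q)))
    (fun a j => if red j = a.1 then
      (P j 0 - lift (a.1 0)) ^ a.2.1.1 * (P j 1 - lift (a.1 1)) ^ a.2.2.1 else 0)
    (fun a => a.2.1.1) (by
      intro a j
      split_ifs with h
      · apply Dvd.dvd.mul_right
        apply pow_dvd_pow_of_dvd
        rw [← ZMod.intCast_zmod_eq_zero_iff_dvd]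
        push_cast
        rw [hlift, ← h]; simp [red]
      · exact dvd_zero _) (Matrix.of fun i j => eval (P j) (g i))
    (fun i a => c i a.1 a.2.1 a.2.2) z (by
      intro i j
      rw [Matrix.of_apply]
      have h1 := hz i j
      rw [sub_eq_iff_eq_add] at h1
      rw [h1, add_comm]
      congr 1
      rw [Fintype.sum_sigma, Finset.sum_eq_single (red j)]
      · simp only [if_true]
        rw [Fintype.sum_prod_type, Finset.sum_range]
        refine Finset.sum_congr rfl fun e _ => ?_
        rw [Finset.sum_range]
      · intro q _ hq
        simp [Ne.symm hq]
      · simp)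
  have hs : ∑ a : (Σ q : Fin 2 → ZMod p, Fin k × Fin (ρ q)), (k - a.2.1.1) =
      (∑ q, ρ q) * ∑ e ∈ Finset.range k, (k - e) := by
    rw [Fintype.sum_sigma, Finset.sum_mul]
    refine Finset.sum_congr rfl fun q _ => ?_
    rw [Fintype.sum_prod_type, Finset.sum_range, Finset.mul_sum]
    refine Finset.sum_congr rfl fun e _ => ?_
    simp
  rwa [hs] at this

end NPC



namespace NPC

/-- primes up to `n` -/
def Pr (n : ℕ) : Finset ℕ := (Finset.range (n + 1)).filter Nat.Prime

theorem mem_Pr {n p : ℕ} : p ∈ Pr n ↔ p ≤ n ∧ p.Prime := by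
  simp [Pr]

theorem theta_le (n : ℕ) : ∑ p ∈ Pr n, Real.log p ≤ Real.log 4 * n := by
  have h := Chebyshev.theta_le_log4_mul_x (x := (n : ℝ)) (by positivity)
  rw [Chebyshev.theta_eq_sum_Icc, Nat.floor_natCast] at h
  convert h using 2
  ext p
  simp [mem_Pr]

theorem log_fact (n : ℕ) : Real.log (n.factorial : ℝ) =
    ∑ p ∈ Pr n, (n.factorial.factorization p : ℝ) * Real.log p := by
  rw [Real.log_nat_eq_sum_factorization, Finsupp.sum_of_support_subset (s := Pr n)]
  · intro p hp
    rw [Nat.support_factorization, Nat.mem_primeFactors] at hp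
    rw [mem_Pr]
    exact ⟨(hp.1.dvd_factorial).1 hp.2.1, hp.1⟩
  · simp

theorem mertens_upper {n : ℕ} (hn : 1 ≤ n) :
    ∑ p ∈ Pr n, Real.log p / p ≤ Real.log n + Real.log 4 := by
  have hn0 : (0 : ℝ) < n := by exact_mod_cast hn
  have h1 : Real.log (n.factorial : ℝ) ≤ n * Real.log n := by
    rw [← Real.log_pow]
    apply Real.log_le_log (by positivity)
    exact_mod_cast Nat.factorial_le_pow n
  have h2 : ∑ p ∈ Pr n, ((n : ℝ) / p - 1) * Real.log p ≤ Real.log (n.factorial : ℝ) := by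
    rw [log_fact]
    refine Finset.sum_le_sum fun p hp => ?_
    rw [mem_Pr] at hp
    have hp1 : (1 : ℝ) ≤ p := by exact_mod_cast hp.2.one_lt.le
    refine mul_le_mul_of_nonneg_right ?_ (Real.log_nonneg hp1)
    have h3 : n / p ≤ n.factorial.factorization p := by
      rw [Nat.factorization_factorial hp.2 (Nat.lt_succ_self _)]
      refine le_trans ?_ (Finset.single_le_sum (f := fun i => n / p ^ i) (a := 1)
        (fun _ _ => Nat.zero_le _) ?_)
      · simp
      · rw [Finset.mem_Ico]
        refine ⟨le_refl _, ?_⟩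
        have := Nat.log_pos hp.2.one_lt hp.1
        omega
    have h4 : (n : ℝ) / p < (n / p : ℕ) + 1 := by
      rw [div_lt_iff₀ (by linarith)]
      have := Nat.lt_div_mul_add (a := n) hp.2.pos
      have h5 : n < (n / p + 1) * p := by rw [add_mul, one_mul]; exact this
      exact_mod_cast h5
    have h6 : ((n / p : ℕ) : ℝ) ≤ n.factorial.factorization p := by exact_mod_cast h3
    linarith
  have h7 : ∑ p ∈ Pr n, ((n : ℝ) / p - 1) * Real.log p =
      n * ∑ p ∈ Pr n, Real.log p / p - ∑ p ∈ Pr n, Real.log p := by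
    rw [Finset.mul_sum, ← Finset.sum_sub_distrib]
    refine Finset.sum_congr rfl fun p _ => ?_
    ring
  have h8 := theta_le n
  have : n * ∑ p ∈ Pr n, Real.log p / p ≤ n * (Real.log n + Real.log 4) := by
    rw [mul_add]; linarith
  exact le_of_mul_le_mul_left this hn0

theorem mertens_lower : ∃ C : ℝ, ∀ n : ℕ, 1 ≤ n →
    Real.log n - C ≤ ∑ p ∈ Pr n, Real.log p / p := by
  have hs : Summable fun n : ℕ => 4 * (1 / (n : ℝ) ^ (3 / 2 : ℝ)) :=
    (Real.summable_one_div_nat_rpow.2 (by norm_num)).mul_left _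
  refine ⟨1 + ∑' n : ℕ, 4 * (1 / (n : ℝ) ^ (3 / 2 : ℝ)), fun n hn => ?_⟩
  have hn0 : (0 : ℝ) < n := by exact_mod_cast hn
  have h1 : n * Real.log n - n ≤ Real.log (n.factorial : ℝ) := by
    have := Real.pow_div_factorial_le_exp (n : ℝ) hn0.le n
    have hl := Real.log_le_log (by positivity) this
    rw [Real.log_exp, Real.log_div (by positivity) (by positivity), Real.log_pow] at hl
    linarith
  have h2 : Real.log (n.factorial : ℝ) ≤ ∑ p ∈ Pr n, ((n : ℝ) * (Real.log p / p) +
      n * (4 * (1 / (p : ℝ) ^ (3 / 2 : ℝ)))) := by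
    rw [log_fact]
    refine Finset.sum_le_sum fun p hp => ?_
    rw [mem_Pr] at hp
    have hp2 : (2 : ℝ) ≤ p := by exact_mod_cast hp.2.two_le
    have hlp : 0 ≤ Real.log p := Real.log_nonneg (by linarith)
    have h3 : (n.factorial.factorization p : ℝ) ≤ n / (p - 1) := by
      rw [le_div_iff₀ (by linarith)]
      have := Fact.mk hp.2
      have h4 := sub_one_mul_padicValNat_factorial (p := p) n
      have h5 : (p - 1) * padicValNat p n.factorial ≤ n := by omega
      rw [Nat.factorization_def _ hp.2]
      have h6 : (((p - 1) * padicValNat p n.factorial : ℕ) : ℝ) ≤ n := by exact_mod_cast h5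
      rw [Nat.cast_mul, Nat.cast_sub hp.2.one_lt.le, Nat.cast_one] at h6
      linarith
    refine (mul_le_mul_of_nonneg_right h3 hlp).trans ?_
    rw [← mul_add, div_mul_eq_mul_div, mul_div_assoc]
    refine mul_le_mul_of_nonneg_left ?_ hn0.le
    have hr : (p : ℝ) ^ (3 / 2 : ℝ) = p * Real.sqrt p := by
      rw [show (3 / 2 : ℝ) = 1 + 1 / 2 by norm_num, Real.rpow_add (by linarith), Real.rpow_one,
        Real.sqrt_eq_rpow]
    rw [hr]
    set t := Real.sqrt p with ht
    have htt : t * t = p := Real.mul_self_sqrt (by linarith)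
    have ht1 : 1 ≤ t := by rw [ht]; exact Real.one_le_sqrt.2 (by linarith)
    have hlog : Real.log p ≤ 2 * t := by
      rw [← htt, Real.log_mul (by linarith) (by linarith)]
      have := Real.log_le_sub_one_of_pos (show 0 < t by linarith)
      linarith
    have e1 : Real.log p / (p - 1) = Real.log p / p + Real.log p / (p * (p - 1)) := by
      have : (p : ℝ) - 1 ≠ 0 := by linarith
      have : (p : ℝ) ≠ 0 := by linarith
      field_simp
      ring
    rw [e1]
    have e2 : Real.log p / (p * (p - 1)) ≤ 4 * (1 / (p * t)) := by
      rw [mul_one_div, div_le_div_iff₀ (by nlinarith) (by nlinarith)]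
      have : Real.log p * t ≤ 4 * (p - 1) := by nlinarith
      nlinarith
    linarith
  rw [Finset.sum_add_distrib, ← Finset.mul_sum, ← Finset.mul_sum] at h2
  have h9 : ∑ p ∈ Pr n, 4 * (1 / (p : ℝ) ^ (3 / 2 : ℝ)) ≤ ∑' n : ℕ, 4 * (1 / (n : ℝ) ^ (3 / 2 : ℝ)) :=
    hs.sum_le_tsum _ (fun i _ => by positivity)
  have : n * (Real.log n - (1 + ∑' n : ℕ, 4 * (1 / (n : ℝ) ^ (3 / 2 : ℝ)))) ≤
      n * ∑ p ∈ Pr n, Real.log p / p := by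
    have h10 := mul_le_mul_of_nonneg_left h9 hn0.le
    nlinarith
  exact le_of_mul_le_mul_left this hn0

theorem sum_dvd_le {c : ℕ} (hc : c ≠ 0) (S : Finset ℕ) (hS : ∀ p ∈ S, p.Prime ∧ p ∣ c) :
    ∑ p ∈ S, Real.log p / p ≤ Real.log (1 + Real.log c) + Real.log 4 + 1 := by
  have hc1 : (1 : ℝ) ≤ c := by exact_mod_cast Nat.one_le_iff_ne_zero.2 hc
  have hlc : 0 ≤ Real.log c := Real.log_nonneg hc1
  set y := ⌊1 + Real.log c⌋₊ with hy
  have hy1 : 1 ≤ y := by rw [hy, Nat.one_le_floor_iff]; linarith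
  have hyl : (y : ℝ) ≤ 1 + Real.log c := Nat.floor_le (by linarith)
  rw [← Finset.sum_filter_add_sum_filter_not S (fun p => p ≤ y)]
  have hnn : ∀ p : ℕ, 0 ≤ Real.log p / p := fun p =>
    div_nonneg (Real.log_natCast_nonneg p) (by positivity)
  have h1 : ∑ p ∈ S with p ≤ y, Real.log p / p ≤ Real.log (1 + Real.log c) + Real.log 4 := by
    refine (Finset.sum_le_sum_of_subset_of_nonneg (t := Pr y) ?_ fun p _ _ => hnn p).trans ?_
    · intro p hp
      rw [Finset.mem_filter] at hp
      rw [mem_Pr]; exact ⟨hp.2, (hS p hp.1).1⟩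
    · refine (mertens_upper hy1).trans ?_
      have : Real.log y ≤ Real.log (1 + Real.log c) :=
        Real.log_le_log (by exact_mod_cast hy1) hyl
      linarith
  have h2 : ∑ p ∈ S with ¬ p ≤ y, Real.log p / p ≤ 1 := by
    have h3 : ∑ p ∈ S with ¬ p ≤ y, Real.log p / p ≤
        ∑ p ∈ S with ¬ p ≤ y, Real.log p / (1 + Real.log c) := by
      refine Finset.sum_le_sum fun p hp => ?_
      rw [Finset.mem_filter] at hp
      have : 1 + Real.log c < p := Nat.lt_of_floor_lt (not_le.1 hp.2)
      exact div_le_div_of_nonneg_left (Real.log_natCast_nonneg p) (by linarith) this.le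
    refine h3.trans ?_
    rw [← Finset.sum_div, div_le_one (by linarith)]
    have h4 : ∑ p ∈ S with ¬ p ≤ y, Real.log p = Real.log ((∏ p ∈ S with ¬ p ≤ y, p : ℕ) : ℝ) := by
      rw [Nat.cast_prod, Real.log_prod]
      intro p hp
      rw [Finset.mem_filter] at hp
      exact_mod_cast (hS p hp.1).1.ne_zero
    rw [h4]
    have h5 : (∏ p ∈ S with ¬ p ≤ y, p) ∣ c := by
      apply Finset.prod_primes_dvd
      · intro p hp; exact (hS p (Finset.mem_filter.1 hp).1).1.prime
      · intro p hp; exact (hS p (Finset.mem_filter.1 hp).1).2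
    have h6 := Nat.le_of_dvd (Nat.pos_of_ne_zero hc) h5
    have h7 : Real.log ((∏ p ∈ S with ¬ p ≤ y, p : ℕ) : ℝ) ≤ Real.log c := by
      apply Real.log_le_log
      · have : 0 < ∏ p ∈ S with ¬ p ≤ y, p := Nat.pos_of_dvd_of_pos h5 (Nat.pos_of_ne_zero hc)
        exact_mod_cast this
      · exact_mod_cast h6
    linarith
  linarith

theorem tail_aux {P0 : ℕ} (h0 : 1 ≤ P0) (N : ℕ) (hN : P0 ≤ N) :
    ∑ p ∈ (Finset.Ico P0 N).filter Nat.Prime, Real.log p / (p * Real.sqrt p) ≤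
      3 * Real.log 4 * (1 / Real.sqrt P0 - 1 / Real.sqrt N) +
      (∑ p ∈ (Finset.Ico P0 N).filter Nat.Prime, Real.log p) / (N * Real.sqrt N) := by
  induction N, hN using Nat.le_induction with
  | base => simp
  | succ N hN ih =>
    have hN0 : (0 : ℝ) < N := by exact_mod_cast (by omega : 0 < N)
    set l : ℝ := if N.Prime then Real.log N else 0 with hl
    have e : ∀ g : ℕ → ℝ, ∑ p ∈ (Finset.Ico P0 (N + 1)).filter Nat.Prime, g p =
        ∑ p ∈ (Finset.Ico P0 N).filter Nat.Prime, g p + if N.Prime then g N else 0 := by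
      intro g
      rw [Finset.sum_filter, Finset.sum_filter, Finset.sum_Ico_succ_top hN]
    have hth : ∑ p ∈ (Finset.Ico P0 (N + 1)).filter Nat.Prime, Real.log p ≤ Real.log 4 * N := by
      refine le_trans ?_ (theta_le N)
      refine Finset.sum_le_sum_of_subset_of_nonneg ?_ fun p _ _ => Real.log_natCast_nonneg p
      intro p hp
      simp only [Finset.mem_filter, Finset.mem_Ico] at hp
      rw [mem_Pr]; exact ⟨by omega, hp.2⟩
    rw [e (fun p => Real.log p / (p * Real.sqrt p))]
    set th := ∑ p ∈ (Finset.Ico P0 (N + 1)).filter Nat.Prime, Real.log p with hthd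
    have hth2 : ∑ p ∈ (Finset.Ico P0 N).filter Nat.Prime, Real.log p = th - l := by
      rw [hthd, e]; ring
    rw [hth2] at ih
    have hl2 : (if N.Prime then Real.log N / (N * Real.sqrt N) else 0) = l / (N * Real.sqrt N) := by
      rw [hl]; split_ifs <;> simp
    rw [hl2]
    have hlog4 : 0 < Real.log 4 := Real.log_pos (by norm_num)
    push_cast
    set a := Real.sqrt N with ha
    set b := Real.sqrt (N + 1) with hb
    have ha0 : 0 < a := Real.sqrt_pos.2 hN0
    have hab : a ≤ b := Real.sqrt_le_sqrt (by linarith)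
    have hb0 : 0 < b := by linarith
    have haa : (N : ℝ) = a * a := (Real.mul_self_sqrt hN0.le).symm
    have hbb : (N : ℝ) + 1 = b * b := (Real.mul_self_sqrt (by linarith)).symm
    have key : (N : ℝ) * (1 / (N * a) - 1 / ((N + 1) * b)) ≤ 3 * (1 / a - 1 / b) := by
      rw [hbb, haa]
      have e1 : a * a * (1 / (a * a * a) - 1 / (b * b * b)) =
          (b - a) * (a * a + a * b + b * b) / (a * b * b * b) := by
        field_simp; ring
      have e2 : 3 * (1 / a - 1 / b) = (b - a) * (3 * (b * b)) / (a * b * b * b) := by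
        field_simp
      rw [e1, e2]
      apply div_le_div_of_nonneg_right _ (by positivity)
      apply mul_le_mul_of_nonneg_left _ (by linarith)
      nlinarith
    have hdiff : 0 ≤ 1 / (N * a) - 1 / ((N + 1) * b) := by
      rw [sub_nonneg]
      apply one_div_le_one_div_of_le (by positivity)
      gcongr; linarith
    have k2 : th * (1 / (N * a) - 1 / ((N + 1) * b)) ≤ Real.log 4 * (3 * (1 / a - 1 / b)) := by
      refine (mul_le_mul_of_nonneg_right hth hdiff).trans ?_
      rw [mul_assoc]
      exact mul_le_mul_of_nonneg_left key hlog4.le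
    have e3 : (th - l) / (N * a) = th * (1 / (N * a)) - l / (N * a) := by ring
    have e4 : th / ((N + 1) * b) = th * (1 / ((N + 1) * b)) := by ring
    rw [e3] at ih
    rw [e4]
    nlinarith

theorem tail_le {P0 : ℕ} (h0 : 1 ≤ P0) (S : Finset ℕ) (hS : ∀ p ∈ S, p.Prime ∧ P0 ≤ p) :
    ∑ p ∈ S, Real.log p / (p * Real.sqrt p) ≤ 3 * Real.log 4 / Real.sqrt P0 := by
  set N := S.sup id + P0 + 1 with hN
  have h1 := tail_aux h0 N (by omega)
  have hlog4 : 0 < Real.log 4 := Real.log_pos (by norm_num)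
  have h2 : ∑ p ∈ S, Real.log p / (p * Real.sqrt p) ≤
      ∑ p ∈ (Finset.Ico P0 N).filter Nat.Prime, Real.log p / (p * Real.sqrt p) := by
    refine Finset.sum_le_sum_of_subset_of_nonneg ?_ fun p _ _ =>
      div_nonneg (Real.log_natCast_nonneg p) (by positivity)
    intro p hp
    have : p ≤ S.sup id := Finset.le_sup (f := id) hp
    simp only [Finset.mem_filter, Finset.mem_Ico]
    exact ⟨⟨(hS p hp).2, by omega⟩, (hS p hp).1⟩
  have hN0 : (0 : ℝ) < N := by exact_mod_cast (by omega : 0 < N)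
  have hth : ∑ p ∈ (Finset.Ico P0 N).filter Nat.Prime, Real.log p ≤ Real.log 4 * N := by
    refine le_trans ?_ (theta_le N)
    refine Finset.sum_le_sum_of_subset_of_nonneg ?_ fun p _ _ => Real.log_natCast_nonneg p
    intro p hp
    simp only [Finset.mem_filter, Finset.mem_Ico] at hp
    rw [mem_Pr]; exact ⟨by omega, hp.2⟩
  have h3 : (∑ p ∈ (Finset.Ico P0 N).filter Nat.Prime, Real.log p) / (N * Real.sqrt N) ≤
      Real.log 4 * (1 / Real.sqrt N) := by
    have hs : 0 < Real.sqrt N := Real.sqrt_pos.2 hN0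
    rw [div_le_iff₀ (by positivity)]
    refine hth.trans (le_of_eq ?_)
    field_simp
  have h4 : 0 < 1 / Real.sqrt N := by
    have hs : 0 < Real.sqrt N := Real.sqrt_pos.2 hN0
    positivity
  have e : 3 * Real.log 4 / Real.sqrt P0 = 3 * Real.log 4 * (1 / Real.sqrt P0) := by ring
  rw [e]
  nlinarith

end NPC



namespace NPC

/-- The primes used. -/
def Sp (d c s : ℕ) : Finset ℕ := (Pr s).filter (fun p => 100 * d ^ 4 ≤ p ∧ ¬ p ∣ c)

theorem analytic : ∃ C : ℝ, ∀ d s c : ℕ, 1 ≤ d → 1 ≤ s → c ≠ 0 →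
    (s : ℝ) ^ 2 / 2 * (Real.log s - Real.log (d ^ 4) - Real.log (1 + Real.log c) - C) ≤
    ∑ p ∈ Sp d c s, Real.log p * ((s : ℝ) ^ 2 / (2 * (p + 7 * d ^ 2 * Real.sqrt p)) - s / 2) := by
  obtain ⟨C0, hC0⟩ := mertens_lower
  refine ⟨C0 + Real.log 100 + 3 * Real.log 4 + 1 + 7 * (3 * Real.log 4 / 10), ?_⟩
  intro d s c hd hs hc
  have hd1 : (1 : ℝ) ≤ d := by exact_mod_cast hd
  have hs1 : (1 : ℝ) ≤ s := by exact_mod_cast hs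
  set P0 := 100 * d ^ 4 with hP0
  have hP01 : 1 ≤ P0 := by have := Nat.one_le_pow 4 d hd; omega
  have hnn : ∀ p : ℕ, 0 ≤ Real.log p / p := fun p =>
    div_nonneg (Real.log_natCast_nonneg p) (by positivity)
  -- main sum
  have h1 : ∑ p ∈ Pr s, Real.log p / p ≤ ∑ p ∈ Sp d c s, Real.log p / p +
      ∑ p ∈ Pr P0, Real.log p / p + ∑ p ∈ (Pr s).filter (· ∣ c), Real.log p / p := by
    have hsub : Pr s ⊆ (Sp d c s ∪ Pr P0) ∪ (Pr s).filter (· ∣ c) := by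
      intro p hp
      rw [Finset.mem_union, Finset.mem_union, Sp, Finset.mem_filter, Finset.mem_filter, mem_Pr,
        mem_Pr]
      rw [mem_Pr] at hp
      by_cases h : p ∣ c
      · tauto
      · by_cases h2 : 100 * d ^ 4 ≤ p
        · tauto
        · left; right; exact ⟨by omega, hp.2⟩
    refine (Finset.sum_le_sum_of_subset_of_nonneg hsub fun p _ _ => hnn p).trans ?_
    have u1 := Finset.sum_union_inter (s₁ := Sp d c s ∪ Pr P0) (s₂ := (Pr s).filter (· ∣ c))
      (f := fun p : ℕ => Real.log p / (p : ℝ))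
    have u2 := Finset.sum_union_inter (s₁ := Sp d c s) (s₂ := Pr P0)
      (f := fun p : ℕ => Real.log p / (p : ℝ))
    have v1 : 0 ≤ ∑ p ∈ (Sp d c s ∪ Pr P0) ∩ (Pr s).filter (· ∣ c), Real.log p / p :=
      Finset.sum_nonneg fun p _ => hnn p
    have v2 : 0 ≤ ∑ p ∈ Sp d c s ∩ Pr P0, Real.log p / p :=
      Finset.sum_nonneg fun p _ => hnn p
    linarith
  have h2 := hC0 s hs
  have h3 := mertens_upper hP01
  have h4 := sum_dvd_le hc ((Pr s).filter (· ∣ c)) (by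
    intro p hp
    rw [Finset.mem_filter, mem_Pr] at hp
    exact ⟨hp.1.2, hp.2⟩)
  have h5 := tail_le hP01 (Sp d c s) (by
    intro p hp
    rw [Sp, Finset.mem_filter, mem_Pr] at hp
    exact ⟨hp.1.2, hp.2.1⟩)
  have h6 : ∑ p ∈ Sp d c s, Real.log p ≤ Real.log 4 * s := by
    refine le_trans ?_ (theta_le s)
    exact Finset.sum_le_sum_of_subset_of_nonneg (Finset.filter_subset _ _)
      fun p _ _ => Real.log_natCast_nonneg p
  have hsq : Real.sqrt P0 = 10 * (d : ℝ) ^ 2 := by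
    rw [hP0]
    push_cast
    rw [show (100 : ℝ) * (d : ℝ) ^ 4 = (10 * (d : ℝ) ^ 2) ^ 2 by ring]
    exact Real.sqrt_sq (by positivity)
  have hlP : Real.log P0 = Real.log 100 + Real.log ((d : ℝ) ^ 4) := by
    rw [hP0]
    push_cast
    rw [Real.log_mul (by norm_num) (by positivity)]
  rw [hlP] at h3
  have h7 : 7 * (d : ℝ) ^ 2 * ∑ p ∈ Sp d c s, Real.log p / (p * Real.sqrt p) ≤
      7 * (3 * Real.log 4 / 10) := by
    have hd2 : (0 : ℝ) < (d : ℝ) ^ 2 := by positivity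
    rw [hsq] at h5
    refine (mul_le_mul_of_nonneg_left h5 (by positivity)).trans (le_of_eq ?_)
    field_simp
  have h8 : ∀ p ∈ Sp d c s, (s : ℝ) ^ 2 / 2 * (Real.log p / p - 7 * (d : ℝ) ^ 2 *
      (Real.log p / (p * Real.sqrt p))) - s / 2 * Real.log p ≤
      Real.log p * ((s : ℝ) ^ 2 / (2 * (p + 7 * d ^ 2 * Real.sqrt p)) - s / 2) := by
    intro p hp
    rw [Sp, Finset.mem_filter, mem_Pr] at hp
    have hp0 : (0 : ℝ) < p := by exact_mod_cast hp.1.2.pos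
    have hlp : 0 ≤ Real.log p := Real.log_natCast_nonneg p
    set t := Real.sqrt p with ht
    have ht0 : 0 < t := Real.sqrt_pos.2 hp0
    have htt : (p : ℝ) = t * t := (Real.mul_self_sqrt hp0.le).symm
    set D := 7 * (d : ℝ) ^ 2 with hD
    have hD0 : 0 < D := by positivity
    have key : 1 / (p : ℝ) - D * (1 / (p * t)) ≤ 1 / (p + D * t) := by
      rw [htt]
      rw [le_div_iff₀ (by positivity)]
      have : (1 / (t * t) - D * (1 / (t * t * t))) * (t * t + D * t) = 1 - (D / t) ^ 2 := by
        field_simp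
        ring
      rw [this]
      nlinarith [sq_nonneg (D / t)]
    have k2 := mul_le_mul_of_nonneg_left key (mul_nonneg (by positivity : (0 : ℝ) ≤ (s : ℝ) ^ 2 / 2) hlp)
    have e1 : Real.log p * ((s : ℝ) ^ 2 / (2 * (p + D * t)) - s / 2) =
        (s : ℝ) ^ 2 / 2 * Real.log p * (1 / (p + D * t)) - s / 2 * Real.log p := by
      have : (p : ℝ) + D * t ≠ 0 := by positivity
      field_simp
    rw [e1]
    have e2 : (s : ℝ) ^ 2 / 2 * (Real.log p / p - D * (Real.log p / (p * t))) =
        (s : ℝ) ^ 2 / 2 * Real.log p * (1 / p - D * (1 / (p * t))) := by ring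
    rw [e2]
    linarith
  refine le_trans ?_ (Finset.sum_le_sum h8)
  rw [Finset.sum_sub_distrib, ← Finset.mul_sum, ← Finset.mul_sum, Finset.sum_sub_distrib,
    ← Finset.mul_sum]
  have h9 : (s : ℝ) / 2 * ∑ p ∈ Sp d c s, Real.log p ≤ (s : ℝ) ^ 2 / 2 * Real.log 4 := by
    refine (mul_le_mul_of_nonneg_left h6 (by positivity)).trans (le_of_eq ?_)
    ring
  have h10 : (s : ℝ) ^ 2 / 2 * (Real.log s - Real.log (d ^ 4) - Real.log (1 + Real.log c) -
      (C0 + Real.log 100 + 3 * Real.log 4 + 1 + 7 * (3 * Real.log 4 / 10)) + Real.log 4) ≤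
      (s : ℝ) ^ 2 / 2 * (∑ p ∈ Sp d c s, Real.log p / p -
        7 * (d : ℝ) ^ 2 * ∑ p ∈ Sp d c s, Real.log p / (p * Real.sqrt p)) := by
    apply mul_le_mul_of_nonneg_left _ (by positivity)
    linarith
  rw [mul_add] at h10
  linarith

/-- The final inequality juggling. -/
theorem final_ineq {s M1 d b L X C : ℝ} (hd : 1 ≤ d) (hb : 1 ≤ b) (hL : L = d * Real.log b)
    (hs : d ^ 2 * b ≤ s) (hM : M1 ≤ s + d ^ 2) (hM0 : 0 ≤ M1) (hX : 0 < X)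
    (h : s ^ 2 / 2 * (Real.log s - Real.log X - C) ≤
      s * Real.log s + L * (d * M1 + M1 ^ 2 / (2 * d))) :
    s ≤ Real.exp (C + 9) * X * b := by
  have hb0 : 0 < b := by linarith
  have hd2 : 1 ≤ d ^ 2 := one_le_pow₀ hd
  have hs1 : 1 ≤ s := by nlinarith
  have hlb0 : 0 ≤ Real.log b := Real.log_nonneg hb
  have hlb : Real.log b ≤ b := by
    have := Real.log_le_sub_one_of_pos hb0; linarith
  have hls : Real.log s ≤ s := by
    have := Real.log_le_sub_one_of_pos (by linarith : 0 < s); linarith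
  have hL0 : 0 ≤ L := by rw [hL]; positivity
  have h1 : L * (d * M1 + M1 ^ 2 / (2 * d)) ≤
      L * (d * (s + d ^ 2) + (s + d ^ 2) ^ 2 / (2 * d)) := by
    apply mul_le_mul_of_nonneg_left _ hL0
    gcongr
  have e : L * (d * (s + d ^ 2) + (s + d ^ 2) ^ 2 / (2 * d)) =
      Real.log b * (d ^ 2 * (s + d ^ 2) + (s + d ^ 2) ^ 2 / 2) := by
    rw [hL]; field_simp
  set D := d ^ 2 with hD
  have hDb : D * Real.log b ≤ s := by
    refine le_trans ?_ hs
    gcongr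
  have hDs : D ≤ s := by nlinarith
  have h2 : Real.log b * (D * (s + D) + (s + D) ^ 2 / 2) ≤ s ^ 2 / 2 * Real.log b + 7 / 2 * s ^ 2 := by
    have e2 : Real.log b * (D * (s + D) + (s + D) ^ 2 / 2) =
      s ^ 2 / 2 * Real.log b + (D * Real.log b) * (2 * s + 3 / 2 * D) := by ring
    rw [e2]
    have : (D * Real.log b) * (2 * s + 3 / 2 * D) ≤ s * (2 * s + 3 / 2 * s) := by
      gcongr
    nlinarith
  have h3 : s * Real.log s ≤ s ^ 2 := by
    rw [sq]; gcongr
  have h4 : s ^ 2 / 2 * (Real.log s - Real.log X - C) ≤ s ^ 2 / 2 * (Real.log b + 9) := by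
    rw [e] at h1
    nlinarith
  have h5 := le_of_mul_le_mul_left h4 (by positivity)
  rw [← Real.log_le_log_iff (by linarith) (by positivity), Real.log_mul (by positivity) (by positivity),
    Real.log_mul (by positivity) (by positivity), Real.log_exp]
  linarith

end NPC



namespace NPC
open MvPolynomial

theorem np_map {K : Type*} [Field K] {d d' : ℕ} {f : MvPolynomial (Fin 2) ℤ} (h0 : 0 < d')
    (h1 : d' < d) (h2 : Nat.Coprime d d')
    (hlow : ∀ m ∈ f.support, m ≠ Finsupp.single 0 d → m ≠ Finsupp.single 1 d' →
          m 0 * d' + m 1 * d < d * d')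
    (φ : ℤ →+* K) (ha : φ (f.coeff (Finsupp.single 0 d)) ≠ 0)
    (hb : φ (f.coeff (Finsupp.single 1 d')) ≠ 0) : NP d d' (f.map φ) where
  pos := h0
  lt := h1
  cop := h2
  ha := by rwa [coeff_map]
  hb := by rwa [coeff_map]
  low := by
    intro m hm hm0 hm1
    rw [coeff_map] at hm
    refine hlow m ?_ hm0 hm1
    rw [mem_support_iff]
    intro h
    rw [h, map_zero] at hm
    exact hm rfl

section
variable {K : Type*} [Field K] {d d' : ℕ} {f : MvPolynomial (Fin 2) K}

theorem sp_monomial (a : K) (m : Fin 2 →₀ ℕ) (c : K) :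
    sp a (monomial m c) = Polynomial.C (c * a ^ m 0) * Polynomial.X ^ m 1 := by
  rw [sp, aeval_monomial, Finsupp.prod_fintype _ _ (by simp)]
  simp [mul_assoc]

theorem sp_eval (a b : K) (P : MvPolynomial (Fin 2) K) :
    (sp a P).eval b = eval ![a, b] P := by
  have : ((Polynomial.evalRingHom b).comp (sp a).toRingHom) = eval ![a, b] := by
    apply MvPolynomial.ringHom_ext
    · intro r; simp [sp]
    · intro i; fin_cases i <;> simp [sp]
  exact congrArg (fun φ => φ P) this

theorem sp_deriv (a : K) (P : MvPolynomial (Fin 2) K) :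
    Polynomial.derivative (sp a P) = sp a (pderiv 1 P) := by
  induction P using MvPolynomial.induction_on' with
  | monomial m c =>
    rw [pderiv_monomial, sp_monomial, sp_monomial, Polynomial.derivative_C_mul_X_pow]
    simp
    ring
  | add P Q hP hQ => simp [hP, hQ]

theorem sp_shape (hf : NP d d' f) (a : K) : sp a f ≠ 0 ∧ (sp a f).natDegree ≤ d' := by
  set b := coeff (Finsupp.single 1 d') f with hb
  have h1 : (sp a (f - monomial (Finsupp.single 1 d') b)).degree < (d' : WithBot ℕ) := by
    rw [MvPolynomial.as_sum (f - monomial (Finsupp.single 1 d') b), map_sum]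
    rw [← Polynomial.mem_degreeLT]
    refine Submodule.sum_mem _ fun m hm => ?_
    rw [Polynomial.mem_degreeLT, sp_monomial]
    refine (Polynomial.degree_C_mul_X_pow_le _ _).trans_lt ?_
    rw [mem_support_iff] at hm
    have hne : Finsupp.single 1 d' ≠ m := by
      rintro rfl; apply hm; simp [hb]
    have hlt : m 1 < d' := by
      by_cases h0 : m = Finsupp.single 0 d
      · rw [h0]; simp [hf.pos]
      · have := hf.low m (by simpa [coeff_monomial, hne] using hm) h0 (Ne.symm hne)
        simp only [wt] at this
        by_contra hcon
        push Not at hcon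
        have h3 : d' * d ≤ m 1 * d := Nat.mul_le_mul_right _ hcon
        rw [mul_comm d' d] at h3
        omega
    exact_mod_cast hlt
  have h2 : sp a f = sp a (f - monomial (Finsupp.single 1 d') b) +
      Polynomial.C b * Polynomial.X ^ d' := by
    have := sp_monomial a (Finsupp.single 1 d') b
    simp at this
    rw [← this, ← map_add]; congr 1; ring
  constructor
  · intro h
    have h3 := congrArg (fun P => Polynomial.coeff P d') h2
    simp only [h, Polynomial.coeff_add, Polynomial.coeff_zero,
      Polynomial.coeff_eq_zero_of_degree_lt h1, Polynomial.coeff_C_mul, Polynomial.coeff_X_pow,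
      if_true] at h3
    apply hf.hb
    rw [← hb]; simpa using h3.symm
  · rw [h2]
    refine Polynomial.natDegree_add_le_of_degree_le ?_ (Polynomial.natDegree_C_mul_X_pow_le _ _)
    exact Polynomial.natDegree_le_of_degree_le h1.le

/-- The local multiplicity. -/
noncomputable def rho (f : MvPolynomial (Fin 2) K) (q : Fin 2 → K) : ℕ :=
  (sp (q 0) f).rootMultiplicity (q 1)

theorem vec_eta (q : Fin 2 → K) : ![q 0, q 1] = q := by
  ext i; fin_cases i <;> rfl

theorem rho_zero (q : Fin 2 → K) (h : eval q f ≠ 0) : rho f q = 0 := by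
  apply Polynomial.rootMultiplicity_eq_zero
  rwa [Polynomial.IsRoot, sp_eval, vec_eta]

theorem rho_one (hf : NP d d' f) (q : Fin 2 → K) (h : eval q (pderiv 1 f) ≠ 0) : rho f q ≤ 1 := by
  by_contra hc
  push Not at hc
  have := (Polynomial.one_lt_rootMultiplicity_iff_isRoot (sp_shape hf (q 0)).1).1 hc
  apply h
  have h2 := this.2
  rwa [sp_deriv, Polynomial.IsRoot, sp_eval, vec_eta] at h2

theorem rho_le (hf : NP d d' f) (q : Fin 2 → K) : rho f q ≤ d' := by
  classical
  refine le_trans ?_ (sp_shape hf (q 0)).2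
  rw [rho, ← Polynomial.count_roots]
  exact (Multiset.count_le_card _ _).trans (Polynomial.card_roots' _)

end

theorem choose_k (s N : ℕ) (R : ℝ) (hN : (N : ℝ) ≤ R) (hR : 1 ≤ R) :
    ∃ k : ℕ, (s : ℝ) ^ 2 / (2 * R) - s / 2 ≤
      ((k * s - N * ∑ e ∈ Finset.range k, (k - e) : ℕ) : ℝ) := by
  have hsumN : ∀ k : ℕ, 2 * ∑ e ∈ Finset.range k, (k - e) = k * (k + 1) := by
    intro k
    have := Finset.sum_range_reflect (fun i => i + 1) k
    have h2 : ∑ e ∈ Finset.range k, (k - e) = ∑ e ∈ Finset.range k, (k - 1 - e + 1) := by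
      refine Finset.sum_congr rfl fun e he => ?_
      rw [Finset.mem_range] at he; omega
    rw [h2, this]
    have h3 := Finset.sum_range_id_mul_two (k + 1)
    rw [Finset.sum_range_succ'] at h3
    simp at h3
    linarith
  rcases Nat.eq_zero_or_pos N with h0 | hpos
  · refine ⟨s, ?_⟩
    rw [h0, zero_mul, Nat.sub_zero]
    push_cast
    have : (s : ℝ) ^ 2 / (2 * R) ≤ (s : ℝ) ^ 2 := div_le_self (by positivity) (by linarith)
    have h3 : (0 : ℝ) ≤ s := by positivity
    nlinarith
  · refine ⟨s / N, ?_⟩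
    set k := s / N with hk
    have hN0 : (0 : ℝ) < N := by exact_mod_cast hpos
    have h1 : N * k ≤ s := Nat.mul_div_le s N
    have h2 : s < N * k + N := by
      have := Nat.lt_div_mul_add (a := s) hpos
      rw [mul_comm]; exact this
    have h1r : (N : ℝ) * k ≤ s := by exact_mod_cast h1
    have h2r : (s : ℝ) < N * k + N := by exact_mod_cast h2
    have hsum := hsumN k
    have hsr : 2 * ((∑ e ∈ Finset.range k, (k - e) : ℕ) : ℝ) = k * (k + 1) := by
      exact_mod_cast hsum
    have h3 : (k : ℝ) * s - N * (∑ e ∈ Finset.range k, (k - e) : ℕ) ≤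
        ((k * s - N * ∑ e ∈ Finset.range k, (k - e) : ℕ) : ℝ) := by
      have := Nat.cast_le (α := ℝ).2 (le_add_tsub :
        k * s ≤ N * ∑ e ∈ Finset.range k, (k - e) + (k * s - N * ∑ e ∈ Finset.range k, (k - e)))
      push_cast at this ⊢
      linarith
    refine le_trans ?_ h3
    have h4 : (s : ℝ) ^ 2 / (2 * R) ≤ (s : ℝ) ^ 2 / (2 * N) := by
      gcongr
    refine (sub_le_sub_right h4 _).trans ?_
    rw [sub_le_iff_le_add, div_le_iff₀ (by positivity)]
    set t : ℝ := s - N * k with ht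
    have hst : (s : ℝ) = t + N * k := by rw [ht]; ring
    have ht0 : 0 ≤ t := by linarith
    have ht1 : t ≤ N := by linarith
    have hsr' : ((∑ e ∈ Finset.range k, (k - e) : ℕ) : ℝ) = k * (k + 1) / 2 := by linarith
    rw [hsr', hst]
    nlinarith [mul_nonneg ht0 (sub_nonneg.2 ht1)]

theorem log_det_lower (D : ℤ) (hD : D ≠ 0)
    (S : Finset ℕ) (hS : ∀ p ∈ S, p.Prime) (E : ℕ → ℝ)
    (h : ∀ p ∈ S, ∃ e : ℕ, E p ≤ e ∧ (p : ℤ) ^ e ∣ D) :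
    ∑ p ∈ S, Real.log p * E p ≤ Real.log |(D : ℝ)| := by
  classical
  have h' : ∀ p, ∃ e : ℕ, p ∈ S → E p ≤ e ∧ (p : ℤ) ^ e ∣ D := by
    intro p
    by_cases hp : p ∈ S
    · obtain ⟨e, he⟩ := h p hp; exact ⟨e, fun _ => he⟩
    · exact ⟨0, fun h => absurd h hp⟩
  choose e he using h'
  have h1 : (∏ p ∈ S, p ^ e p) ∣ D.natAbs := by
    apply Finset.prod_dvd_of_isRelPrime
    · intro p hp q hq hpq
      exact Nat.coprime_iff_isRelPrime.1 (Nat.Coprime.pow _ _ ((Nat.coprime_primes (hS p hp) (hS q hq)).2 hpq))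
    · intro p hp
      have := (he p hp).2
      rw [← Int.natAbs_dvd_natAbs] at this
      simpa [Int.natAbs_pow] using this
  have h2 := Nat.le_of_dvd (Int.natAbs_pos.2 hD) h1
  have h3 : ∑ p ∈ S, Real.log p * E p ≤ Real.log ((∏ p ∈ S, p ^ e p : ℕ) : ℝ) := by
    rw [Nat.cast_prod, Real.log_prod]
    · refine Finset.sum_le_sum fun p hp => ?_
      rw [Nat.cast_pow, Real.log_pow, mul_comm]
      exact mul_le_mul_of_nonneg_right (he p hp).1 (Real.log_natCast_nonneg p)
    · intro p hp
      have := (hS p hp).ne_zero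
      positivity
  refine h3.trans ?_
  have h4 : |(D : ℝ)| = (D.natAbs : ℝ) := by
    rw [Nat.cast_natAbs]; push_cast; rfl
  rw [h4]
  apply Real.log_le_log
  · have : 0 < ∏ p ∈ S, p ^ e p := Nat.pos_of_dvd_of_pos h1 (Int.natAbs_pos.2 hD)
    exact_mod_cast this
  · exact_mod_cast h2

theorem det_upper {J : Type*} [Fintype J] [DecidableEq J] (A : Matrix J J ℤ) (R : J → ℝ)
    (h : ∀ i j, |(A i j : ℝ)| ≤ R i) :
    |(A.det : ℝ)| ≤ (Fintype.card J).factorial * ∏ i, R i := by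
  rw [Matrix.det_apply']
  push_cast
  refine (Finset.abs_sum_le_sum_abs _ _).trans ?_
  have : ∀ σ ∈ (Finset.univ : Finset (Equiv.Perm J)),
      |((Equiv.Perm.sign σ : ℤ) : ℝ) * ∏ i, (A (σ i) i : ℝ)| ≤ ∏ i, R i := by
    intro σ _
    rw [abs_mul, Finset.abs_prod]
    have h1 : |((Equiv.Perm.sign σ : ℤ) : ℝ)| = 1 := by
      rcases Int.units_eq_one_or (Equiv.Perm.sign σ) with h | h <;> simp [h]
    rw [h1, one_mul, ← Equiv.prod_comp σ R]
    exact Finset.prod_le_prod (fun i _ => abs_nonneg _) fun i _ => h _ _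
  refine (Finset.sum_le_sum this).trans ?_
  simp [Fintype.card_perm]

/-- Selecting a nonsingular square submatrix. -/
theorem exists_minor {K J Z : Type*} [Field K] [Fintype J] [DecidableEq J] (A : J → Z → K)
    (h : ∀ c : J → K, (∀ z, ∑ i, c i * A i z = 0) → c = 0) :
    ∃ P : J → Z, (Matrix.of fun i j => A i (P j)).det ≠ 0 := by
  classical
  set col : Z → J → K := fun z i => A i z with hcol
  have hspan : Submodule.span K (Set.range col) = ⊤ := by
    by_contra hne
    obtain ⟨φ, hφ0, hφ⟩ := Submodule.exists_le_ker_of_lt_top _ (lt_top_iff_ne_top.2 hne)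
    apply hφ0
    have hφe : ∀ v : J → K, φ v = ∑ i, φ (Pi.single i 1) * v i := by
      intro v
      conv_lhs => rw [pi_eq_sum_univ' v]
      rw [map_sum]
      refine Finset.sum_congr rfl fun i _ => ?_
      rw [map_smul, smul_eq_mul, mul_comm]
    have hc := h (fun i => φ (Pi.single i 1)) (by
      intro z
      have : φ (col z) = 0 := hφ (Submodule.subset_span ⟨z, rfl⟩)
      rw [hφe] at this
      exact this)
    ext i
    simpa using congrFun hc i
  obtain ⟨b, hb1, hb2, hb3⟩ := exists_linearIndependent K (Set.range col)
  rw [hspan] at hb2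
  let B := Module.Basis.mk hb3 (by rw [Subtype.range_coe, hb2])
  have hfin : Fintype b := FiniteDimensional.fintypeBasisIndex B
  have hcard : Fintype.card J = Fintype.card b := by
    rw [← Module.finrank_eq_card_basis B, Module.finrank_fintype_fun_eq_card]
  let e : J ≃ b := Fintype.equivOfCardEq hcard
  choose P hP using fun x : b => hb1 x.2
  refine ⟨fun j => P (e j), ?_⟩
  have hli : LinearIndependent K (fun j => col (P (e j))) := by
    have : (fun j => col (P (e j))) = (Subtype.val : b → (J → K)) ∘ e := by
      ext j; simp [hP]
    rw [this]
    exact hb3.comp _ e.injective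
  have hu : IsUnit (Matrix.of fun j i => A i (P (e j))) := by
    rw [← Matrix.linearIndependent_rows_iff_isUnit]
    exact hli
  rw [Matrix.isUnit_iff_isUnit_det] at hu
  rw [← Matrix.det_transpose]
  exact hu.ne_zero

end NPC



namespace NPC
open MvPolynomial

theorem minor_int {d d' : ℕ} {f : MvPolynomial (Fin 2) ℤ}
    (hf : NP d d' (f.map (Int.castRingHom ℚ))) (Z : Finset (Fin 2 → ℤ))
    (hZ : ∀ z ∈ Z, eval z f = 0) (J : Finset ℕ) (hJ : ∀ n ∈ J, Gam d d' n ∧ n < Z.card) :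
    ∃ P : J → Fin 2 → ℤ, (∀ j, P j ∈ Z) ∧
      (Matrix.of fun i j : J => eval (P j) (monomial (ex d d' i) (1 : ℤ))).det ≠ 0 := by
  classical
  obtain ⟨l, μ, hl⟩ := exists_lm hf
  let ca : (Fin 2 → ℤ) → Fin 2 → ℚ := fun z i => (z i : ℚ)
  have hca : Function.Injective ca := by
    intro a b h
    ext i
    exact Int.cast_injective (α := ℚ) (congrFun h i)
  have hev : ∀ (z : Fin 2 → ℤ) (g : MvPolynomial (Fin 2) ℤ),
      eval (ca z) (g.map (Int.castRingHom ℚ)) = ((eval z g : ℤ) : ℚ) := by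
    intro z g
    rw [eval_map]
    exact (eval₂_comp (Int.castRingHom ℚ) z g).symm
  obtain ⟨P, hP⟩ := exists_minor (K := ℚ) (J := J) (Z := Z)
    (fun i z => eval (ca z.1) (em ℚ d d' i)) (by
      intro c hc
      by_contra hne
      obtain ⟨i0, hi0⟩ := Function.ne_iff.1 hne
      obtain ⟨a, -, ha⟩ := good_sum (d := d) (d' := d') (l := l) (μ := μ) (Finset.univ : Finset J)
        (fun i => (i : ℕ)) (fun i => em ℚ d d' i)
        (fun i _ => em_good (f := f.map (Int.castRingHom ℚ)) hl (hJ i i.2).1)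
        (fun i _ j _ h => Subtype.ext h) c ⟨i0, Finset.mem_univ _, hi0⟩
      have := bezout hf hl ha (Z.image ca) (by
        intro q hq
        obtain ⟨z, hz, rfl⟩ := Finset.mem_image.1 hq
        rw [hev, hZ z hz]; simp) (by
        intro q hq
        obtain ⟨z, hz, rfl⟩ := Finset.mem_image.1 hq
        rw [map_sum]
        simp only [smul_eval]
        exact hc ⟨z, hz⟩)
      rw [Finset.card_image_of_injective _ hca] at this
      have := (hJ a a.2).2
      omega)
  refine ⟨fun j => (P j).1, fun j => (P j).2, ?_⟩
  intro h0
  apply hP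
  have h1 := congrArg (Int.castRingHom ℚ) h0
  rw [RingHom.map_det, map_zero] at h1
  rw [← h1]
  congr 1
  ext i j
  simp only [Matrix.of_apply, RingHom.mapMatrix_apply, Matrix.map_apply]
  rw [eq_intCast, ← hev, map_monomial]
  simp [em]

theorem lower {d d' : ℕ} {f : MvPolynomial (Fin 2) ℤ} (h0 : 0 < d')
    (h1 : d' < d) (h2 : Nat.Coprime d d')
    (hlow : ∀ m ∈ f.support, m ≠ Finsupp.single 0 d → m ≠ Finsupp.single 1 d' →
          m 0 * d' + m 1 * d < d * d')
    {J : Type*} [Fintype J] [DecidableEq J] (P : J → Fin 2 → ℤ) (hP : ∀ j, eval (P j) f = 0)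
    (g : J → MvPolynomial (Fin 2) ℤ)
    (hD : (Matrix.of fun i j => eval (P j) (g i)).det ≠ 0) (c s : ℕ)
    (hc : c = (f.coeff (Finsupp.single 0 d) * f.coeff (Finsupp.single 1 d')).natAbs)
    (hs : s = Fintype.card J) :
    ∑ p ∈ Sp d c s, Real.log p * ((s : ℝ) ^ 2 / (2 * (p + 7 * d ^ 2 * Real.sqrt p)) - s / 2) ≤
      Real.log |(((Matrix.of fun i j => eval (P j) (g i)).det : ℤ) : ℝ)| := by
  refine log_det_lower _ hD (Sp d c s) ?_ _ ?_
  · intro p hp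
    rw [Sp, Finset.mem_filter, mem_Pr] at hp
    exact hp.1.2
  · intro p hp
    rw [Sp, Finset.mem_filter, mem_Pr] at hp
    haveI : Fact p.Prime := ⟨hp.1.2⟩
    have hpc : ¬ (p : ℤ) ∣ f.coeff (Finsupp.single 0 d) * f.coeff (Finsupp.single 1 d') := by
      rw [Int.natCast_dvd, ← hc]; exact hp.2.2
    have hf : NP d d' (f.map (Int.castRingHom (ZMod p))) := by
      refine np_map h0 h1 h2 hlow _ ?_ ?_
      · rw [eq_intCast, Ne, ZMod.intCast_zmod_eq_zero_iff_dvd]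
        exact fun h => hpc (h.mul_right _)
      · rw [eq_intCast, Ne, ZMod.intCast_zmod_eq_zero_iff_dvd]
        exact fun h => hpc (h.mul_left _)
    have hw := weighted_count hf hp.2.1 (rho (f.map (Int.castRingHom (ZMod p))))
      (fun q hq => rho_zero q hq) (fun q hq => rho_one hf q hq) (fun q => rho_le hf q)
    have hp1 : (1 : ℝ) ≤ p := by exact_mod_cast hp.1.2.one_lt.le
    obtain ⟨k, hk⟩ := choose_k s _ _ hw (by
      have : 0 ≤ 7 * (d : ℝ) ^ 2 * Real.sqrt p := by positivity
      linarith)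
    refine ⟨_, hk, ?_⟩
    rw [hs]
    exact det_div p k f _ (fun q => rfl) (fun a => (sp_shape hf a).1) P hP g

theorem upper {d d' : ℕ} (hd : 0 < d) (B : ℝ) (hB : 1 ≤ B) (J : Finset ℕ) (M : ℕ)
    (hJ : ∀ n ∈ J, Gam d d' n ∧ n < M) (P : J → Fin 2 → ℤ) (hP : ∀ j i, |(P j i : ℝ)| ≤ B)
    (hD : (Matrix.of fun i j : J => eval (P j) (monomial (ex d d' i) (1 : ℤ))).det ≠ 0) :
    Real.log |(((Matrix.of fun i j : J =>
      eval (P j) (monomial (ex d d' i) (1 : ℤ))).det : ℤ) : ℝ)| ≤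
      (J.card : ℝ) * Real.log J.card + Real.log B * (d * M + (M : ℝ) ^ 2 / (2 * d)) := by
  have hB0 : 0 < B := by linarith
  have hd0 : (0 : ℝ) < d := by exact_mod_cast hd
  have hL : 0 ≤ Real.log B := Real.log_nonneg hB
  have h1 := det_upper (Matrix.of fun i j : J => eval (P j) (monomial (ex d d' i) (1 : ℤ)))
    (fun i => B ^ (ex d d' i 0 + ex d d' i 1)) (by
      intro i j
      rw [Matrix.of_apply, eval_monomial, Finsupp.prod_fintype _ _ (by simp)]
      simp only [Fin.prod_univ_two, one_mul]
      push_cast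
      rw [abs_mul, abs_pow, abs_pow, pow_add]
      gcongr
      · exact hP j 0
      · exact hP j 1)
  have hpos : 0 < |(((Matrix.of fun i j : J =>
      eval (P j) (monomial (ex d d' i) (1 : ℤ))).det : ℤ) : ℝ)| :=
    abs_pos.2 (by exact_mod_cast hD)
  refine (Real.log_le_log hpos h1).trans ?_
  have hf0 : (0 : ℝ) < ((Fintype.card J).factorial : ℝ) := by
    exact_mod_cast Nat.factorial_pos _
  rw [Real.log_mul hf0.ne' (Finset.prod_ne_zero_iff.2 fun i _ => by positivity),
    Real.log_prod (fun i _ => by positivity)]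
  refine add_le_add ?_ ?_
  · rw [Fintype.card_coe]
    rw [Fintype.card_coe] at hf0
    have : ((J.card).factorial : ℝ) ≤ (J.card : ℝ) ^ J.card := by
      exact_mod_cast Nat.factorial_le_pow J.card
    rw [← Real.log_pow]
    exact Real.log_le_log hf0 this
  · have hi : ∀ i : J, Real.log (B ^ (ex d d' i 0 + ex d d' i 1)) ≤
        Real.log B * (d + ((i : ℕ) : ℝ) / d) := by
      intro i
      rw [Real.log_pow, mul_comm]
      refine mul_le_mul_of_nonneg_left ?_ hL
      obtain ⟨e1, e2⟩ := ex_spec (hJ i i.2).1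
      push_cast
      refine add_le_add (by exact_mod_cast e1.le) ?_
      rw [le_div_iff₀ hd0]
      rw [wt] at e2
      exact_mod_cast (show ex d d' i 1 * d ≤ i by omega)
    refine (Finset.sum_le_sum fun i _ => hi i).trans ?_
    rw [← Finset.mul_sum]
    refine mul_le_mul_of_nonneg_left ?_ hL
    rw [Finset.sum_coe_sort J (fun i : ℕ => (d : ℝ) + (i : ℝ) / d)]
    have hsub : J ⊆ Finset.range M := fun n hn => Finset.mem_range.2 (hJ n hn).2
    refine (Finset.sum_le_sum_of_subset_of_nonneg hsub fun i _ _ => by positivity).trans ?_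
    rw [Finset.sum_add_distrib, ← Finset.sum_div]
    refine add_le_add (by simp [mul_comm]) ?_
    have hg : 2 * ∑ i ∈ Finset.range M, (i : ℝ) ≤ (M : ℝ) ^ 2 := by
      have := Finset.sum_range_id_mul_two M
      have h3 : (∑ i ∈ Finset.range M, i) * 2 ≤ M ^ 2 := by
        rw [this, sq]; exact Nat.mul_le_mul_left _ (Nat.sub_le _ _)
      have h4 : ((∑ i ∈ Finset.range M, i : ℕ) : ℝ) * 2 ≤ (M : ℝ) ^ 2 := by exact_mod_cast h3
      push_cast at h4
      linarith
    rw [div_le_div_iff₀ hd0 (by positivity)]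
    nlinarith

theorem main : ∃ c : ℝ, 0 < c ∧ ∀ (d d' : ℕ) (f : MvPolynomial (Fin 2) ℤ) (B : ℝ),
    0 < d' → d' < d → Nat.Coprime d d' →
    f.coeff (Finsupp.single 0 d) ≠ 0 →
    f.coeff (Finsupp.single 1 d') ≠ 0 →
    (∀ m ∈ f.support, m ≠ Finsupp.single 0 d → m ≠ Finsupp.single 1 d' →
      m 0 * d' + m 1 * d < d * d') →
    1 ≤ B → ∀ Z : Finset (Fin 2 → ℤ), (∀ z ∈ Z, (∀ i, |(z i : ℝ)| ≤ B) ∧ eval z f = 0) →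
    (Z.card : ℝ) ≤ c * (d : ℝ) ^ 4 *
      (Real.log |((f.coeff (Finsupp.single 0 d) * f.coeff (Finsupp.single 1 d') : ℤ) : ℝ)| + 1) *
      B ^ ((1 : ℝ) / d) := by
  classical
  obtain ⟨C, hC⟩ := analytic
  refine ⟨Real.exp (C + 9) + 2, by positivity, ?_⟩
  intro d d' f B h0 h1 h2 ha hb hlow hB Z hZ
  have hd : 0 < d := by omega
  have hd1 : (1 : ℝ) ≤ d := by exact_mod_cast hd
  set b : ℝ := B ^ ((1 : ℝ) / d) with hbdef
  have hb1 : 1 ≤ b := Real.one_le_rpow hB (by positivity)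
  set c : ℕ := (f.coeff (Finsupp.single 0 d) * f.coeff (Finsupp.single 1 d')).natAbs with hcdef
  have hc0 : c ≠ 0 := Int.natAbs_ne_zero.2 (mul_ne_zero ha hb)
  have habs : |((f.coeff (Finsupp.single 0 d) * f.coeff (Finsupp.single 1 d') : ℤ) : ℝ)| =
      (c : ℝ) := by
    rw [hcdef, Nat.cast_natAbs, Int.cast_abs]
  rw [habs]
  have hlc : 0 ≤ Real.log c := Real.log_natCast_nonneg c
  set X : ℝ := (d : ℝ) ^ 4 * (1 + Real.log c) with hX
  have hd4 : (1 : ℝ) ≤ (d : ℝ) ^ 4 := one_le_pow₀ hd1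
  have hd24 : (d : ℝ) ^ 2 ≤ (d : ℝ) ^ 4 := pow_le_pow_right₀ hd1 (by norm_num)
  have hX1 : (d : ℝ) ^ 2 ≤ X := by rw [hX]; nlinarith
  have hX0 : 0 < X := by positivity
  have hgoal : (Real.exp (C + 9) + 2) * (d : ℝ) ^ 4 * (Real.log c + 1) * b =
      Real.exp (C + 9) * X * b + 2 * X * b := by rw [hX]; ring
  rw [hgoal]
  have hE : 0 ≤ Real.exp (C + 9) * X * b := by positivity
  have hXb : (d : ℝ) ^ 2 * b ≤ X * b := by gcongr
  have hdb : (d : ℝ) ^ 2 ≤ (d : ℝ) ^ 2 * b := le_mul_of_one_le_right (by positivity) hb1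
  by_cases hsmall : (Z.card : ℝ) ≤ 2 * (d : ℝ) ^ 2 * b
  · linarith
  push Not at hsmall
  set J := (Finset.range Z.card).filter (Gam d d') with hJdef
  have hJ : ∀ n ∈ J, Gam d d' n ∧ n < Z.card := by
    intro n hn
    rw [hJdef, Finset.mem_filter, Finset.mem_range] at hn
    exact ⟨hn.2, hn.1⟩
  have hcard : (Z.card : ℝ) ≤ J.card + (d : ℝ) ^ 2 := by
    have h3 := card_gam hd h2 Z.card
    have h4 : d * d' ≤ d ^ 2 := by rw [sq]; exact Nat.mul_le_mul_left _ h1.le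
    have h5 : Z.card ≤ J.card + d ^ 2 := by rw [hJdef]; omega
    exact_mod_cast h5
  have hs : (d : ℝ) ^ 2 * b ≤ J.card := by linarith
  have hs1 : 1 ≤ J.card := by
    have : (1 : ℝ) ≤ J.card := by nlinarith
    exact_mod_cast this
  have hfQ : NP d d' (f.map (Int.castRingHom ℚ)) :=
    np_map h0 h1 h2 hlow _ (by simpa using ha) (by simpa using hb)
  obtain ⟨P, hPZ, hD⟩ := minor_int hfQ Z (fun z hz => (hZ z hz).2) J hJ
  have hup := upper hd B hB J Z.card hJ P (fun j i => (hZ _ (hPZ j)).1 i) hD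
  have hlo := lower h0 h1 h2 hlow P (fun j => (hZ _ (hPZ j)).2)
    (fun i : J => monomial (ex d d' i) (1 : ℤ)) hD c J.card hcdef (Fintype.card_coe J).symm
  have han := hC d J.card c hd hs1 hc0
  have hfin := (han.trans hlo).trans hup
  have hlogX : Real.log X = Real.log ((d : ℝ) ^ 4) + Real.log (1 + Real.log c) := by
    rw [hX, Real.log_mul (by positivity) (by positivity)]
  have hLb : Real.log B = d * Real.log b := by
    rw [hbdef, Real.log_rpow (by linarith)]
    field_simp
  have := final_ineq (s := J.card) (M1 := Z.card) (d := d) (b := b) (L := Real.log B) (X := X)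
    (C := C) hd1 hb1 hLb hs hcard (by positivity) hX0 (by
      rw [hlogX]
      refine le_trans (le_of_eq ?_) hfin
      ring)
  nlinarith

end NPC


/-- **Curves with indecomposable Newton polygon.** There is an absolute constant
`c > 0` such that for all coprime integers `d > d' > 0`, all nonzero integers
`c_d, c_{d'}`, and every `f ∈ ℤ[x_1,x_2]` of the form
`f = c_d·x_1^d + c_{d'}·x_2^{d'} + Σ_{i·d' + i'·d < d·d'} c_{i,i'}·x_1^i·x_2^{i'}`,
one has `N_aff(f,B) ≤ c·d^4·(log|c_d·c_{d'}| + 1)·B^(1/d)` for every `B ≥ 1`. -/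
theorem newton_polygon_curve_bound :
    ∃ c : ℝ, 0 < c ∧
      ∀ (d d' : ℕ) (f : MvPolynomial (Fin 2) ℤ) (B : ℝ),
        0 < d' → d' < d → Nat.Coprime d d' →
        f.coeff (Finsupp.single 0 d) ≠ 0 →
        f.coeff (Finsupp.single 1 d') ≠ 0 →
        (∀ m ∈ f.support, m ≠ Finsupp.single 0 d → m ≠ Finsupp.single 1 d' →
          m 0 * d' + m 1 * d < d * d') →
        1 ≤ B →
        (Naff f B : ℝ) ≤
          c * (d : ℝ) ^ 4 *
            (Real.log |((f.coeff (Finsupp.single 0 d) * f.coeff (Finsupp.single 1 d') : ℤ) : ℝ)| + 1) *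
            B ^ ((1 : ℝ) / d) := by
  obtain ⟨c, hc, h⟩ := NPC.main
  refine ⟨c, hc, ?_⟩
  intro d d' f B h0 h1 h2 ha hb hlow hB
  rw [Naff]
  by_cases hfin : {x : Fin 2 → ℤ | (∀ i, |(x i : ℝ)| ≤ B) ∧ MvPolynomial.eval x f = 0}.Finite
  · rw [Set.ncard_eq_toFinset_card _ hfin]
    refine h d d' f B h0 h1 h2 ha hb hlow hB hfin.toFinset ?_
    intro z hz
    exact hfin.mem_toFinset.1 hz
  · rw [Set.Infinite.ncard hfin]
    have := h d d' f B h0 h1 h2 ha hb hlow hB ∅ (by simp)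
    simpa using this
end
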